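/- Let f ∈ ℝ[x,y,z] be homogeneous of degree 4 defining a smooth complex plane quartic Q = V(f), and let L∞ be a real bitangent of Q. Then every real bitangent L ≠ L∞ of Q has its tangency points off L∞, so its Qtype relative to L∞ is defined, and (number of real bitangents L ≠ L∞ with Qtype_{L∞}(L) = +1) − (number of real bitangents L ≠ L∞ with Qtype_{L∞}(L) = −1) = 3. -/

import Mathlib

open MvPolynomial

noncomputable section

/-- Complexification of a real ternary polynomial. -/
def cmap (f : MvPolynomial (Fin 3) ℝ) : MvPolynomial (Fin 3) ℂ :=
  MvPolynomial.map (algebraMap ℝ ℂ) f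

/-- Evaluation of the complexification of `f` at a complex point. -/
def cev (f : MvPolynomial (Fin 3) ℝ) (p : Fin 3 → ℂ) : ℂ :=
  eval p (cmap f)

/-- The linear form with coefficient vector `ℓ`, evaluated at `p`. -/
def lin {R : Type*} [CommSemiring R] (ℓ p : Fin 3 → R) : R := ∑ i, ℓ i * p i

/-- The complexification of a real vector. -/
def cvec (v : Fin 3 → ℝ) : Fin 3 → ℂ := fun i => (v i : ℂ)

/-- Smoothness of the complex plane curve V(f): the gradient is nonzero at every
nonzero complex zero of `f`. -/
def SmoothQuartic (f : MvPolynomial (Fin 3) ℝ) : Prop :=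
  ∀ p : Fin 3 → ℂ, p ≠ 0 → cev f p = 0 → ∃ i, eval p (pderiv i (cmap f)) ≠ 0

/-- The line `V(ℓ)` is a bitangent of `V(f)` with tangency points `z₁, z₂`:
the restriction of `f` to the line is a nonzero scalar multiple of the square of a
nonzero quadratic form on the line, whose zeros (with multiplicity) are `z₁, z₂`.
Over ℂ the quadratic form is written as the product of two linear forms `m₁, m₂`,
each nonzero on the line and vanishing at the corresponding tangency point. -/
def IsBitangentAt (f : MvPolynomial (Fin 3) ℝ) (ℓ z₁ z₂ : Fin 3 → ℂ) : Prop :=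
  ℓ ≠ 0 ∧ z₁ ≠ 0 ∧ z₂ ≠ 0 ∧ lin ℓ z₁ = 0 ∧ lin ℓ z₂ = 0 ∧
  ∃ (m₁ m₂ : Fin 3 → ℂ) (c : ℂ), c ≠ 0 ∧
    lin m₁ z₁ = 0 ∧ lin m₂ z₂ = 0 ∧
    (∃ p, lin ℓ p = 0 ∧ lin m₁ p ≠ 0) ∧
    (∃ p, lin ℓ p = 0 ∧ lin m₂ p ≠ 0) ∧
    (∀ p, lin ℓ p = 0 → cev f p = c * (lin m₁ p * lin m₂ p) ^ 2)

/-- The line `V(ℓ)` is a bitangent of the quartic `V(f)`. -/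
def IsBitangent (f : MvPolynomial (Fin 3) ℝ) (ℓ : Fin 3 → ℂ) : Prop :=
  ∃ z₁ z₂, IsBitangentAt f ℓ z₁ z₂

/-- The set of real bitangent lines of `V(f)`, as points of the real projective
plane of lines. -/
def realBitangents (f : MvPolynomial (Fin 3) ℝ) :
    Set (Projectivization ℝ (Fin 3 → ℝ)) :=
  {L | IsBitangent f (cvec L.rep)}

/-- Directional derivative of (the complexification of) `f` along the real vector `v`. -/
def Dv (f : MvPolynomial (Fin 3) ℝ) (v : Fin 3 → ℝ) (z : Fin 3 → ℂ) : ℂ :=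
  ∑ i, (v i : ℂ) * eval z (pderiv i (cmap f))

/-- `Qtype_{L∞}(L) = ε ∈ {+1, -1}` for the real bitangent `L = V(ℓ)` of `V(f)`,
relative to the real line at infinity `V(ℓinf)`: for tangency points normalized so
that `ℓ∞(z̃ᵢ) = 1` and any real `v` with `ℓ(v) ≠ 0`, the product
`(D_v f)(z̃₁)·(D_v f)(z̃₂)` is a nonzero real number of sign `ε`. -/
def HasQtype (f : MvPolynomial (Fin 3) ℝ) (ℓinf : Fin 3 → ℝ) (ℓ : Fin 3 → ℂ)
    (ε : ℤ) : Prop :=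
  ∃ (z₁ z₂ : Fin 3 → ℂ) (v : Fin 3 → ℝ) (r : ℝ),
    IsBitangentAt f ℓ z₁ z₂ ∧
    lin (cvec ℓinf) z₁ = 1 ∧ lin (cvec ℓinf) z₂ = 1 ∧
    lin ℓ (cvec v) ≠ 0 ∧
    Dv f v z₁ * Dv f v z₂ = (r : ℂ) ∧
    ((0 < r ∧ ε = 1) ∨ (r < 0 ∧ ε = -1))

/-- A point of ℙ²(ℂ) (given by a nonzero vector) is real. -/
def IsRealPoint (z : Fin 3 → ℂ) : Prop :=
  ∃ (w : Fin 3 → ℝ) (t : ℂ), w ≠ 0 ∧ t ≠ 0 ∧ z = t • cvec w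

section Frames
variable {k V : Type*} [Field k] [AddCommGroup V] [Module k V]

/-- Two linearly independent vectors. -/
def Indep2 (k : Type*) {V : Type*} [Field k] [AddCommGroup V] [Module k V] (a b : V) : Prop :=
  ∀ x y : k, x • a + y • b = 0 → x = 0 ∧ y = 0

/-- Four linearly independent vectors. -/
def Frame (k : Type*) {V : Type*} [Field k] [AddCommGroup V] [Module k V] (a b c d : V) : Prop :=
  ∀ x y s t : k, x • a + y • b + s • c + t • d = 0 → x = 0 ∧ y = 0 ∧ s = 0 ∧ t = 0

theorem indep2_iff {a b : V} : Indep2 k a b ↔ LinearIndependent k ![a, b] :=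
  LinearIndependent.pair_iff.symm

theorem frame_iff {a b c d : V} : Frame k a b c d ↔ LinearIndependent k ![a, b, c, d] := by
  rw [Fintype.linearIndependent_iff]
  constructor
  · intro h g hg
    simp only [Fin.sum_univ_four] at hg
    have := h (g 0) (g 1) (g 2) (g 3) hg
    intro i
    fin_cases i <;> simp [this]
  · intro h x y s t hx
    have := h ![x, y, s, t] (by simpa [Fin.sum_univ_four] using hx)
    exact ⟨this 0, this 1, this 2, this 3⟩

theorem Frame.coords (hV : Module.finrank k V = 4) {a b c d : V} (h : Frame k a b c d) (w : V) :
    ∃ x y s t : k, w = x • a + y • b + s • c + t • d := by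
  have : FiniteDimensional k V := FiniteDimensional.of_finrank_pos (by omega)
  have hs := (frame_iff.1 h).span_eq_top_of_card_eq_finrank' (by simp [hV])
  have hw : w ∈ Submodule.span k (Set.range ![a, b, c, d]) := hs ▸ Submodule.mem_top
  obtain ⟨g, hg⟩ := (Submodule.mem_span_range_iff_exists_fun k).1 hw
  refine ⟨g 0, g 1, g 2, g 3, ?_⟩
  rw [← hg]
  simp [Fin.sum_univ_four]

theorem Frame.indep {a b c d : V} (h : Frame k a b c d) : Indep2 k a b := fun x y hx => by
  obtain ⟨h1, h2, -, -⟩ := h x y 0 0 (by simpa using hx)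
  exact ⟨h1, h2⟩

theorem exists_frame_of_notMem (hV : Module.finrank k V = 4) {a b c : V} (h : Indep2 k a b)
    (hc : c ∉ Submodule.span k {a, b}) : ∃ d, Frame k a b c d := by
  have h3 : LinearIndependent k ![c, a, b] := by
    refine linearIndependent_finCons.2 ⟨indep2_iff.1 h, ?_⟩
    simpa [Set.pair_comm] using hc
  have h3' : LinearIndependent k ![a, b, c] := by
    have := h3.comp ![1, 2, 0] (by decide)
    convert this using 1
    ext i; fin_cases i <;> rfl
  obtain ⟨d, hd⟩ := exists_linearIndependent_snoc_of_lt_finrank h3' (by omega)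
  have he : Fin.snoc ![a, b, c] d = ![a, b, c, d] := by
    ext i; fin_cases i <;> rfl
  exact ⟨d, frame_iff.2 (he ▸ hd)⟩

theorem exists_frame (hV : Module.finrank k V = 4) {a b : V} (h : Indep2 k a b) :
    ∃ c d, Frame k a b c d := by
  obtain ⟨c, hc⟩ := exists_linearIndependent_snoc_of_lt_finrank (indep2_iff.1 h) (by omega)
  have := (linearIndependent_finSnoc.1 hc).2
  obtain ⟨d, hd⟩ := exists_frame_of_notMem hV (c := c) h (by simpa [Set.pair_comm] using this)
  exact ⟨c, d, hd⟩

theorem finrank_span_pair {a b : V} (h : Indep2 k a b) :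
    Module.finrank k (Submodule.span k ({a, b} : Set V)) = 2 := by
  have e : ({a, b} : Set V) = Set.range ![a, b] := by
    ext x; simp [Matrix.range_cons, Matrix.range_empty, or_comm]
  rw [e]
  simpa using finrank_span_eq_card (indep2_iff.1 h)

theorem Frame.notMem_span {a b c d : V} (h : Frame k a b c d) {s t : k} (hst : ¬ (s = 0 ∧ t = 0))
    (e : V) (he : e ∈ Submodule.span k {a, b}) : e + s • c + t • d ∉ Submodule.span k {a, b} := by
  intro h1
  obtain ⟨x, y, rfl⟩ := Submodule.mem_span_pair.1 he
  obtain ⟨x', y', h2⟩ := Submodule.mem_span_pair.1 h1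
  have h3 : (x - x') • a + (y - y') • b + s • c + t • d = 0 := by
    rw [← sub_eq_zero] at h2
    rw [← neg_eq_zero, ← h2]
    module
  obtain ⟨-, -, h3, h4⟩ := h _ _ _ _ h3
  exact hst ⟨h3, h4⟩

theorem span_pair_eq_of_mem {E : Submodule k V} (hE : Module.finrank k E = 2) {a b : V}
    (ha : a ∈ E) (hb : b ∈ E) (h : Indep2 k a b) : E = Submodule.span k {a, b} := by
  have hfin : FiniteDimensional k E := FiniteDimensional.of_finrank_pos (by omega)
  symm
  apply Submodule.eq_of_le_of_finrank_eq
  · rw [Submodule.span_le]; rintro x (rfl | rfl) <;> assumption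
  · rw [finrank_span_pair h, hE]

/-- A two-dimensional subspace is spanned by any of its nonzero vectors and another one. -/
theorem exists_pair_of_finrank_two {E : Submodule k V} (hE : Module.finrank k E = 2) {a : V}
    (ha : a ∈ E) (ha0 : a ≠ 0) : ∃ b ∈ E, Indep2 k a b ∧ E = Submodule.span k {a, b} := by
  have hfin : FiniteDimensional k E := FiniteDimensional.of_finrank_pos (by omega)
  obtain ⟨b, hb, hb'⟩ : ∃ b ∈ E, b ∉ Submodule.span k {a} := by
    by_contra! hc
    have h1 := Submodule.finrank_mono (show E ≤ Submodule.span k {a} from hc)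
    rw [finrank_span_singleton ha0] at h1
    omega
  have hi : Indep2 k a b := by
    intro x y hxy
    have hy : y = 0 := by
      by_contra hy
      refine hb' (Submodule.mem_span_singleton.2 ⟨-(y⁻¹ * x), ?_⟩)
      have := congrArg (y⁻¹ • ·) hxy
      simp only [smul_add, smul_smul, inv_mul_cancel₀ hy, one_smul, smul_zero] at this
      rw [neg_smul, neg_eq_iff_add_eq_zero, this]
    subst hy
    simpa [ha0] using hxy
  exact ⟨b, hb, hi, span_pair_eq_of_mem hE ha hb hi⟩

end Frames

section Tri
variable {k V : Type*} [Field k] [AddCommGroup V] [Module k V]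

/-- Symmetric trilinear forms. -/
structure SymTri (T : V →ₗ[k] V →ₗ[k] V →ₗ[k] k) : Prop where
  left : ∀ a b c, T a b c = T b a c
  right : ∀ a b c, T a b c = T a c b

/-- `E` is a line of the projective cubic surface `T(x,x,x) = 0`. -/
def OnCubic (T : V →ₗ[k] V →ₗ[k] V →ₗ[k] k) (E : Submodule k V) : Prop :=
  Module.finrank k E = 2 ∧ ∀ x ∈ E, T x x x = 0

theorem SymTri.polar [CharZero k] {T : V →ₗ[k] V →ₗ[k] V →ₗ[k] k} (hT : SymTri T)
    {E : Submodule k V} (hE : ∀ x ∈ E, T x x x = 0) {x y z : V} (hx : x ∈ E) (hy : y ∈ E)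
    (hz : z ∈ E) : T x y z = 0 := by
  have h1 := hE _ hx
  have h2 := hE _ hy
  have h3 := hE _ hz
  have h4 := hE _ (E.add_mem hx hy)
  have h5 := hE _ (E.add_mem hx hz)
  have h6 := hE _ (E.add_mem hy hz)
  have h7 := hE _ (E.add_mem (E.add_mem hx hy) hz)
  simp only [map_add, LinearMap.add_apply] at h4 h5 h6 h7
  have e1 := hT.left y x z
  have e2 := hT.right x z y
  have e3 := hT.left z x y
  have e4 := hT.right y z x
  have e5 := hT.left z y x
  have h6 : 6 * T x y z = 0 := by
    linear_combination h7 - h4 - h5 - h6 + h1 + h2 + h3 - 3 * e1 - 2 * e2 - e3 - 2 * e4 - e5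
  simpa using h6

theorem polar_span [CharZero k] {T : V →ₗ[k] V →ₗ[k] V →ₗ[k] k} (hT : SymTri T)
    {a b : V} (h0 : T a a a = 0) (h1 : T a a b = 0) (h2 : T a b b = 0) (h3 : T b b b = 0) :
    ∀ x ∈ Submodule.span k {a, b}, T x x x = 0 := by
  intro x hx
  obtain ⟨s, t, rfl⟩ := Submodule.mem_span_pair.1 hx
  simp only [map_add, map_smul, LinearMap.add_apply, LinearMap.smul_apply, smul_eq_mul,
    hT.left b a, hT.right b b a, hT.right a b a, h0, h1, h2, h3]
  ring

theorem onCubic_span [CharZero k] {T : V →ₗ[k] V →ₗ[k] V →ₗ[k] k} (hT : SymTri T)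
    {a b : V} (hab : Indep2 k a b)
    (h0 : T a a a = 0) (h1 : T a a b = 0) (h2 : T a b b = 0) (h3 : T b b b = 0) :
    OnCubic T (Submodule.span k {a, b}) :=
  ⟨finrank_span_pair hab, polar_span hT h0 h1 h2 h3⟩

end Tri

section Scalars

theorem exists_kernel_two {k : Type*} [Field k] {p q r : k} (h : p * r - q ^ 2 = 0) :
    ∃ x y : k, ¬ (x = 0 ∧ y = 0) ∧ p * x + q * y = 0 ∧ q * x + r * y = 0 := by
  by_cases hp : p = 0 ∧ q = 0
  · obtain ⟨rfl, rfl⟩ := hp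
    exact ⟨1, 0, by simp, by simp, by simp⟩
  · exact ⟨q, -p, fun h => hp ⟨by simpa using h.2, h.1⟩, by ring, by linear_combination -h⟩

theorem exists_binary_quadratic_zero_iff {P Q R : ℝ} :
    (∃ s t : ℝ, ¬ (s = 0 ∧ t = 0) ∧ P * s ^ 2 + Q * (s * t) + R * t ^ 2 = 0) ↔
      0 ≤ Q ^ 2 - 4 * P * R := by
  constructor
  · rintro ⟨s, t, hst, h⟩
    rcases eq_or_ne t 0 with rfl | ht
    · have hs : s ≠ 0 := fun h => hst ⟨h, rfl⟩
      have : P = 0 := by simpa [hs] using h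
      subst this; nlinarith [sq_nonneg Q]
    · have : t ^ 2 * (Q ^ 2 - 4 * P * R) = (2 * P * s + Q * t) ^ 2 := by
        linear_combination -4 * P * h
      by_contra hneg
      push Not at hneg
      nlinarith [sq_nonneg (2 * P * s + Q * t), mul_pos_of_neg_of_neg hneg hneg,
        sq_pos_of_ne_zero ht]
  · intro h
    rcases eq_or_ne P 0 with rfl | hP
    · exact ⟨1, 0, by simp, by simp⟩
    · refine ⟨-Q + √(Q ^ 2 - 4 * P * R), 2 * P, by simp [hP], ?_⟩
      linear_combination P * Real.sq_sqrt h

theorem exists_complex_quadratic_zero (p q r : ℂ) :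
    ∃ x y : ℂ, ¬ (x = 0 ∧ y = 0) ∧ p * x ^ 2 + 2 * q * (x * y) + r * y ^ 2 = 0 := by
  rcases eq_or_ne p 0 with rfl | hp
  · exact ⟨1, 0, by simp, by simp⟩
  · obtain ⟨w, hw⟩ := IsAlgClosed.exists_pow_nat_eq (q ^ 2 - p * r) two_pos
    exact ⟨-q + w, p, by simp [hp], by linear_combination p * hw⟩

/-- Two binary quadratics with vanishing resultant have a common zero. -/
theorem exists_common_zero_of_res {a0 a1 a2 b0 b1 b2 : ℂ}
    (h : (a0 * b2 + a2 * b0 - 2 * a1 * b1) ^ 2 -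
      4 * (a0 * a2 - a1 ^ 2) * (b0 * b2 - b1 ^ 2) = 0) :
    ∃ x y : ℂ, ¬ (x = 0 ∧ y = 0) ∧ a0 * x ^ 2 + 2 * a1 * (x * y) + a2 * y ^ 2 = 0 ∧
      b0 * x ^ 2 + 2 * b1 * (x * y) + b2 * y ^ 2 = 0 := by
  obtain ⟨c, hc⟩ : ∃ c, c = a0 * b1 - a1 * b0 := ⟨_, rfl⟩
  obtain ⟨d, hd⟩ : ∃ d, d = a0 * b2 - a2 * b0 := ⟨_, rfl⟩
  obtain ⟨e, he⟩ : ∃ e, e = a1 * b2 - a2 * b1 := ⟨_, rfl⟩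
  have hr : d ^ 2 - 4 * c * e = 0 := by subst hc hd he; linear_combination h
  have ha : a0 * e - a1 * d + a2 * c = 0 := by subst hc hd he; ring
  have hb : b0 * e - b1 * d + b2 * c = 0 := by subst hc hd he; ring
  by_cases h1 : d = 0 ∧ c = 0
  · obtain ⟨hd0, hc0⟩ := h1
    by_cases he0 : e = 0
    · by_cases hA : a0 = 0 ∧ a1 = 0 ∧ a2 = 0
      · obtain ⟨rfl, rfl, rfl⟩ := hA
        obtain ⟨x, y, hxy, hq⟩ := exists_complex_quadratic_zero b0 b1 b2
        exact ⟨x, y, hxy, by ring, hq⟩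
      · obtain ⟨x, y, hxy, hq⟩ := exists_complex_quadratic_zero a0 a1 a2
        refine ⟨x, y, hxy, hq, ?_⟩
        have h0 : a0 * (b0 * x ^ 2 + 2 * b1 * (x * y) + b2 * y ^ 2) = 0 := by
          linear_combination b0 * hq + 2 * x * y * (hc0 - hc) + y ^ 2 * (hd0 - hd)
        have h1 : a1 * (b0 * x ^ 2 + 2 * b1 * (x * y) + b2 * y ^ 2) = 0 := by
          linear_combination b1 * hq - x ^ 2 * (hc0 - hc) + y ^ 2 * (he0 - he)
        have h2 : a2 * (b0 * x ^ 2 + 2 * b1 * (x * y) + b2 * y ^ 2) = 0 := by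
          linear_combination b2 * hq - x ^ 2 * (hd0 - hd) - 2 * x * y * (he0 - he)
        by_contra hne
        exact hA ⟨by simpa [hne] using h0, by simpa [hne] using h1, by simpa [hne] using h2⟩
    · refine ⟨2 * e, -d, by simp [he0], ?_, ?_⟩
      · linear_combination 4 * e * ha + a2 * hr
      · linear_combination 4 * e * hb + b2 * hr
  · refine ⟨d, -2 * c, by simpa using h1, ?_, ?_⟩
    · linear_combination 4 * c * ha + a0 * hr
    · linear_combination 4 * c * hb + b0 * hr

end Scalars

section Real
variable {V : Type*} [AddCommGroup V] [Module ℝ V]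

/-- The complexification of the cubic surface `T(x,x,x) = 0` is smooth. -/
def SmoothTri (T : V →ₗ[ℝ] V →ₗ[ℝ] V →ₗ[ℝ] ℝ) : Prop :=
  ∀ x y, (∀ w, T x x w = T y y w ∧ T x y w = 0) → x = 0 ∧ y = 0

/-- Hyperbolic lines (in the sense of Segre). -/
def Hyp (T : V →ₗ[ℝ] V →ₗ[ℝ] V →ₗ[ℝ] ℝ) (E : Submodule ℝ V) : Prop :=
  ∃ n ∉ E, ∃ x ∈ E, x ≠ 0 ∧ ∀ e ∈ E, T x e n = 0

open Classical in
/-- The Segre sign of a line. -/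
def segre (T : V →ₗ[ℝ] V →ₗ[ℝ] V →ₗ[ℝ] ℝ) (E : Submodule ℝ V) : ℤ := if Hyp T E then 1 else -1

theorem SmoothTri.pair {T : V →ₗ[ℝ] V →ₗ[ℝ] V →ₗ[ℝ] ℝ} (hT : SymTri T) (hs : SmoothTri T)
    {a b : V} (hab : Indep2 ℝ a b) {X Y : ℂ}
    (h : ∀ w, (T a a w : ℂ) * X ^ 2 + 2 * (T a b w : ℂ) * (X * Y) + (T b b w : ℂ) * Y ^ 2 = 0) :
    X = 0 ∧ Y = 0 := by
  have := hs (X.re • a + Y.re • b) (X.im • a + Y.im • b) (fun w => by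
    have h1 := congrArg Complex.re (h w)
    have h2 := congrArg Complex.im (h w)
    simp [pow_two] at h1 h2
    simp only [map_add, map_smul, LinearMap.add_apply, LinearMap.smul_apply, smul_eq_mul,
      hT.left b a]
    constructor
    · linear_combination h1
    · linear_combination h2 / 2)
  obtain ⟨h1, h2⟩ := hab _ _ this.1
  obtain ⟨h3, h4⟩ := hab _ _ this.2
  exact ⟨Complex.ext h1 h3, Complex.ext h2 h4⟩

/-- The resultant of the two quadratic forms `T(·,·,m)` and `T(·,·,n)` on `⟨a, b⟩`. -/
def resTri (T : V →ₗ[ℝ] V →ₗ[ℝ] V →ₗ[ℝ] ℝ) (a b m n : V) : ℝ :=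
  (T a a m * T b b n + T b b m * T a a n - 2 * T a b m * T a b n) ^ 2 -
    4 * (T a a m * T b b m - T a b m ^ 2) * (T a a n * T b b n - T a b n ^ 2)

theorem hyp_iff {T : V →ₗ[ℝ] V →ₗ[ℝ] V →ₗ[ℝ] ℝ} (hV : Module.finrank ℝ V = 4) (hT : SymTri T)
    {a b m n : V} (hE : ∀ x ∈ Submodule.span ℝ {a, b}, T x x x = 0) (hf : Frame ℝ a b m n) :
    Hyp T (Submodule.span ℝ {a, b}) ↔ 0 ≤ resTri T a b m n := by
  have ha : a ∈ Submodule.span ℝ {a, b} := Submodule.subset_span (by simp)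
  have hb : b ∈ Submodule.span ℝ {a, b} := Submodule.subset_span (by simp)
  unfold resTri
  rw [← exists_binary_quadratic_zero_iff]
  constructor
  · rintro ⟨w, hw, x, hx, hx0, h⟩
    obtain ⟨p, q, s, t, rfl⟩ := hf.coords hV w
    obtain ⟨u, v, rfl⟩ := Submodule.mem_span_pair.1 hx
    have h1 := h a ha
    have h2 := h b hb
    have z := fun y1 (h1 : y1 ∈ Submodule.span ℝ {a, b}) y2 h2 y3 h3 =>
      hT.polar hE (x := y1) (y := y2) (z := y3) h1 h2 h3
    simp only [map_add, map_smul, LinearMap.add_apply, LinearMap.smul_apply, smul_eq_mul,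
      hT.left b a, z a ha a ha a ha, z a ha a ha b hb, z a ha b hb a ha, z a ha b hb b hb,
      z b hb b hb b hb, z b hb b hb a ha] at h1 h2
    refine ⟨s, t, ?_, ?_⟩
    · rintro ⟨rfl, rfl⟩
      apply hw
      simpa using Submodule.mem_span_pair.2 ⟨p, q, rfl⟩
    · by_contra hd
      refine hx0 ?_
      have hu : u * (((T a a) m * (T b b) m - (T a b) m ^ 2) * s ^ 2 +
        ((T a a) m * (T b b) n + (T b b) m * (T a a) n - 2 * (T a b) m * (T a b) n) * (s * t) +
        ((T a a) n * (T b b) n - (T a b) n ^ 2) * t ^ 2) = 0 := by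
        linear_combination (s * T b b m + t * T b b n) * h1 - (s * T a b m + t * T a b n) * h2
      have hv : v * (((T a a) m * (T b b) m - (T a b) m ^ 2) * s ^ 2 +
        ((T a a) m * (T b b) n + (T b b) m * (T a a) n - 2 * (T a b) m * (T a b) n) * (s * t) +
        ((T a a) n * (T b b) n - (T a b) n ^ 2) * t ^ 2) = 0 := by
        linear_combination (s * T a a m + t * T a a n) * h2 - (s * T a b m + t * T a b n) * h1
      simp only [mul_eq_zero, hd, or_false] at hu hv
      simp [hu, hv]
  · rintro ⟨s, t, hst, h⟩
    obtain ⟨x, y, hxy, h1, h2⟩ := exists_kernel_two (p := s * T a a m + t * T a a n)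
      (q := s * T a b m + t * T a b n) (r := s * T b b m + t * T b b n)
      (by linear_combination h)
    refine ⟨s • m + t • n, ?_, x • a + y • b, Submodule.mem_span_pair.2 ⟨_, _, rfl⟩, ?_, ?_⟩
    · simpa using hf.notMem_span hst 0 (Submodule.zero_mem _)
    · exact fun h0 => hxy (hf.indep _ _ h0)
    · intro e he
      obtain ⟨u, v, rfl⟩ := Submodule.mem_span_pair.1 he
      simp only [map_add, map_smul, LinearMap.add_apply, LinearMap.smul_apply, smul_eq_mul,
        hT.left b a]
      linear_combination u * h1 + v * h2

theorem resTri_ne_zero {T : V →ₗ[ℝ] V →ₗ[ℝ] V →ₗ[ℝ] ℝ} (hV : Module.finrank ℝ V = 4)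
    (hT : SymTri T) (hs : SmoothTri T)
    {a b m n : V} (hE : ∀ x ∈ Submodule.span ℝ {a, b}, T x x x = 0) (hf : Frame ℝ a b m n) :
    resTri T a b m n ≠ 0 := by
  intro h
  have ha : a ∈ Submodule.span ℝ {a, b} := Submodule.subset_span (by simp)
  have hb : b ∈ Submodule.span ℝ {a, b} := Submodule.subset_span (by simp)
  obtain ⟨x, y, hxy, h1, h2⟩ := exists_common_zero_of_res (a0 := T a a m) (a1 := T a b m)
    (a2 := T b b m) (b0 := T a a n) (b1 := T a b n) (b2 := T b b n)
    (by unfold resTri at h; exact_mod_cast h)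
  refine hxy (hs.pair hT hf.indep fun w => ?_)
  obtain ⟨p, q, s, t, rfl⟩ := hf.coords hV w
  simp only [map_add, map_smul, smul_eq_mul,
    hT.polar hE ha ha ha, hT.polar hE ha ha hb, hT.polar hE ha hb ha, hT.polar hE ha hb hb,
    hT.polar hE hb hb ha, hT.polar hE hb hb hb]
  push_cast
  linear_combination s * h1 + t * h2

theorem segre_eq_sign {T : V →ₗ[ℝ] V →ₗ[ℝ] V →ₗ[ℝ] ℝ} (hV : Module.finrank ℝ V = 4)
    (hT : SymTri T) (hs : SmoothTri T)
    {a b m n : V} (hE : ∀ x ∈ Submodule.span ℝ {a, b}, T x x x = 0) (hf : Frame ℝ a b m n) :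
    segre T (Submodule.span ℝ {a, b}) = SignType.sign (resTri T a b m n) := by
  have h1 := hyp_iff hV hT hE hf
  have h2 := resTri_ne_zero hV hT hs hE hf
  unfold segre
  split_ifs with h
  · simp [lt_of_le_of_ne (h1.1 h) h2.symm]
  · rw [h1, not_le] at h
    simp [h]

end Real

section Roots

theorem sign_eq_of_no_root {p : Polynomial ℝ} {a b : ℝ} (hab : a ≤ b)
    (h : ∀ v, a ≤ v → v ≤ b → p.eval v ≠ 0) :
    SignType.sign (p.eval a) = SignType.sign (p.eval b) := by
  have hc : ContinuousOn (fun x => p.eval x) (Set.Icc a b) := p.continuous.continuousOn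
  rcases lt_or_gt_of_ne (h a le_rfl hab) with h1 | h1 <;>
    rcases lt_or_gt_of_ne (h b hab le_rfl) with h2 | h2
  · simp [h1, h2]
  · obtain ⟨v, hv, h0⟩ := intermediate_value_Icc hab hc ⟨h1.le, h2.le⟩
    exact absurd h0 (h v hv.1 hv.2)
  · obtain ⟨v, hv, h0⟩ := intermediate_value_Icc' hab hc ⟨h2.le, h1.le⟩
    exact absurd h0 (h v hv.1 hv.2)
  · simp [h1, h2]

theorem two_mul_sum_sign_derivative {a b : ℝ} (hab : a < b) (n : ℕ) :
    ∀ (p : Polynomial ℝ) (R : Finset ℝ), R.card = n →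
      (∀ v, v ∈ R ↔ (a < v ∧ v < b) ∧ p.eval v = 0) →
      (∀ v ∈ R, p.derivative.eval v ≠ 0) → p.eval a ≠ 0 → p.eval b ≠ 0 →
      2 * ∑ v ∈ R, (SignType.sign (p.derivative.eval v) : ℤ) =
        SignType.sign (p.eval b) - SignType.sign (p.eval a) := by
  induction n with
  | zero =>
    intro p R hR hm _ ha hb
    obtain rfl := Finset.card_eq_zero.1 hR
    rw [sign_eq_of_no_root hab.le fun v h1 h2 h0 => ?_]
    · simp
    · rcases h1.eq_or_lt with rfl | h1
      · exact ha h0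
      rcases h2.eq_or_lt with rfl | h2
      · exact hb h0
      simpa using (hm v).2 ⟨⟨h1, h2⟩, h0⟩
  | succ n ih =>
    intro p R hR hm hs ha hb
    have hne : R.Nonempty := Finset.card_pos.1 (by omega)
    obtain ⟨r, hr, hmax⟩ : ∃ r ∈ R, ∀ v ∈ R, v ≤ r :=
      ⟨R.max' hne, R.max'_mem hne, fun v hv => R.le_max' v hv⟩
    obtain ⟨⟨har, hrb⟩, hr0⟩ := (hm r).1 hr
    obtain ⟨q, rfl⟩ := Polynomial.dvd_iff_isRoot.2 hr0
    have hd : ∀ v, ((Polynomial.X - Polynomial.C r) * q).derivative.eval v =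
        q.eval v + (v - r) * q.derivative.eval v := fun v => by simp
    have hqr : q.eval r ≠ 0 := by simpa [hd] using hs r hr
    have hmem : ∀ v, v ∈ R.erase r ↔ (a < v ∧ v < b) ∧ q.eval v = 0 := by
      intro v
      rw [Finset.mem_erase, hm]
      constructor
      · rintro ⟨h1, h2, h3⟩
        exact ⟨h2, by simpa [sub_eq_zero, h1] using h3⟩
      · rintro ⟨h1, h2⟩
        exact ⟨fun h => hqr (h ▸ h2), h1, by simp [h2]⟩
    have hqa : q.eval a ≠ 0 := fun h => ha (by simp [h])
    have hqb : q.eval b ≠ 0 := fun h => hb (by simp [h])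
    have key := ih q (R.erase r) (by rw [Finset.card_erase_of_mem hr]; omega) hmem
      (fun v hv h => hs v (Finset.mem_of_mem_erase hv) (by
        rw [hd, h, ((hmem v).1 hv).2]; ring)) hqa hqb
    have hsum : ∑ v ∈ R.erase r, (SignType.sign
        (((Polynomial.X - Polynomial.C r) * q).derivative.eval v) : ℤ) =
        - ∑ v ∈ R.erase r, (SignType.sign (q.derivative.eval v) : ℤ) := by
      rw [← Finset.sum_neg_distrib]
      refine Finset.sum_congr rfl fun v hv => ?_
      have hvr : v < r := lt_of_le_of_ne (hmax v (Finset.mem_of_mem_erase hv))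
        (Finset.ne_of_mem_erase hv)
      rw [hd, ((hmem v).1 hv).2, zero_add, sign_mul, sign_neg (sub_neg.2 hvr)]
      simp
    have hq : SignType.sign (q.eval r) = SignType.sign (q.eval b) := by
      refine sign_eq_of_no_root hrb.le fun v h1 h2 h0 => ?_
      rcases h2.eq_or_lt with rfl | h2
      · exact hqb h0
      have h3 := (hmem v).2 ⟨⟨har.trans_le h1, h2⟩, h0⟩
      exact (Finset.ne_of_mem_erase h3) (le_antisymm (hmax v (Finset.mem_of_mem_erase h3)) h1)
    rw [← Finset.add_sum_erase R _ hr, hsum, hd]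
    simp only [sub_self, zero_mul, add_zero, Polynomial.eval_mul, Polynomial.eval_sub,
      Polynomial.eval_X, Polynomial.eval_C, sign_mul, sign_pos (sub_pos.2 hrb),
      sign_neg (sub_neg.2 har), one_mul, neg_mul, hq]
    push_cast
    linarith

/-- The roots in `[0, 1]` counted by `sum_sign_derivative`. -/
def IsCountedRoot (p : Polynomial ℝ) (v : ℝ) : Prop :=
  (0 ≤ v ∧ v ≤ 1) ∧ p.eval v = 0 ∧ ((0 < v ∧ v < 1) ∨ 0 < p.derivative.eval v)

theorem sum_interior {p g q : Polynomial ℝ} (hp : p = g * q)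
    (hg : ∀ v, 0 < v → v < 1 → 0 < g.eval v)
    (hs : ∀ v, 0 ≤ v → v ≤ 1 → p.eval v = 0 → p.derivative.eval v ≠ 0)
    (h0 : q.eval 0 ≠ 0) (h1 : q.eval 1 ≠ 0) {R : Finset ℝ}
    (hR : ∀ v, v ∈ R ↔ (0 < v ∧ v < 1) ∧ p.eval v = 0) :
    2 * ∑ v ∈ R, (SignType.sign (p.derivative.eval v) : ℤ) =
        SignType.sign (q.eval 1) - SignType.sign (q.eval 0) := by
  have hm : ∀ v, v ∈ R ↔ (0 < v ∧ v < 1) ∧ q.eval v = 0 := by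
    intro v
    rw [hR, hp, Polynomial.eval_mul]
    refine and_congr_right fun h => ?_
    simp [(hg v h.1 h.2).ne']
  have hd : ∀ v ∈ R, p.derivative.eval v = g.eval v * q.derivative.eval v := by
    intro v hv
    rw [hp]
    simp [((hm v).1 hv).2]
  rw [← two_mul_sum_sign_derivative one_pos R.card q R rfl hm ?_ h0 h1]
  · congr 1
    refine Finset.sum_congr rfl fun v hv => ?_
    have := (hm v).1 hv
    rw [hd v hv, sign_mul, sign_pos (hg v this.1.1 this.1.2), one_mul]
  · intro v hv h
    have := (hR v).1 hv
    exact hs v this.1.1.le this.1.2.le this.2 (by rw [hd v hv, h, mul_zero])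

theorem sum_sign_derivative {p : Polynomial ℝ} (h0 : p.eval 0 ≤ 0) (h1 : 0 ≤ p.eval 1)
    (hs : ∀ v, 0 ≤ v → v ≤ 1 → p.eval v = 0 → p.derivative.eval v ≠ 0) :
    ∃ R : Finset ℝ, (∀ v, v ∈ R ↔ IsCountedRoot p v) ∧
      ∑ v ∈ R, (SignType.sign (p.derivative.eval v) : ℤ) = 1 := by
  classical
  have hp0 : p ≠ 0 := by
    rintro rfl
    exact hs 0 le_rfl zero_le_one (by simp) (by simp)
  obtain ⟨R, hR⟩ : ∃ R : Finset ℝ, ∀ v, v ∈ R ↔ (0 < v ∧ v < 1) ∧ p.eval v = 0 :=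
    ⟨p.roots.toFinset.filter fun v => 0 < v ∧ v < 1, fun v => by
      simp [hp0, and_comm]⟩
  obtain ⟨A, hA⟩ : ∃ A : Finset ℝ, (∀ v, v ∈ A ↔ v = 0 ∧ p.eval 0 = 0 ∧
      0 < p.derivative.eval 0) := ⟨if p.eval 0 = 0 ∧ 0 < p.derivative.eval 0 then {0} else ∅,
      fun v => by split_ifs with h <;> simp [h]⟩
  obtain ⟨B, hB⟩ : ∃ A : Finset ℝ, (∀ v, v ∈ A ↔ v = 1 ∧ p.eval 1 = 0 ∧
      0 < p.derivative.eval 1) := ⟨if p.eval 1 = 0 ∧ 0 < p.derivative.eval 1 then {1} else ∅,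
      fun v => by split_ifs with h <;> simp [h]⟩
  refine ⟨R ∪ (A ∪ B), ?_, ?_⟩
  · intro v
    simp only [Finset.mem_union, hR, hA, hB, IsCountedRoot]
    constructor
    · rintro (⟨h1, h2⟩ | ⟨rfl, h2⟩ | ⟨rfl, h2⟩)
      · exact ⟨⟨h1.1.le, h1.2.le⟩, h2, .inl h1⟩
      · exact ⟨by simp, h2.1, .inr h2.2⟩
      · exact ⟨by simp, h2.1, .inr h2.2⟩
    · rintro ⟨⟨h1, h2⟩, h3, h4⟩
      rcases h1.eq_or_lt with rfl | h1
      · simp at h4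
        exact .inr (.inl ⟨rfl, h3, h4⟩)
      rcases h2.eq_or_lt with rfl | h2
      · simp at h4
        exact .inr (.inr ⟨rfl, h3, h4⟩)
      · exact .inl ⟨⟨h1, h2⟩, h3⟩
  · have dAB : Disjoint A B := by
      rw [Finset.disjoint_left]
      intro v h1 h2
      rw [hA] at h1; rw [hB] at h2
      linarith [h1.1, h2.1]
    have dR : Disjoint R (A ∪ B) := by
      rw [Finset.disjoint_left]
      intro v h1 h2
      rw [Finset.mem_union, hA, hB] at h2; rw [hR] at h1
      rcases h2 with h2 | h2 <;> linarith [h1.1.1, h1.1.2, h2.1]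
    rw [Finset.sum_union dR, Finset.sum_union dAB]
    obtain ⟨g0, q, hpq, hg0, hq0, hA2, hg01⟩ : ∃ g q : Polynomial ℝ, p = g * q ∧
        (∀ v, 0 < v → 0 < g.eval v) ∧ q.eval 0 ≠ 0 ∧
        2 * ∑ v ∈ A, (SignType.sign (p.derivative.eval v) : ℤ) = SignType.sign (q.eval 0) + 1 ∧
        g.eval 1 = 1 := by
      rcases h0.eq_or_lt with h0 | h0
      · obtain ⟨q, hq⟩ := Polynomial.dvd_iff_isRoot.2 h0
        have hd : p.derivative.eval 0 = q.eval 0 := by rw [hq]; simp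
        have hq0 : q.eval 0 ≠ 0 := hd ▸ hs 0 le_rfl zero_le_one h0
        refine ⟨Polynomial.X, q, by simpa using hq, by simp, hq0, ?_, by simp⟩
        rcases lt_or_gt_of_ne hq0 with h | h
        · have : A = ∅ := by ext v; simp [hA, hd, h.le]
          simp [this, h]
        · have : A = {0} := by ext v; simp [hA, hd, h, h0]
          simp [this, hd, h]
      · refine ⟨1, p, by simp, by simp, h0.ne, ?_, by simp⟩
        have : A = ∅ := by ext v; simp [hA, h0.ne]
        simp [this, h0]
    obtain ⟨g1, q1, hq1, hg1, hg10, hq11, hB2⟩ : ∃ g r : Polynomial ℝ, q = g * r ∧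
        (∀ v, v < 1 → 0 < g.eval v) ∧ g.eval 0 = 1 ∧ r.eval 1 ≠ 0 ∧
        2 * ∑ v ∈ B, (SignType.sign (p.derivative.eval v) : ℤ) = 1 - SignType.sign (r.eval 1) := by
      have hp1 : p.eval 1 = q.eval 1 := by rw [hpq]; simp [hg01]
      rcases h1.eq_or_lt with h1 | h1
      · obtain ⟨r, hr⟩ := Polynomial.dvd_iff_isRoot.2 (hp1 ▸ h1.symm)
        have hd : p.derivative.eval 1 = r.eval 1 := by rw [hpq, hr]; simp [hg01]
        have hr1 : r.eval 1 ≠ 0 := hd ▸ hs 1 zero_le_one le_rfl h1.symm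
        refine ⟨1 - Polynomial.X, -r, by rw [hr]; simp; ring, by simp, by simp, by simpa, ?_⟩
        rcases lt_or_gt_of_ne hr1 with h | h
        · have : B = ∅ := by ext v; simp [hB, hd, h.le]
          simp [this, h]
        · have : B = {1} := by ext v; simp [hB, hd, h, h1.symm]
          simp [this, hd, h]
      · refine ⟨1, q, by simp, by simp, by simp, hp1 ▸ h1.ne', ?_⟩
        have : B = ∅ := by ext v; simp [hB, h1.ne']
        rw [hp1] at h1
        simp [this, h1]
    have hq10 : q.eval 0 = q1.eval 0 := by rw [hq1]; simp [hg10]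
    have key := sum_interior (p := p) (g := g0 * g1) (q := q1) (by rw [hpq, hq1]; ring)
      (fun v h0 h1 => by simpa using mul_pos (hg0 v h0) (hg1 v h1)) hs (hq10 ▸ hq0) hq11 hR
    rw [hq10] at hA2
    linarith

end Roots

section Tritangent
variable {V : Type*} [AddCommGroup V] [Module ℝ V] {T : V →ₗ[ℝ] V →ₗ[ℝ] V →ₗ[ℝ] ℝ}

theorem not_all_zero_of_notMem (hV : Module.finrank ℝ V = 4) (hT : SymTri T) (hs : SmoothTri T)
    {a b c : V} (hE : ∀ x ∈ Submodule.span ℝ {a, b}, T x x x = 0) (hab : Indep2 ℝ a b)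
    (hc : c ∉ Submodule.span ℝ {a, b}) : ¬ (T a a c = 0 ∧ T a b c = 0 ∧ T b b c = 0) := by
  rintro ⟨h1, h2, h3⟩
  obtain ⟨d, hd⟩ := exists_frame_of_notMem hV hab hc
  exact resTri_ne_zero hV hT hs hE hd (by simp [resTri, h1, h2, h3])

/-- A section of the cubic surface by the plane `P` consisting of three distinct lines. -/
structure IsTritangent (T : V →ₗ[ℝ] V →ₗ[ℝ] V →ₗ[ℝ] ℝ) (P A B C : Submodule ℝ V) : Prop where
  finrank : Module.finrank ℝ P = 3
  lineA : OnCubic T A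
  lineB : OnCubic T B
  lineC : OnCubic T C
  leA : A ≤ P
  leB : B ≤ P
  leC : C ≤ P
  neAB : A ≠ B
  neAC : A ≠ C
  neBC : B ≠ C
  mem : ∀ x ∈ P, T x x x = 0 → x ∈ A ∨ x ∈ B ∨ x ∈ C

theorem IsTritangent.rotate {P A B C : Submodule ℝ V} (h : IsTritangent T P A B C) :
    IsTritangent T P C A B :=
  ⟨h.finrank, h.lineC, h.lineA, h.lineB, h.leC, h.leA, h.leB, h.neAC.symm, h.neBC.symm, h.neAB,
    fun x hx h0 => by have := h.mem x hx h0; tauto⟩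

theorem finrank_sup_of_inf_ne_bot {k V : Type*} [Field k] [AddCommGroup V] [Module k V]
    {A B : Submodule k V} (hA : Module.finrank k A = 2)
    (hB : Module.finrank k B = 2) (hne : A ≠ B) (h : A ⊓ B ≠ ⊥) :
    Module.finrank k (A ⊔ B : Submodule k V) = 3 := by
  have fA : FiniteDimensional k A := FiniteDimensional.of_finrank_pos (by omega)
  have fB : FiniteDimensional k B := FiniteDimensional.of_finrank_pos (by omega)
  have h1 := Submodule.finrank_sup_add_finrank_inf_eq A B
  have h2 : 0 < Module.finrank k (A ⊓ B : Submodule k V) := by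
    rw [Nat.pos_iff_ne_zero, Ne, Submodule.finrank_eq_zero]; exact h
  have h3 : Module.finrank k (A ⊓ B : Submodule k V) < 2 := by
    by_contra! hc
    have e1 := Submodule.eq_of_le_of_finrank_le (inf_le_left : A ⊓ B ≤ A) (by omega)
    have e2 := Submodule.eq_of_le_of_finrank_le (inf_le_right : A ⊓ B ≤ B) (by omega)
    exact hne (e1.symm.trans e2)
  omega

theorem exists_meet_basis {k V : Type*} [Field k] [AddCommGroup V] [Module k V]
    {A B : Submodule k V} (hA : Module.finrank k A = 2)
    (hB : Module.finrank k B = 2) (hne : A ≠ B) {m : V} (hm : m ≠ 0) (hmA : m ∈ A) (hmB : m ∈ B) :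
    ∃ e c, A = Submodule.span k {m, e} ∧ B = Submodule.span k {m, c} ∧ Indep2 k m e ∧
      Indep2 k m c ∧ c ∉ A := by
  obtain ⟨e, he, hme, rfl⟩ := exists_pair_of_finrank_two hA hmA hm
  obtain ⟨c, hc, hmc, rfl⟩ := exists_pair_of_finrank_two hB hmB hm
  refine ⟨e, c, rfl, rfl, hme, hmc, fun h => hne ?_⟩
  exact span_pair_eq_of_mem hA hmA h hmc

theorem exists_third_line (hV : Module.finrank ℝ V = 4) (hT : SymTri T) (hs : SmoothTri T)
    {A B : Submodule ℝ V} (hA : OnCubic T A) (hB : OnCubic T B) (hne : A ≠ B) (h : A ⊓ B ≠ ⊥) :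
    ∃ C, IsTritangent T (A ⊔ B) A B C ∧ segre T A * segre T B * segre T C = 1 := by
  obtain ⟨m, ⟨hmA, hmB⟩, hm0⟩ := Submodule.exists_mem_ne_zero_of_ne_bot h
  obtain ⟨e, c, rfl, rfl, hme, hmc, hcA⟩ := exists_meet_basis hA.1 hB.1 hne hm0 hmA hmB
  obtain ⟨n, hn⟩ := exists_frame_of_notMem hV hme hcA
  have hn' : Frame ℝ m c e n := fun x y s t h => by
    have := hn x s y t (by rw [← h]; abel)
    tauto
  have heA : e ∈ Submodule.span ℝ {m, e} := Submodule.subset_span (by simp)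
  have hcB : c ∈ Submodule.span ℝ {m, c} := Submodule.subset_span (by simp)
  have hcA := not_all_zero_of_notMem hV hT hs hA.2 hme hcA
  have heB := not_all_zero_of_notMem hV hT hs hB.2 hmc (c := e) (by
    simpa using hn'.notMem_span (s := 1) (t := 0) (by simp) 0 (Submodule.zero_mem _))
  have zmmm := hT.polar hA.2 hmA hmA hmA
  have zmme := hT.polar hA.2 hmA hmA heA
  have zmee := hT.polar hA.2 hmA heA heA
  have zeee := hT.polar hA.2 heA heA heA
  have zmmc := hT.polar hB.2 hmB hmB hcB
  have zmcc := hT.polar hB.2 hmB hcB hcB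
  have zccc := hT.polar hB.2 hcB hcB hcB
  rw [zmmc] at hcA
  rw [zmme, hT.right m c e, hT.right c c e, hT.left c e c] at heB
  have hP := finrank_sup_of_inf_ne_bot hA.1 hB.1 hne h
  obtain ⟨α, hα⟩ : ∃ α, T m e c = α := ⟨_, rfl⟩
  obtain ⟨β, hβ⟩ : ∃ β, T e e c = β := ⟨_, rfl⟩
  obtain ⟨γ, hγ⟩ : ∃ γ, T e c c = γ := ⟨_, rfl⟩
  rw [hα, hβ] at hcA
  rw [hα, hγ] at heB
  have hr1 : T e m c = α := by rw [← hα, hT.left]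
  have hr2 : T c e c = γ := by rw [← hγ, hT.left]
  have hr3 : T c c e = γ := by rw [hT.right c c e, hr2]
  have hr4 : T m c e = α := by rw [hT.right m c e, hα]
  have hr5 : T e c e = β := by rw [← hβ, hT.right]
  have hr6 : T c e e = β := by rw [hT.left c e e, hr5]
  have hr7 : T c m e = α := by rw [hT.left c m e, hr4]
  have hr8 : T e c m = α := by rw [hT.right e c m, hr1]
  have hr9 : T c e m = α := by rw [hT.left c e m, hr8]
  have hr10 : T e m e = 0 := by rw [hT.left, zmee]
  have hr11 : T e e m = 0 := by rw [hT.right, hr10]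
  have hr12 : T c m c = 0 := by rw [hT.left, zmcc]
  have hr13 : T c c m = 0 := by rw [hT.right, hr12]
  have hr14 : T m c m = 0 := by rw [hT.right, zmmc]
  have hr15 : T c m m = 0 := by rw [hT.left, hr14]
  have hr16 : T m e m = 0 := by rw [hT.right, zmme]
  have hr17 : T e m m = 0 := by rw [hT.left, hr16]
  have hF : ∀ x y z : ℝ, T (x • m + y • e + z • c) (x • m + y • e + z • c) (x • m + y • e + z • c)
      = 3 * (y * z * (2 * α * x + β * y + γ * z)) := by
    intro x y z
    simp only [map_add, map_smul, LinearMap.add_apply, LinearMap.smul_apply, smul_eq_mul,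
      hα, hβ, hγ, hr1, hr2, hr3, hr4, hr5, hr6, hr7, hr8, hr9, hr10, hr11, hr12, hr13, hr14,
      hr15, hr16, hr17, zmmm, zmme, zmee, zeee, zmmc, zmcc, zccc]
    ring
  have hmem : ∀ x ∈ Submodule.span ℝ {m, e} ⊔ Submodule.span ℝ {m, c}, T x x x = 0 →
      ∃ p y z : ℝ, x = p • m + y • e + z • c ∧ (y = 0 ∨ z = 0 ∨ 2 * α * p + β * y + γ * z = 0) := by
    intro x hx h0
    obtain ⟨u, hu, v, hv, rfl⟩ := Submodule.mem_sup.1 hx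
    obtain ⟨x1, y, rfl⟩ := Submodule.mem_span_pair.1 hu
    obtain ⟨x2, z, rfl⟩ := Submodule.mem_span_pair.1 hv
    have e1 : x1 • m + y • e + (x2 • m + z • c) = (x1 + x2) • m + y • e + z • c := by module
    rw [e1] at h0 ⊢
    rw [hF] at h0
    refine ⟨_, _, _, rfl, ?_⟩
    simpa [or_assoc] using h0
  have hPm : m ∈ Submodule.span ℝ {m, e} ⊔ Submodule.span ℝ {m, c} := Submodule.mem_sup_left hmA
  have hPe : e ∈ Submodule.span ℝ {m, e} ⊔ Submodule.span ℝ {m, c} := Submodule.mem_sup_left heA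
  have hPc : c ∈ Submodule.span ℝ {m, e} ⊔ Submodule.span ℝ {m, c} := Submodule.mem_sup_right hcB
  have hcub : ∀ u v : V, Indep2 ℝ u v → (∀ s t : ℝ, ∃ x y z : ℝ, s • u + t • v =
      x • m + y • e + z • c ∧ 2 * α * x + β * y + γ * z = 0) →
      OnCubic T (Submodule.span ℝ {u, v}) := by
    intro u v huv hx
    refine ⟨finrank_span_pair huv, fun x hx' => ?_⟩
    obtain ⟨s, t, rfl⟩ := Submodule.mem_span_pair.1 hx'
    obtain ⟨x, y, z, h1, h2⟩ := hx s t
    rw [h1, hF, h2]; ring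
  have nA : ∀ x y z : ℝ, z ≠ 0 → x • m + y • e + z • c ∉ Submodule.span ℝ {m, e} := by
    intro x y z hz
    simpa using hn.notMem_span (s := z) (t := 0) (by simp [hz]) _
      (Submodule.mem_span_pair.2 ⟨x, y, rfl⟩)
  have nB : ∀ x y z : ℝ, y ≠ 0 → x • m + y • e + z • c ∉ Submodule.span ℝ {m, c} := by
    intro x y z hy
    rw [add_right_comm]
    simpa using hn'.notMem_span (s := y) (t := 0) (by simp [hy]) _
      (Submodule.mem_span_pair.2 ⟨x, z, rfl⟩)
  have rA : resTri T m e c n = T m m n * (β ^ 2 * T m m n - 4 * α * β * T m e n +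
      4 * α ^ 2 * T e e n) := by
    simp only [resTri, zmmc, hα, hβ]; ring
  have rB : resTri T m c e n = T m m n * (γ ^ 2 * T m m n - 4 * α * γ * T m c n +
      4 * α ^ 2 * T c c n) := by
    simp only [resTri, zmme, hr4, hr3]; ring
  have nzA := resTri_ne_zero hV hT hs hA.2 hn
  have nzB := resTri_ne_zero hV hT hs hB.2 hn'
  have sA := segre_eq_sign hV hT hs hA.2 hn
  have sB := segre_eq_sign hV hT hs hB.2 hn'
  rcases eq_or_ne α 0 with h0 | h0
  · subst h0
    have hβ0 : β ≠ 0 := fun h => hcA (by simp [h])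
    have hγ0 : γ ≠ 0 := fun h => heB (by simp [h])
    have hq : Frame ℝ m (γ • e - β • c) e n := by
      intro x y s t hx
      obtain ⟨h1, h2, h3, h4⟩ := hn x (y * γ + s) (-(y * β)) t (by rw [← hx]; module)
      have h5 : y = 0 := by simpa [hβ0] using h3
      subst h5
      exact ⟨h1, rfl, by simpa using h2, h4⟩
    have hC : OnCubic T (Submodule.span ℝ {m, γ • e - β • c}) :=
      hcub _ _ hq.indep fun s t => ⟨s, t * γ, -(t * β), by module, by ring⟩
    have hqC : γ • e - β • c ∈ Submodule.span ℝ {m, γ • e - β • c} :=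
      Submodule.subset_span (by simp)
    refine ⟨Submodule.span ℝ {m, γ • e - β • c}, ⟨hP, hA, hB, hC, le_sup_left, le_sup_right, ?_,
      hne, ?_, ?_, ?_⟩, ?_⟩
    · rw [Submodule.span_le]
      rintro x (rfl | rfl)
      · exact hPm
      · exact Submodule.sub_mem _ (Submodule.smul_mem _ _ hPe) (Submodule.smul_mem _ _ hPc)
    · intro h
      apply nA 0 γ (-β) (by simpa)
      rw [h]
      convert hqC using 1; module
    · intro h
      apply nB 0 γ (-β) hγ0
      rw [h]
      convert hqC using 1; module
    · intro x hx h0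
      obtain ⟨p, y, z, rfl, rfl | rfl | h⟩ := hmem x hx h0
      · exact .inr (.inl (Submodule.mem_span_pair.2 ⟨p, z, by module⟩))
      · exact .inl (Submodule.mem_span_pair.2 ⟨p, y, by module⟩)
      · refine .inr (.inr (Submodule.mem_span_pair.2 ⟨p, y / γ, ?_⟩))
        have hz : z = -(β * y / γ) := by field_simp; linear_combination h
        have hy : y = y / γ * γ := by field_simp
        rw [hz]
        nth_rewrite 2 [hy]
        module
    · have sC := segre_eq_sign hV hT hs hC.2 hq
      have rC : resTri T m (γ • e - β • c) e n = (β ^ 2 * γ * T m m n) ^ 2 := by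
        simp only [resTri, map_sub, map_smul, LinearMap.sub_apply, LinearMap.smul_apply,
          smul_eq_mul, zmme, hr4, zmee, zeee, hr3, hr5, hr6]
        ring
      have hmn : T m m n ≠ 0 := fun h => nzA (by rw [rA, h]; ring)
      rw [sA, sB, sC, rA, rB, rC, sign_pos, sign_pos, sign_pos]
      · simp
      · positivity
      · have : T m m n * (γ ^ 2 * T m m n - 4 * 0 * γ * T m c n + 4 * 0 ^ 2 * T c c n) =
          (γ * T m m n) ^ 2 := by ring
        rw [this]; positivity
      · have : T m m n * (β ^ 2 * T m m n - 4 * 0 * β * T m e n + 4 * 0 ^ 2 * T e e n) =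
          (β * T m m n) ^ 2 := by ring
        rw [this]; positivity
  · have hq : Frame ℝ (β • m - (2 * α) • e) (γ • m - (2 * α) • c) m n := by
      intro x y s t hx
      obtain ⟨h1, h2, h3, h4⟩ := hn (x * β + y * γ + s) (-(x * (2 * α))) (-(y * (2 * α))) t
        (by rw [← hx]; module)
      have h5 : x = 0 := by simpa [h0] using h2
      have h6 : y = 0 := by simpa [h0] using h3
      subst h5 h6
      exact ⟨rfl, rfl, by simpa using h1, h4⟩
    have hC : OnCubic T (Submodule.span ℝ {β • m - (2 * α) • e, γ • m - (2 * α) • c}) :=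
      hcub _ _ hq.indep fun s t => ⟨s * β + t * γ, -(s * (2 * α)), -(t * (2 * α)),
        by module, by ring⟩
    have huC : β • m - (2 * α) • e ∈ Submodule.span ℝ {β • m - (2 * α) • e, γ • m - (2 * α) • c} :=
      Submodule.subset_span (by simp)
    have hwC : γ • m - (2 * α) • c ∈ Submodule.span ℝ {β • m - (2 * α) • e, γ • m - (2 * α) • c} :=
      Submodule.subset_span (by simp)
    refine ⟨Submodule.span ℝ {β • m - (2 * α) • e, γ • m - (2 * α) • c}, ⟨hP, hA, hB, hC,
      le_sup_left, le_sup_right, ?_, hne, ?_, ?_, ?_⟩, ?_⟩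
    · rw [Submodule.span_le]
      rintro x (rfl | rfl)
      · exact Submodule.sub_mem _ (Submodule.smul_mem _ _ hPm) (Submodule.smul_mem _ _ hPe)
      · exact Submodule.sub_mem _ (Submodule.smul_mem _ _ hPm) (Submodule.smul_mem _ _ hPc)
    · intro h
      apply nA γ 0 (-(2 * α)) (by simpa)
      rw [h]
      convert hwC using 1; module
    · intro h
      apply nB β (-(2 * α)) 0 (by simpa)
      rw [h]
      convert huC using 1; module
    · intro x hx hx0
      obtain ⟨p, y, z, rfl, rfl | rfl | h⟩ := hmem x hx hx0
      · exact .inr (.inl (Submodule.mem_span_pair.2 ⟨p, z, by module⟩))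
      · exact .inl (Submodule.mem_span_pair.2 ⟨p, y, by module⟩)
      · obtain ⟨y, rfl⟩ : ∃ y', y = y' * (2 * α) := ⟨y / (2 * α), by field_simp⟩
        obtain ⟨z, rfl⟩ : ∃ z', z = z' * (2 * α) := ⟨z / (2 * α), by field_simp⟩
        have hp : p = -(y * β) - z * γ := by
          apply mul_left_cancel₀ (mul_ne_zero two_ne_zero h0)
          linear_combination h
        subst hp
        exact .inr (.inr (Submodule.mem_span_pair.2 ⟨-y, -z, by module⟩))
    · have sC := segre_eq_sign hV hT hs hC.2 hq
      have nzC := resTri_ne_zero hV hT hs hC.2 hq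
      have rC : resTri T (β • m - (2 * α) • e) (γ • m - (2 * α) • c) m n = 64 * α ^ 6 *
          ((β ^ 2 * T m m n - 4 * α * β * T m e n + 4 * α ^ 2 * T e e n) *
            (γ ^ 2 * T m m n - 4 * α * γ * T m c n + 4 * α ^ 2 * T c c n)) := by
        simp only [resTri, map_sub, map_smul, LinearMap.sub_apply, LinearMap.smul_apply,
          smul_eq_mul, zmmm, hr16, hr17, hr14, hr15, hr11, hr13, hr8, hT.left e m n,
          hT.left c m n]
        ring
      have h1 : SignType.sign (resTri T m e c n * resTri T m c e n *
          resTri T (β • m - (2 * α) • e) (γ • m - (2 * α) • c) m n) = 1 := by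
        have h2 := mul_ne_zero (mul_ne_zero nzA nzB) nzC
        rw [sign_eq_one_iff]
        refine lt_of_le_of_ne ?_ h2.symm
        rw [rA, rB, rC]
        have : ∀ g u v a : ℝ, g * u * (g * v) * (64 * a ^ 6 * (u * v)) =
          64 * (a ^ 3 * g * u * v) ^ 2 := fun g u v a => by ring
        rw [this]
        positivity
      rw [sA, sB, sC]
      rw [sign_mul, sign_mul] at h1
      exact_mod_cast congrArg (fun s : SignType => (s : ℤ)) h1

end Tritangent

section Hyperbolic
variable {V : Type*} [AddCommGroup V] [Module ℝ V] {T : V →ₗ[ℝ] V →ₗ[ℝ] V →ₗ[ℝ] ℝ}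

/-- Coordinates adapted to a hyperbolic line `⟨e₁, e₂⟩`. -/
structure HypFrame (T : V →ₗ[ℝ] V →ₗ[ℝ] V →ₗ[ℝ] ℝ) (e1 e2 n1 n2 : V) : Prop where
  frame : Frame ℝ e1 e2 n1 n2
  line : ∀ x ∈ Submodule.span ℝ {e1, e2}, T x x x = 0
  h111 : T e1 e1 n1 = 1
  h121 : T e1 e2 n1 = 0
  h221 : T e2 e2 n1 = 0
  h112 : T e1 e1 n2 = 0
  h122 : T e1 e2 n2 = 0
  h222 : T e2 e2 n2 = 1

theorem HypFrame.swap (hT : SymTri T) {e1 e2 n1 n2 : V} (h : HypFrame T e1 e2 n1 n2) :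
    HypFrame T e2 e1 n2 n1 :=
  ⟨fun x y s t h0 => by
    have := h.frame y x t s (by rw [← h0]; abel)
    tauto, by rw [Set.pair_comm]; exact h.line, h.h222, by rw [hT.left, h.h122], h.h112,
    h.h221, by rw [hT.left, h.h121], h.h111⟩

theorem exists_hypFrame (hV : Module.finrank ℝ V = 4) (hT : SymTri T) (hs : SmoothTri T)
    {E : Submodule ℝ V} (hE : OnCubic T E) (hh : Hyp T E) :
    ∃ e1 e2 n1 n2, E = Submodule.span ℝ {e1, e2} ∧ HypFrame T e1 e2 n1 n2 := by
  obtain ⟨n, hn, x, hx, hx0, h⟩ := hh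
  obtain ⟨y, hy, hxy, rfl⟩ := exists_pair_of_finrank_two hE.1 hx hx0
  obtain ⟨n', hf⟩ := exists_frame_of_notMem hV hxy hn
  have h1 := h x hx
  have h2 := h y hy
  have hres := resTri_ne_zero hV hT hs hE.2 hf
  simp only [resTri, h1, h2] at hres
  have ha : T y y n ≠ 0 := fun h => hres (by rw [h]; ring)
  have hb : T x x n' ≠ 0 := fun h => hres (by rw [h]; ring)
  obtain ⟨a, ha'⟩ : ∃ a, T y y n = a := ⟨_, rfl⟩
  obtain ⟨b, hb'⟩ : ∃ a, T x x n' = a := ⟨_, rfl⟩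
  obtain ⟨c, hc'⟩ : ∃ a, T x y n' = a := ⟨_, rfl⟩
  obtain ⟨d, hd'⟩ : ∃ a, T y y n' = a := ⟨_, rfl⟩
  rw [ha'] at ha; rw [hb'] at hb
  have hyx : ∀ w, T y x w = T x y w := hT.left y x
  have hfr : Frame ℝ x (y - (c / b) • x) (b⁻¹ • (n' - ((d - c ^ 2 / b) / a) • n)) (a⁻¹ • n) := by
    intro p q s t h0
    obtain ⟨k1, k2, k3, k4⟩ := hf (p - q * (c / b)) q (t * a⁻¹ - s * b⁻¹ * ((d - c ^ 2 / b) / a))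
      (s * b⁻¹) (by rw [← h0]; module)
    have hs0 : s = 0 := by simpa [hb] using k4
    subst hs0 k2
    refine ⟨by simpa using k1, rfl, rfl, by simpa [ha] using k3⟩
  have hE2 := span_pair_eq_of_mem hE.1 hx (Submodule.sub_mem _ hy
    (Submodule.smul_mem _ (c / b) hx)) hfr.indep
  refine ⟨x, y - (c / b) • x, _, _, hE2, hfr, hE2 ▸ hE.2, ?_, ?_, ?_, ?_, ?_, ?_⟩ <;>
  · simp only [map_sub, map_smul, LinearMap.sub_apply, LinearMap.smul_apply, smul_eq_mul, hyx,
      h1, h2, ha', hb', hc', hd']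
    field_simp
    try ring

/-- `M` is a line of the surface meeting `⟨e₁, e₂⟩` and contained in `⟨e₁, e₂, w⟩`. -/
def Meets (T : V →ₗ[ℝ] V →ₗ[ℝ] V →ₗ[ℝ] ℝ) (e1 e2 w : V) (M : Submodule ℝ V) : Prop :=
  OnCubic T M ∧ (∃ m ∈ M, m ∈ Submodule.span ℝ {e1, e2} ∧ m ≠ 0) ∧
    ∃ x y : ℝ, x • e1 + y • e2 + w ∈ M

theorem Meets.neg {e1 e2 w : V} {M : Submodule ℝ V} (h : Meets T e1 e2 w M) :
    Meets T e1 e2 (-w) M := by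
  obtain ⟨h1, h2, x, y, h3⟩ := h
  refine ⟨h1, h2, -x, -y, ?_⟩
  convert M.neg_mem h3 using 1
  module

theorem Meets.swap {e1 e2 w : V} {M : Submodule ℝ V} (h : Meets T e1 e2 w M) :
    Meets T e2 e1 w M := by
  obtain ⟨h1, h2, x, y, h3⟩ := h
  exact ⟨h1, by rwa [Set.pair_comm], y, x, by rwa [add_comm (y • e2)]⟩

theorem indep2_of_notMem {k V : Type*} [Field k] [AddCommGroup V] [Module k V] {E : Submodule k V}
    {m c : V} (hm : m ∈ E) (hm0 : m ≠ 0) (hc : c ∉ E) : Indep2 k m c := by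
  intro x y h
  have hy : y = 0 := by
    by_contra hy
    apply hc
    have : c = -(y⁻¹ * x) • m := by
      have := congrArg (y⁻¹ • ·) h
      simp only [smul_add, smul_smul, inv_mul_cancel₀ hy, one_smul, smul_zero] at this
      rw [neg_smul, eq_neg_iff_add_eq_zero, add_comm, this]
    rw [this]
    exact E.smul_mem _ hm
  subst hy
  simpa [hm0] using h

variable {e1 e2 n1 n2 w : V} {s t : ℝ}

theorem meets_iff (hT : SymTri T) (hE : ∀ x ∈ Submodule.span ℝ {e1, e2}, T x x x = 0)
    (hi : Indep2 ℝ e1 e2)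
    (hw : w ∉ Submodule.span ℝ {e1, e2}) (hs : T e1 e1 w = s) (h0 : T e1 e2 w = 0)
    (ht : T e2 e2 w = t) (M : Submodule ℝ V) :
    Meets T e1 e2 w M ↔ ∃ x y x' y' : ℝ, ¬ (x = 0 ∧ y = 0) ∧
      M = Submodule.span ℝ {x • e1 + y • e2, x' • e1 + y' • e2 + w} ∧
      s * x ^ 2 + t * y ^ 2 = 0 ∧
      2 * (s * x * x' + t * y * y') + x * T e1 w w + y * T e2 w w = 0 ∧
      3 * (s * x' ^ 2 + t * y' ^ 2) + 3 * (x' * T e1 w w + y' * T e2 w w) + T w w w = 0 := by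
  have ha : e1 ∈ Submodule.span ℝ {e1, e2} := Submodule.subset_span (by simp)
  have hb : e2 ∈ Submodule.span ℝ {e1, e2} := Submodule.subset_span (by simp)
  have hn : ∀ x y : ℝ, x • e1 + y • e2 + w ∉ Submodule.span ℝ {e1, e2} := fun x y h => hw (by
    have := Submodule.sub_mem _ h (Submodule.mem_span_pair.2 ⟨x, y, rfl⟩)
    simpa using this)
  have hind : ∀ x y x' y' : ℝ, ¬ (x = 0 ∧ y = 0) →
      Indep2 ℝ (x • e1 + y • e2) (x' • e1 + y' • e2 + w) := fun x y x' y' h =>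
    indep2_of_notMem (Submodule.mem_span_pair.2 ⟨x, y, rfl⟩) (fun h0 => h (hi _ _ h0)) (hn x' y')
  have z1 := hT.polar hE ha ha ha
  have z2 := hT.polar hE ha ha hb
  have z3 := hT.polar hE ha hb hb
  have z4 := hT.polar hE hb hb hb
  have z5 := hT.polar hE ha hb ha
  have z6 := hT.polar hE hb hb ha
  have r1 : T w e1 e1 = s := by rw [hT.left, hT.right, hs]
  have r2 : T e1 w e1 = s := by rw [hT.right, hs]
  have r3 : T e2 e1 w = 0 := by rw [hT.left, h0]
  have r4 : T w e2 e2 = t := by rw [hT.left, hT.right, ht]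
  have r5 : T e2 w e2 = t := by rw [hT.right, ht]
  have r6 : T e1 w e2 = 0 := by rw [hT.right, h0]
  have r7 : T e2 w e1 = 0 := by rw [hT.right, r3]
  have r8 : T w e1 e2 = 0 := by rw [hT.left, r6]
  have r9 : T w e2 e1 = 0 := by rw [hT.left, r7]
  have r10 : T w e1 w = T e1 w w := by rw [hT.left]
  have r11 : T w e2 w = T e2 w w := by rw [hT.left]
  have r12 : T w w e1 = T e1 w w := by rw [hT.right, r10]
  have r13 : T w w e2 = T e2 w w := by rw [hT.right, r11]
  have r14 := hT.left e2 e1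
  have key : ∀ x y x' y' : ℝ,
      T (x • e1 + y • e2) (x • e1 + y • e2) (x • e1 + y • e2) = 0 ∧
      T (x • e1 + y • e2) (x • e1 + y • e2) (x' • e1 + y' • e2 + w) = s * x ^ 2 + t * y ^ 2 ∧
      T (x • e1 + y • e2) (x' • e1 + y' • e2 + w) (x' • e1 + y' • e2 + w) =
        2 * (s * x * x' + t * y * y') + x * T e1 w w + y * T e2 w w ∧
      T (x' • e1 + y' • e2 + w) (x' • e1 + y' • e2 + w) (x' • e1 + y' • e2 + w) =
        3 * (s * x' ^ 2 + t * y' ^ 2) + 3 * (x' * T e1 w w + y' * T e2 w w) + T w w w := by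
    intro x y x' y'
    simp only [map_add, map_smul, LinearMap.add_apply, LinearMap.smul_apply, smul_eq_mul,
      z1, z2, z3, z4, z5, z6, hs, h0, ht, r1, r2, r3, r4, r5, r6, r7, r8, r9, r10, r11, r12, r13,
      r14]
    refine ⟨?_, ?_, ?_, ?_⟩ <;> ring
  constructor
  · rintro ⟨hM, ⟨m, hmM, hmE, hm0⟩, x', y', hc⟩
    obtain ⟨x, y, rfl⟩ := Submodule.mem_span_pair.1 hmE
    have hxy : ¬ (x = 0 ∧ y = 0) := by rintro ⟨rfl, rfl⟩; simp at hm0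
    obtain ⟨k0, k1, k2, k3⟩ := key x y x' y'
    refine ⟨x, y, x', y', hxy, span_pair_eq_of_mem hM.1 hmM hc (hind x y x' y' hxy), ?_, ?_, ?_⟩
    · rw [← k1, hT.polar hM.2 hmM hmM hc]
    · rw [← k2, hT.polar hM.2 hmM hc hc]
    · rw [← k3, hT.polar hM.2 hc hc hc]
  · rintro ⟨x, y, x', y', hxy, rfl, h1, h2, h3⟩
    obtain ⟨k0, k1, k2, k3⟩ := key x y x' y'
    refine ⟨onCubic_span hT (hind x y x' y' hxy) k0 (k1.trans h1) (k2.trans h2) (k3.trans h3),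
      ⟨_, Submodule.subset_span (by simp), Submodule.mem_span_pair.2 ⟨x, y, rfl⟩,
        fun h0 => hxy (hi _ _ h0)⟩, x', y', Submodule.subset_span (by simp)⟩

theorem span_smul_add (m c : V) {r : ℝ} (hr : r ≠ 0) (q : ℝ) :
    Submodule.span ℝ {r • m, c + q • m} = Submodule.span ℝ {m, c} := by
  apply le_antisymm <;> rw [Submodule.span_le]
  · rintro x (rfl | rfl)
    · exact Submodule.mem_span_pair.2 ⟨r, 0, by module⟩
    · exact Submodule.mem_span_pair.2 ⟨q, 1, by module⟩
  · rintro x (rfl | rfl)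
    · exact Submodule.mem_span_pair.2 ⟨r⁻¹, 0, by simp [smul_smul, hr]⟩
    · refine Submodule.mem_span_pair.2 ⟨-(q * r⁻¹), 1, ?_⟩
      rw [smul_smul, neg_mul, mul_assoc, inv_mul_cancel₀ hr]
      module

theorem meets_interior (hT : SymTri T) (hE : ∀ x ∈ Submodule.span ℝ {e1, e2}, T x x x = 0)
    (hi : Indep2 ℝ e1 e2)
    (hw : w ∉ Submodule.span ℝ {e1, e2}) {g h : ℝ} (hg : 0 < g) (hh : 0 < h)
    (hs : T e1 e1 w = h ^ 2) (h0 : T e1 e2 w = 0)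
    (ht : T e2 e2 w = -g ^ 2) (M : Submodule ℝ V) :
    Meets T e1 e2 w M ↔ g ^ 2 * T e1 w w ^ 2 - h ^ 2 * T e2 w w ^ 2 -
        4 / 3 * g ^ 2 * h ^ 2 * T w w w = 0 ∧
      ∃ η x : ℝ, (η = 1 ∨ η = -1) ∧ 2 * g * h ^ 2 * x = - (g * T e1 w w + η * h * T e2 w w) ∧
      M = Submodule.span ℝ {g • e1 + (η * h) • e2, x • e1 + w} := by
  rw [meets_iff hT hE hi hw hs h0 ht]
  constructor
  · rintro ⟨x, y, x', y', hxy, rfl, c0, c1, c2⟩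
    obtain ⟨η, r, hη, hx, hy⟩ : ∃ η r : ℝ, (η = 1 ∨ η = -1) ∧ x = r * g ∧ y = r * (η * h) := by
      have : (h * x - g * y) * (h * x + g * y) = 0 := by linear_combination c0
      rcases mul_eq_zero.1 this with h1 | h1
      · exact ⟨1, x / g, by simp, by field_simp, by field_simp; linear_combination -h1⟩
      · exact ⟨-1, x / g, by simp, by field_simp, by field_simp; linear_combination h1⟩
    have hη2 : η * η = 1 := by rcases hη with rfl | rfl <;> norm_num
    have hηh : η * h ≠ 0 := by rcases hη with rfl | rfl <;> simp [hh.ne']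
    have hr : r ≠ 0 := by
      rintro rfl
      exact hxy (by simp [hx, hy])
    obtain ⟨q, rfl⟩ : ∃ q, y' = q * (η * h) := ⟨y' / (η * h), by rw [div_mul_cancel₀ _ hηh]⟩
    subst hx hy
    have c1' : 2 * g * h ^ 2 * (x' - q * g) = - (g * T e1 w w + η * h * T e2 w w) := by
      apply mul_left_cancel₀ hr
      linear_combination c1 + 2 * r * q * h ^ 2 * g ^ 2 * hη2
    refine ⟨?_, η, x' - q * g, hη, c1', ?_⟩
    · obtain ⟨u, hu⟩ : ∃ u, u = x' - q * g := ⟨_, rfl⟩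
      obtain rfl : x' = u + q * g := by rw [hu]; ring
      have c1'' : 2 * g * h ^ 2 * u + (g * T e1 w w + η * h * T e2 w w) = 0 := by
        rw [hu]; linear_combination c1'
      have e : 4 / 3 * g ^ 2 * h ^ 2 *
        (3 * (h ^ 2 * (u + q * g) ^ 2 + -g ^ 2 * (q * (η * h)) ^ 2) + 3 * ((u + q * g) * T e1 w w +
          q * (η * h) * T e2 w w) + T w w w) = (2 * g * h ^ 2 * u + (g * T e1 w w +
          η * h * T e2 w w)) * (2 * g * h ^ 2 * u + g * T e1 w w - η * h * T e2 w w +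
          4 * g ^ 2 * h ^ 2 * q) - (η * η - 1) * (4 * g ^ 4 * h ^ 4 * q ^ 2 -
            h ^ 2 * T e2 w w ^ 2) - (g ^ 2 * T e1 w w ^ 2 - h ^ 2 * T e2 w w ^ 2 -
        4 / 3 * g ^ 2 * h ^ 2 * T w w w) := by ring
      rw [c2, c1'', hη2] at e
      linear_combination e
    · have k1 : (r * g) • e1 + (r * (η * h)) • e2 = r • (g • e1 + (η * h) • e2) := by module
      have k2 : x' • e1 + (q * (η * h)) • e2 + w = ((x' - q * g) • e1 + w) +
        q • (g • e1 + (η * h) • e2) := by module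
      rw [k1, k2, span_smul_add _ _ hr]
  · rintro ⟨hq, η, x, hη, hx, rfl⟩
    have hη2 : η * η = 1 := by rcases hη with rfl | rfl <;> norm_num
    refine ⟨g, η * h, x, 0, by simp [hg.ne'], by simp, ?_, ?_, ?_⟩
    · linear_combination -g ^ 2 * h ^ 2 * hη2
    · linear_combination hx
    · have hgh : 4 / 3 * g ^ 2 * h ^ 2 ≠ 0 := by positivity
      apply mul_left_cancel₀ hgh
      linear_combination (2 * g * h ^ 2 * x + g * T e1 w w - η * h * T e2 w w) * hx +
        h ^ 2 * T e2 w w ^ 2 * hη2 - hq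

theorem meets_zero (hT : SymTri T) (hE : ∀ x ∈ Submodule.span ℝ {e1, e2}, T x x x = 0)
    (hi : Indep2 ℝ e1 e2)
    (hw : w ∉ Submodule.span ℝ {e1, e2})
    (hs : T e1 e1 w = 1) (h0 : T e1 e2 w = 0)
    (ht : T e2 e2 w = 0) (M : Submodule ℝ V) :
    Meets T e1 e2 w M ↔ T e2 w w = 0 ∧ ∃ x : ℝ, 3 * x ^ 2 + 3 * x * T e1 w w + T w w w = 0 ∧
      M = Submodule.span ℝ {e2, x • e1 + w} := by
  rw [meets_iff hT hE hi hw hs h0 ht]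
  constructor
  · rintro ⟨x, y, x', y', hxy, rfl, c0, c1, c2⟩
    obtain rfl : x = 0 := by simpa using c0
    have hy : y ≠ 0 := fun h => hxy ⟨rfl, h⟩
    have h2 : T e2 w w = 0 := by simpa [hy] using c1
    refine ⟨h2, x', by rw [h2] at c2; linear_combination c2, ?_⟩
    have k1 : (0 : ℝ) • e1 + y • e2 = y • e2 := by module
    have k2 : x' • e1 + y' • e2 + w = x' • e1 + w + y' • e2 := by module
    rw [k1, k2, span_smul_add _ _ hy]
  · rintro ⟨h2, x, hx, rfl⟩
    refine ⟨0, 1, x, 0, by simp, by simp, by simp, ?_, ?_⟩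
    · rw [h2]; ring
    · rw [h2]; linear_combination hx

end Hyperbolic

section HyperbolicSum
variable {V : Type*} [AddCommGroup V] [Module ℝ V] {T : V →ₗ[ℝ] V →ₗ[ℝ] V →ₗ[ℝ] ℝ}
  {e1 e2 n1 n2 : V}

theorem HypFrame.notMem (h : HypFrame T e1 e2 n1 n2) {s t : ℝ} (hst : ¬ (s = 0 ∧ t = 0)) :
    s • n1 + t • n2 ∉ Submodule.span ℝ {e1, e2} := by
  simpa using h.frame.notMem_span hst 0 (Submodule.zero_mem _)

theorem HypFrame.endpoint_ne_zero (hV : Module.finrank ℝ V = 4) (hT : SymTri T)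
    (hs : SmoothTri T) (h : HypFrame T e1 e2 n1 n2) (h2 : T e2 n1 n1 = 0) :
    T e1 n1 n1 ^ 2 - 4 / 3 * T n1 n1 n1 ≠ 0 := by
  intro h0
  have hn : n1 ∉ Submodule.span ℝ {e1, e2} := by
    simpa using h.notMem (s := 1) (t := 0) (by simp)
  have hM : Meets T e1 e2 n1 (Submodule.span ℝ {e2, (-(T e1 n1 n1 / 2)) • e1 + n1}) :=
    (meets_zero hT h.line h.frame.indep hn h.h111 h.h121 h.h221 _).2
      ⟨h2, _, by linear_combination (-3 / 4 : ℝ) * h0, rfl⟩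
  have hi : Indep2 ℝ e2 ((-(T e1 n1 n1 / 2)) • e1 + n1) := by
    intro x y hxy
    obtain ⟨-, k2, k3, -⟩ := h.frame (-(y * (T e1 n1 n1 / 2))) x y 0 (by rw [← hxy]; module)
    exact ⟨k2, k3⟩
  have ha : e1 ∈ Submodule.span ℝ {e1, e2} := Submodule.subset_span (by simp)
  have hb : e2 ∈ Submodule.span ℝ {e1, e2} := Submodule.subset_span (by simp)
  refine not_all_zero_of_notMem hV hT hs hM.1.2 hi (c := e1) ?_ ⟨?_, ?_, ?_⟩
  · intro hmem
    obtain ⟨x, y, hxy⟩ := Submodule.mem_span_pair.1 hmem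
    obtain ⟨k1, -, k3, -⟩ := h.frame (-(y * (T e1 n1 n1 / 2)) - 1) x y 0 (by
      rw [← sub_eq_zero] at hxy; rw [← hxy]; module)
    rw [k3] at k1; norm_num at k1
  · exact hT.polar h.line hb hb ha
  · simp only [map_add, map_smul, LinearMap.add_apply, LinearMap.smul_apply, smul_eq_mul,
      hT.polar h.line hb ha ha, hT.right e2 n1 e1, hT.left e2 e1, h.h121]
    ring
  · simp only [map_add, map_smul, LinearMap.add_apply, LinearMap.smul_apply, smul_eq_mul,
      hT.polar h.line ha ha ha, hT.right e1 n1 e1, hT.left n1 e1, h.h111,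
      hT.right n1 n1 e1]
    ring

theorem HypFrame.endpoint_fibre (hV : Module.finrank ℝ V = 4) (hT : SymTri T)
    (hs : SmoothTri T) (h : HypFrame T e1 e2 n1 n2) :
    (∀ M, Meets T e1 e2 n1 M → T e2 n1 n1 = 0 ∧ 0 < T e1 n1 n1 ^ 2 - 4 / 3 * T n1 n1 n1) ∧
    (T e2 n1 n1 = 0 ∧ 0 < T e1 n1 n1 ^ 2 - 4 / 3 * T n1 n1 n1 →
      ∃ S : Finset (Submodule ℝ V), (∀ M, M ∈ S ↔ Meets T e1 e2 n1 M) ∧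
        ∑ M ∈ S, segre T M = 2) := by
  classical
  have hn : n1 ∉ Submodule.span ℝ {e1, e2} := by
    simpa using h.notMem (s := 1) (t := 0) (by simp)
  have hm := meets_zero hT h.line h.frame.indep hn h.h111 h.h121 h.h221
  constructor
  · intro M hM
    obtain ⟨h2, x, hx, -⟩ := (hm M).1 hM
    refine ⟨h2, lt_of_le_of_ne ?_ (h.endpoint_ne_zero hV hT hs h2).symm⟩
    have : T e1 n1 n1 ^ 2 - 4 / 3 * T n1 n1 n1 = (2 * x + T e1 n1 n1) ^ 2 := by
      linear_combination (-4 / 3 : ℝ) * hx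
    rw [this]; positivity
  · rintro ⟨h2, hD⟩
    obtain ⟨r, hr, hr2⟩ : ∃ r, 0 < r ∧ r ^ 2 = T e1 n1 n1 ^ 2 - 4 / 3 * T n1 n1 n1 :=
      ⟨_, Real.sqrt_pos.2 hD, Real.sq_sqrt hD.le⟩
    let M : ℝ → Submodule ℝ V := fun x => Submodule.span ℝ {e2, x • e1 + n1}
    have hMm : ∀ M', Meets T e1 e2 n1 M' ↔ M' = M ((-T e1 n1 n1 + r) / 2) ∨
        M' = M ((-T e1 n1 n1 - r) / 2) := by
      intro M'
      rw [hm]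
      constructor
      · rintro ⟨-, x, hx, rfl⟩
        have : (x - (-T e1 n1 n1 + r) / 2) * (x - (-T e1 n1 n1 - r) / 2) = 0 := by
          linear_combination hx / 3 - hr2 / 4
        rcases mul_eq_zero.1 this with hx | hx
        · exact .inl (by rw [← sub_eq_zero.1 hx])
        · exact .inr (by rw [← sub_eq_zero.1 hx])
      · rintro (rfl | rfl)
        · exact ⟨h2, _, by linear_combination 3 / 4 * hr2, rfl⟩
        · exact ⟨h2, _, by linear_combination 3 / 4 * hr2, rfl⟩
    have hb : e2 ∈ Submodule.span ℝ {e1, e2} := Submodule.subset_span (by simp)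
    have ha : e1 ∈ Submodule.span ℝ {e1, e2} := Submodule.subset_span (by simp)
    have hne : M ((-T e1 n1 n1 + r) / 2) ≠ M ((-T e1 n1 n1 - r) / 2) := by
      intro heq
      have h1 : ((-T e1 n1 n1 + r) / 2) • e1 + n1 ∈ M ((-T e1 n1 n1 - r) / 2) := by
        rw [← heq]; exact Submodule.subset_span (by simp)
      obtain ⟨x, y, hxy⟩ := Submodule.mem_span_pair.1 h1
      obtain ⟨k1, -, k3, -⟩ := h.frame (y * ((-T e1 n1 n1 - r) / 2) - (-T e1 n1 n1 + r) / 2) x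
        (y - 1) 0 (by rw [← sub_eq_zero] at hxy; rw [← hxy]; module)
      have : y = 1 := by linarith
      subst this
      linarith
    have hseg : ∀ x, segre T (M x) = 1 := by
      intro x
      have : Hyp T (M x) := by
        refine ⟨e1, ?_, e2, Submodule.subset_span (by simp), ?_, ?_⟩
        · intro hmem
          obtain ⟨p, q, hxy⟩ := Submodule.mem_span_pair.1 hmem
          obtain ⟨k1, -, k3, -⟩ := h.frame (q * x - 1) p q 0 (by
            rw [← sub_eq_zero] at hxy; rw [← hxy]; module)
          rw [k3] at k1; norm_num at k1
        · intro h0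
          simpa using (h.frame 0 1 0 0 (by simp [h0]))
        · intro e he
          obtain ⟨p, q, rfl⟩ := Submodule.mem_span_pair.1 he
          simp only [map_add, map_smul, LinearMap.add_apply, LinearMap.smul_apply, smul_eq_mul,
            hT.polar h.line hb ha ha, hT.polar h.line hb hb ha, hT.right e2 n1 e1,
            hT.left e2 e1, h.h121]
          ring
      simp [segre, this]
    refine ⟨{M ((-T e1 n1 n1 + r) / 2), M ((-T e1 n1 n1 - r) / 2)}, fun M' => ?_, ?_⟩
    · rw [hMm]; simp
    · rw [Finset.sum_pair hne, hseg, hseg]; norm_num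

theorem HypFrame.interior_fibre (hV : Module.finrank ℝ V = 4) (hT : SymTri T)
    (hs : SmoothTri T) (hf : HypFrame T e1 e2 n1 n2) {g h : ℝ} (hg : 0 < g) (hh : 0 < h)
    (hgh : g ^ 2 + h ^ 2 = 1) {w w' : V} (hw : w = (h ^ 2) • n1 - (g ^ 2) • n2)
    (hw' : w' = - n1 - n2) {l1 l2 N d : ℝ} (h1 : T e1 w w = l1) (h2 : T e2 w w = l2)
    (h3 : T w w w = N)
    (hd : d = l1 ^ 2 + 4 * g ^ 2 * l1 * T e1 w w' + l2 ^ 2 - 4 * h ^ 2 * l2 * T e2 w w' -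
      4 / 3 * (h ^ 2 - g ^ 2) * N - 4 * g ^ 2 * h ^ 2 * T w w w') :
    (∀ M, Meets T e1 e2 w M → g ^ 2 * l1 ^ 2 - h ^ 2 * l2 ^ 2 - 4 / 3 * g ^ 2 * h ^ 2 * N = 0) ∧
    (g ^ 2 * l1 ^ 2 - h ^ 2 * l2 ^ 2 - 4 / 3 * g ^ 2 * h ^ 2 * N = 0 → d ≠ 0 ∧
      ∃ S : Finset (Submodule ℝ V), (∀ M, M ∈ S ↔ Meets T e1 e2 w M) ∧
        ∑ M ∈ S, segre T M = 2 * SignType.sign d) := by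
  classical
  have ha : e1 ∈ Submodule.span ℝ {e1, e2} := Submodule.subset_span (by simp)
  have hb : e2 ∈ Submodule.span ℝ {e1, e2} := Submodule.subset_span (by simp)
  have hn : w ∉ Submodule.span ℝ {e1, e2} := by
    rw [hw, sub_eq_add_neg, ← neg_smul]
    exact hf.notMem (fun h0 => hh.ne' (by simpa using h0.1))
  have q1 : T e1 e1 w = h ^ 2 := by
    simp only [hw, map_sub, map_smul, smul_eq_mul, hf.h111, hf.h112]; ring
  have q2 : T e1 e2 w = 0 := by
    simp only [hw, map_sub, map_smul, smul_eq_mul, hf.h121, hf.h122]; ring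
  have q3 : T e2 e2 w = -g ^ 2 := by
    simp only [hw, map_sub, map_smul, smul_eq_mul, hf.h221, hf.h222]; ring
  have q4 : T e1 e1 w' = -1 := by
    simp only [hw', map_sub, map_neg, hf.h111, hf.h112]; ring
  have q5 : T e1 e2 w' = 0 := by
    simp only [hw', map_sub, map_neg, hf.h121, hf.h122]; ring
  have q6 : T e2 e2 w' = -1 := by
    simp only [hw', map_sub, map_neg, hf.h221, hf.h222]; ring
  have hm := meets_interior hT hf.line hf.frame.indep hn hg hh q1 q2 q3
  rw [h1, h2, h3] at hm
  refine ⟨fun M hM => ((hm M).1 hM).1, fun hp => ?_⟩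
  let X : ℝ → ℝ := fun η => -(g * l1 + η * h * l2) / (2 * g * h ^ 2)
  let M : ℝ → Submodule ℝ V := fun η =>
    Submodule.span ℝ {g • e1 + (η * h) • e2, X η • e1 + w}
  have hX : ∀ η, 2 * g * h ^ 2 * X η = -(g * l1 + η * h * l2) := fun η => by
    simp only [X]; field_simp
  have hMm : ∀ M', Meets T e1 e2 w M' ↔ M' = M 1 ∨ M' = M (-1) := by
    intro M'
    rw [hm]
    constructor
    · rintro ⟨-, η, x, hη, hx, rfl⟩
      obtain rfl : x = X η := by
        have : 2 * g * h ^ 2 ≠ 0 := by positivity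
        apply mul_left_cancel₀ this
        rw [hx, hX]
      rcases hη with rfl | rfl
      · exact .inl rfl
      · exact .inr rfl
    · rintro (rfl | rfl)
      · exact ⟨hp, 1, X 1, by simp, hX 1, rfl⟩
      · exact ⟨hp, -1, X (-1), by simp, hX (-1), rfl⟩
  have hcoef : ∀ {p q s t : ℝ}, p • e1 + q • e2 + s • w + t • w' = 0 →
      p = 0 ∧ q = 0 ∧ s = 0 ∧ t = 0 := by
    intro p q s t h0
    obtain ⟨k1, k2, k3, k4⟩ := hf.frame p q (s * h ^ 2 - t) (-(s * g ^ 2) - t) (by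
      rw [← h0, hw, hw']; module)
    have hs0 : s = 0 := by linear_combination k3 - k4 - s * hgh
    subst hs0
    exact ⟨k1, k2, rfl, by linarith⟩
  have hfr : ∀ η, η = 1 ∨ η = -1 → Frame ℝ (g • e1 + (η * h) • e2) (X η • e1 + w)
      (g • e1 - (η * h) • e2) w' := by
    intro η hη x y s t h0
    obtain ⟨k1, k2, k3, k4⟩ := hcoef (p := (x + s) * g + y * X η) (q := (x - s) * (η * h)) (s := y)
      (t := t) (by rw [← h0]; module)
    subst k3 k4
    have hηh : η * h ≠ 0 := by rcases hη with rfl | rfl <;> simp [hh.ne']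
    have hx1 : x + s = 0 := by simpa [hg.ne'] using k1
    have hx2 : x - s = 0 := by simpa [hηh] using k2
    exact ⟨by linarith, rfl, by linarith, rfl⟩
  have hMc : ∀ η, η = 1 ∨ η = -1 → OnCubic T (M η) := by
    rintro η (rfl | rfl)
    · exact ((hMm _).2 (.inl rfl)).1
    · exact ((hMm _).2 (.inr rfl)).1
  have hne : M 1 ≠ M (-1) := by
    intro heq
    have hmem : g • e1 + ((1 : ℝ) * h) • e2 ∈ M (-1) := by
      rw [← heq]; exact Submodule.subset_span (by simp)
    obtain ⟨x, y, hxy⟩ := Submodule.mem_span_pair.1 hmem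
    obtain ⟨k1, k2, k3, -⟩ := hcoef (p := x * g + y * X (-1) - g) (q := -(x * h) - h) (s := y)
      (t := 0) (by rw [← sub_eq_zero] at hxy; rw [← hxy]; module)
    subst k3
    have hx1 : x = 1 := by
      apply mul_right_cancel₀ hg.ne'; linear_combination k1
    subst hx1
    linarith
  have hres : ∀ η, η = 1 ∨ η = -1 → resTri T (g • e1 + (η * h) • e2) (X η • e1 + w)
      (g • e1 - (η * h) • e2) w' = 4 * g ^ 2 * h ^ 2 * d := by
    intro η hη
    have hη2 : η * η = 1 := by rcases hη with rfl | rfl <;> norm_num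
    have a0 : T (g • e1 + (η * h) • e2) (g • e1 + (η * h) • e2) (g • e1 - (η * h) • e2) = 0 := by
      have hA := hT.polar hf.line ha ha ha
      have hB := hT.polar hf.line ha ha hb
      have hC := hT.polar hf.line ha hb ha
      have hD := hT.polar hf.line ha hb hb
      have hE := hT.polar hf.line hb hb ha
      have hF := hT.polar hf.line hb hb hb
      simp only [map_add, map_sub, map_smul, LinearMap.add_apply, LinearMap.smul_apply,
        smul_eq_mul, hT.left e2 e1, hA, hB, hC, hD, hE, hF]
      ring
    have a1 : T (g • e1 + (η * h) • e2) (X η • e1 + w) (g • e1 - (η * h) • e2) =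
        2 * g ^ 2 * h ^ 2 := by
      have hA := hT.polar hf.line ha ha ha
      have hB := hT.polar hf.line ha ha hb
      simp only [map_add, map_sub, map_smul, LinearMap.add_apply, LinearMap.smul_apply,
        smul_eq_mul, hT.right _ w e1, hT.right _ w e2, hT.left e2 e1, hA, hB, q1, q2, q3,
        hT.polar hf.line ha hb ha, hT.polar hf.line ha hb hb]
      linear_combination g ^ 2 * h ^ 2 * hη2
    have a2 : T (X η • e1 + w) (X η • e1 + w) (g • e1 - (η * h) • e2) = -2 * η * h * l2 := by
      simp only [map_add, map_sub, map_smul, LinearMap.add_apply, LinearMap.smul_apply,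
        smul_eq_mul, hT.polar hf.line ha ha ha, hT.polar hf.line ha ha hb, hT.left w e1,
        hT.right _ w e1, hT.right _ w e2, hT.left w e2, q1, q2, h1, h2]
      linear_combination hX η
    have b0 : T (g • e1 + (η * h) • e2) (g • e1 + (η * h) • e2) w' = -1 := by
      simp only [map_add, map_smul, LinearMap.add_apply, LinearMap.smul_apply,
        smul_eq_mul, hT.left e2 e1, q4, q5, q6]
      linear_combination -hgh - h ^ 2 * hη2
    have b1 : T (g • e1 + (η * h) • e2) (X η • e1 + w) w' =
        - X η * g + g * T e1 w w' + η * h * T e2 w w' := by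
      simp only [map_add, map_smul, LinearMap.add_apply, LinearMap.smul_apply,
        smul_eq_mul, hT.left e2 e1, q4, q5]
      ring
    have b2 : T (X η • e1 + w) (X η • e1 + w) w' =
        - X η ^ 2 + 2 * X η * T e1 w w' + T w w w' := by
      simp only [map_add, map_smul, LinearMap.add_apply, LinearMap.smul_apply,
        smul_eq_mul, hT.left w e1, q4]
      ring
    unfold resTri
    rw [a0, a1, a2, b0, b1, b2, hd]
    have hx := hX η
    obtain ⟨x, hx'⟩ : ∃ x, x = X η := ⟨_, rfl⟩
    rw [← hx'] at hx ⊢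
    obtain ⟨L1, hL1⟩ : ∃ L1, L1 = T e1 w w' := ⟨_, rfl⟩
    obtain ⟨L2, hL2⟩ : ∃ L2, L2 = T e2 w w' := ⟨_, rfl⟩
    obtain ⟨N1, hN1⟩ : ∃ N1, N1 = T w w w' := ⟨_, rfl⟩
    rw [← hL1, ← hL2, ← hN1]
    linear_combination (8 * η * g ^ 2 * h * l2 + 4 * g ^ 2 * (2 * g * h ^ 2 * x -
      (g * l1 + η * h * l2)) - 16 * g ^ 3 * h ^ 2 * L1) * hx + (4 * h ^ 2 * l2 ^ 2 -
      4 * g ^ 2 * h ^ 2 * l2 ^ 2 - 16 * g ^ 2 * h ^ 4 * l2 * L2) * hη2 -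
      4 * h ^ 2 * l2 ^ 2 * hgh - 4 * (h ^ 2 - g ^ 2) * hp
  have hd0 : d ≠ 0 := by
    have := resTri_ne_zero hV hT hs (hMc 1 (.inl rfl)).2 (hfr 1 (.inl rfl))
    rw [hres 1 (.inl rfl)] at this
    exact right_ne_zero_of_mul this
  have hseg : ∀ η, η = 1 ∨ η = -1 → segre T (M η) = SignType.sign d := by
    intro η hη
    rw [segre_eq_sign hV hT hs (hMc η hη).2 (hfr η hη), hres η hη, sign_mul, sign_pos, one_mul]
    positivity
  refine ⟨hd0, {M 1, M (-1)}, fun M' => ?_, ?_⟩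
  · rw [hMm]; simp
  · rw [Finset.sum_pair hne, hseg _ (.inl rfl), hseg _ (.inr rfl)]; ring

end HyperbolicSum

section MeetingSum
variable {V : Type*} [AddCommGroup V] [Module ℝ V] {T : V →ₗ[ℝ] V →ₗ[ℝ] V →ₗ[ℝ] ℝ}
  {e1 e2 n1 n2 : V}

/-- The quadratic polynomial `a (1 - X)² - 2 b X (1 - X) + c X²`. -/
def quadPoly (a b c : ℝ) : Polynomial ℝ :=
  Polynomial.C a * (1 - Polynomial.X) ^ 2 - Polynomial.C (2 * b) * Polynomial.X * (1 - Polynomial.X)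
    + Polynomial.C c * Polynomial.X ^ 2

/-- The value of the cubic form at `(1 - X) n1 - X n2`. -/
def cubPoly (a b c d : ℝ) : Polynomial ℝ :=
  Polynomial.C a * (1 - Polynomial.X) ^ 3
    - Polynomial.C (3 * b) * Polynomial.X * (1 - Polynomial.X) ^ 2
    + Polynomial.C (3 * c) * Polynomial.X ^ 2 * (1 - Polynomial.X)
    - Polynomial.C d * Polynomial.X ^ 3

/-- The polynomial whose roots in `[0, 1]` parametrise the lines meeting `⟨e1, e2⟩`. -/
def meetPoly (T : V →ₗ[ℝ] V →ₗ[ℝ] V →ₗ[ℝ] ℝ) (e1 e2 n1 n2 : V) : Polynomial ℝ :=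
  Polynomial.X * quadPoly (T e1 n1 n1) (T e1 n1 n2) (T e1 n2 n2) ^ 2
    - (1 - Polynomial.X) * quadPoly (T e2 n1 n1) (T e2 n1 n2) (T e2 n2 n2) ^ 2
    - Polynomial.C (4 / 3) * Polynomial.X * (1 - Polynomial.X) *
      cubPoly (T n1 n1 n1) (T n1 n1 n2) (T n1 n2 n2) (T n2 n2 n2)

theorem quadPoly_eval (a b c v : ℝ) :
    (quadPoly a b c).eval v = a * (1 - v) ^ 2 - 2 * b * v * (1 - v) + c * v ^ 2 := by
  simp [quadPoly]

theorem quadPoly_deriv (a b c v : ℝ) : (quadPoly a b c).derivative.eval v =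
    -2 * a * (1 - v) - 2 * b * (1 - 2 * v) + 2 * c * v := by
  simp [quadPoly, pow_two]; ring

theorem cubPoly_eval (a b c d v : ℝ) : (cubPoly a b c d).eval v =
    a * (1 - v) ^ 3 - 3 * b * v * (1 - v) ^ 2 + 3 * c * v ^ 2 * (1 - v) - d * v ^ 3 := by
  simp [cubPoly]

theorem cubPoly_deriv (a b c d v : ℝ) : (cubPoly a b c d).derivative.eval v =
    -3 * (a * (1 - v) ^ 2 + b * (1 - v) * (1 - 3 * v) - c * v * (2 - 3 * v) + d * v ^ 2) := by
  simp [cubPoly, pow_succ]; ring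

theorem meetPoly_deriv (v : ℝ) : (meetPoly T e1 e2 n1 n2).derivative.eval v =
    (quadPoly (T e1 n1 n1) (T e1 n1 n2) (T e1 n2 n2)).eval v ^ 2 +
    2 * v * (quadPoly (T e1 n1 n1) (T e1 n1 n2) (T e1 n2 n2)).eval v *
      (quadPoly (T e1 n1 n1) (T e1 n1 n2) (T e1 n2 n2)).derivative.eval v +
    (quadPoly (T e2 n1 n1) (T e2 n1 n2) (T e2 n2 n2)).eval v ^ 2 -
    2 * (1 - v) * (quadPoly (T e2 n1 n1) (T e2 n1 n2) (T e2 n2 n2)).eval v *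
      (quadPoly (T e2 n1 n1) (T e2 n1 n2) (T e2 n2 n2)).derivative.eval v -
    4 / 3 * (1 - 2 * v) * (cubPoly (T n1 n1 n1) (T n1 n1 n2) (T n1 n2 n2) (T n2 n2 n2)).eval v -
    4 / 3 * v * (1 - v) *
      (cubPoly (T n1 n1 n1) (T n1 n1 n2) (T n1 n2 n2) (T n2 n2 n2)).derivative.eval v := by
  simp [meetPoly, pow_two]; ring

theorem meetPoly_eval (v : ℝ) : (meetPoly T e1 e2 n1 n2).eval v =
    v * (quadPoly (T e1 n1 n1) (T e1 n1 n2) (T e1 n2 n2)).eval v ^ 2 -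
    (1 - v) * (quadPoly (T e2 n1 n1) (T e2 n1 n2) (T e2 n2 n2)).eval v ^ 2 -
    4 / 3 * v * (1 - v) *
      (cubPoly (T n1 n1 n1) (T n1 n1 n2) (T n1 n2 n2) (T n2 n2 n2)).eval v := by
  simp [meetPoly]

theorem HypFrame.fibre (hV : Module.finrank ℝ V = 4) (hT : SymTri T)
    (hs : SmoothTri T) (hf : HypFrame T e1 e2 n1 n2) {v : ℝ} (hv0 : 0 ≤ v) (hv1 : v ≤ 1) :
    (∀ M, Meets T e1 e2 ((1 - v) • n1 - v • n2) M → IsCountedRoot (meetPoly T e1 e2 n1 n2) v) ∧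
    ((meetPoly T e1 e2 n1 n2).eval v = 0 → (meetPoly T e1 e2 n1 n2).derivative.eval v ≠ 0) ∧
    (IsCountedRoot (meetPoly T e1 e2 n1 n2) v →
      ∃ S : Finset (Submodule ℝ V), (∀ M, M ∈ S ↔ Meets T e1 e2 ((1 - v) • n1 - v • n2) M) ∧
        ∑ M ∈ S, segre T M = 2 * SignType.sign ((meetPoly T e1 e2 n1 n2).derivative.eval v)) := by
  rcases hv0.eq_or_lt with rfl | hv0
  · have hw : (1 - 0 : ℝ) • n1 - (0 : ℝ) • n2 = n1 := by module
    have he : (meetPoly T e1 e2 n1 n2).eval 0 = -(T e2 n1 n1) ^ 2 := by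
      rw [meetPoly_eval, quadPoly_eval, quadPoly_eval, cubPoly_eval]; ring
    have hd : T e2 n1 n1 = 0 → (meetPoly T e1 e2 n1 n2).derivative.eval 0 =
        T e1 n1 n1 ^ 2 - 4 / 3 * T n1 n1 n1 := by
      intro h0
      rw [meetPoly_deriv, quadPoly_eval, quadPoly_eval, cubPoly_eval, quadPoly_deriv,
        quadPoly_deriv, cubPoly_deriv, h0]
      ring
    have he' : (meetPoly T e1 e2 n1 n2).eval 0 = 0 ↔ T e2 n1 n1 = 0 := by rw [he]; simp
    obtain ⟨k1, k2⟩ := hf.endpoint_fibre hV hT hs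
    rw [hw]
    refine ⟨fun M hM => ?_, fun h => ?_, fun h => ?_⟩
    · obtain ⟨h1, h2⟩ := k1 M hM
      exact ⟨⟨le_rfl, zero_le_one⟩, he'.2 h1, .inr (by rwa [hd h1])⟩
    · rw [hd (he'.1 h)]
      exact hf.endpoint_ne_zero hV hT hs (he'.1 h)
    · have h1 := he'.1 h.2.1
      have h2 : 0 < (meetPoly T e1 e2 n1 n2).derivative.eval 0 := by
        rcases h.2.2 with h | h
        · exact absurd h.1 (lt_irrefl _)
        · exact h
      obtain ⟨S, hS, hsum⟩ := k2 ⟨h1, by rwa [hd h1] at h2⟩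
      exact ⟨S, hS, by rw [hsum, sign_pos h2]; rfl⟩
  rcases hv1.eq_or_lt with rfl | hv1
  · have hw : (1 - 1 : ℝ) • n1 - (1 : ℝ) • n2 = -n2 := by module
    have he : (meetPoly T e1 e2 n1 n2).eval 1 = (T e1 n2 n2) ^ 2 := by
      rw [meetPoly_eval, quadPoly_eval, quadPoly_eval, cubPoly_eval]; ring
    have hd : T e1 n2 n2 = 0 → (meetPoly T e1 e2 n1 n2).derivative.eval 1 =
        T e2 n2 n2 ^ 2 - 4 / 3 * T n2 n2 n2 := by
      intro h0
      rw [meetPoly_deriv, quadPoly_eval, quadPoly_eval, cubPoly_eval, quadPoly_deriv,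
        quadPoly_deriv, cubPoly_deriv, h0]
      ring
    have he' : (meetPoly T e1 e2 n1 n2).eval 1 = 0 ↔ T e1 n2 n2 = 0 := by rw [he]; simp
    have hf' := hf.swap hT
    obtain ⟨k1, k2⟩ := hf'.endpoint_fibre hV hT hs
    have hmm : ∀ M, Meets T e1 e2 (-n2) M ↔ Meets T e2 e1 n2 M := fun M =>
      ⟨fun h => by simpa using h.neg.swap, fun h => h.swap.neg⟩
    rw [hw]
    simp only [hmm]
    refine ⟨fun M hM => ?_, fun h => ?_, fun h => ?_⟩
    · obtain ⟨h1, h2⟩ := k1 M hM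
      exact ⟨⟨zero_le_one, le_rfl⟩, he'.2 h1, .inr (by rwa [hd h1])⟩
    · rw [hd (he'.1 h)]
      exact hf'.endpoint_ne_zero hV hT hs (he'.1 h)
    · have h1 := he'.1 h.2.1
      have h2 : 0 < (meetPoly T e1 e2 n1 n2).derivative.eval 1 := by
        rcases h.2.2 with h | h
        · exact absurd h.2 (lt_irrefl _)
        · exact h
      obtain ⟨S, hS, hsum⟩ := k2 ⟨h1, by rwa [hd h1] at h2⟩
      exact ⟨S, hS, by rw [hsum, sign_pos h2]; rfl⟩
  obtain ⟨g, hg, rfl⟩ : ∃ g : ℝ, 0 < g ∧ v = g ^ 2 :=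
    ⟨√v, Real.sqrt_pos.2 hv0, (Real.sq_sqrt hv0.le).symm⟩
  obtain ⟨h, hh, hh2⟩ : ∃ h : ℝ, 0 < h ∧ 1 - g ^ 2 = h ^ 2 :=
    ⟨√(1 - g ^ 2), Real.sqrt_pos.2 (by linarith), (Real.sq_sqrt (by linarith)).symm⟩
  have q1 := quadPoly_eval (T e1 n1 n1) (T e1 n1 n2) (T e1 n2 n2) (g ^ 2)
  have q2 := quadPoly_eval (T e2 n1 n1) (T e2 n1 n2) (T e2 n2 n2) (g ^ 2)
  have q3 := cubPoly_eval (T n1 n1 n1) (T n1 n1 n2) (T n1 n2 n2) (T n2 n2 n2) (g ^ 2)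
  have d1 := quadPoly_deriv (T e1 n1 n1) (T e1 n1 n2) (T e1 n2 n2) (g ^ 2)
  have d2 := quadPoly_deriv (T e2 n1 n1) (T e2 n1 n2) (T e2 n2 n2) (g ^ 2)
  have d3 := cubPoly_deriv (T n1 n1 n1) (T n1 n1 n2) (T n1 n2 n2) (T n2 n2 n2) (g ^ 2)
  have hsym1 := hT.right e1 n2 n1
  have hsym2 := hT.right e2 n2 n1
  have hsym3 := hT.right n1 n2 n1
  have hsym4 := hT.left n2 n1 n1
  have hsym5 := hT.left n2 n1 n2
  have hsym6 := hT.right n2 n2 n1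
  obtain ⟨k1, k2⟩ := hf.interior_fibre hV hT hs hg hh (by linarith)
    (w := (1 - g ^ 2) • n1 - (g ^ 2) • n2) (w' := -n1 - n2) (by rw [hh2]) rfl
    (l1 := (quadPoly (T e1 n1 n1) (T e1 n1 n2) (T e1 n2 n2)).eval (g ^ 2))
    (l2 := (quadPoly (T e2 n1 n1) (T e2 n1 n2) (T e2 n2 n2)).eval (g ^ 2))
    (N := (cubPoly (T n1 n1 n1) (T n1 n1 n2) (T n1 n2 n2) (T n2 n2 n2)).eval (g ^ 2))
    (d := (meetPoly T e1 e2 n1 n2).derivative.eval (g ^ 2))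
    (by
      rw [q1]
      simp only [map_sub, map_smul, LinearMap.sub_apply, LinearMap.smul_apply, smul_eq_mul, hsym1]
      ring)
    (by
      rw [q2]
      simp only [map_sub, map_smul, LinearMap.sub_apply, LinearMap.smul_apply, smul_eq_mul, hsym2]
      ring)
    (by
      rw [q3]
      simp only [map_sub, map_smul, LinearMap.sub_apply, LinearMap.smul_apply, smul_eq_mul, hsym3,
        hsym6, hsym5, hsym4]
      ring)
    (by
      rw [meetPoly_deriv, d1, d2, d3]
      simp only [map_sub, map_neg, map_smul, LinearMap.sub_apply, LinearMap.smul_apply, smul_eq_mul,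
        hsym1, hsym2, hsym3, hsym4, hsym5, hsym6, ← hh2]
      ring)
  have he : (meetPoly T e1 e2 n1 n2).eval (g ^ 2) =
    g ^ 2 * (quadPoly (T e1 n1 n1) (T e1 n1 n2) (T e1 n2 n2)).eval (g ^ 2) ^ 2 -
    h ^ 2 * (quadPoly (T e2 n1 n1) (T e2 n1 n2) (T e2 n2 n2)).eval (g ^ 2) ^ 2 -
    4 / 3 * g ^ 2 * h ^ 2 *
      (cubPoly (T n1 n1 n1) (T n1 n1 n2) (T n1 n2 n2) (T n2 n2 n2)).eval (g ^ 2) := by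
    rw [meetPoly_eval, hh2]
  rw [← he] at k1 k2
  exact ⟨fun M hM => ⟨⟨hv0.le, hv1.le⟩, k1 M hM, .inl ⟨hv0, hv1⟩⟩, fun h => (k2 h).1,
    fun h => (k2 h.2.1).2⟩

/-- The lines of the cubic surface meeting a given hyperbolic line have total Segre sign `2`. -/
theorem sum_segre_meeting (hV : Module.finrank ℝ V = 4) (hT : SymTri T) (hs : SmoothTri T)
    {E : Submodule ℝ V} (hE : OnCubic T E) (hh : Hyp T E) :
    ∃ S : Finset (Submodule ℝ V), (∀ M, M ∈ S ↔ OnCubic T M ∧ M ≠ E ∧ E ⊓ M ≠ ⊥) ∧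
      ∑ M ∈ S, segre T M = 2 := by
  classical
  obtain ⟨e1, e2, n1, n2, rfl, hf⟩ := exists_hypFrame hV hT hs hE hh
  have hfib := fun v (h0 : 0 ≤ v) (h1 : v ≤ 1) => hf.fibre hV hT hs h0 h1
  obtain ⟨R, hR, hsum⟩ := sum_sign_derivative (p := meetPoly T e1 e2 n1 n2)
    (by rw [meetPoly_eval]; nlinarith [sq_nonneg
          ((quadPoly (T e2 n1 n1) (T e2 n1 n2) (T e2 n2 n2)).eval 0)])
    (by rw [meetPoly_eval]; nlinarith [sq_nonneg
          ((quadPoly (T e1 n1 n1) (T e1 n1 n2) (T e1 n2 n2)).eval 1)])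
    (fun v h0 h1 => (hfib v h0 h1).2.1)
  have hS : ∀ v, ∃ S : Finset (Submodule ℝ V), v ∈ R →
      (∀ M, M ∈ S ↔ Meets T e1 e2 ((1 - v) • n1 - v • n2) M) ∧
        ∑ M ∈ S, segre T M =
          2 * SignType.sign ((meetPoly T e1 e2 n1 n2).derivative.eval v) := by
    intro v
    by_cases hv : v ∈ R
    · have hc := (hR v).1 hv
      obtain ⟨S, hS⟩ := (hfib v hc.1.1 hc.1.2).2.2 hc
      exact ⟨S, fun _ => hS⟩
    · exact ⟨∅, fun h => absurd h hv⟩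
  choose S hS using hS
  have hnotmem : ∀ v : ℝ, ∀ e ∈ Submodule.span ℝ {e1, e2},
      e + ((1 - v) • n1 - v • n2) ∉ Submodule.span ℝ {e1, e2} := by
    intro v e he
    rw [show e + ((1 - v) • n1 - v • n2) = e + (1 - v) • n1 + (-v) • n2 by module]
    exact hf.frame.notMem_span (by rintro ⟨h1, h2⟩; linarith) e he
  refine ⟨R.biUnion S, fun M => ?_, ?_⟩
  · rw [Finset.mem_biUnion]
    constructor
    · rintro ⟨v, hv, hM⟩
      obtain ⟨h1, ⟨m, hm, hm', hm0⟩, x, y, h3⟩ := ((hS v hv).1 M).1 hM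
      refine ⟨h1, ?_, fun h0 => hm0 ?_⟩
      · rintro rfl
        exact hnotmem v _ (Submodule.mem_span_pair.2 ⟨x, y, rfl⟩) h3
      · have : m ∈ Submodule.span ℝ {e1, e2} ⊓ M := ⟨hm', hm⟩
        rw [h0] at this
        simpa using this
    · rintro ⟨h1, h2, h3⟩
      obtain ⟨m, ⟨hm, hmM⟩, hm0⟩ := Submodule.exists_mem_ne_zero_of_ne_bot h3
      obtain ⟨-, c, -, hMc, -, hmc, hcE⟩ := exists_meet_basis hE.1 h1.1 h2.symm hm0 hm hmM
      have hc : c ∈ M := by rw [hMc]; exact Submodule.subset_span (by simp)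
      obtain ⟨x, y, s, t, rfl⟩ := hf.frame.coords hV c
      obtain ⟨p, q, rfl⟩ := Submodule.mem_span_pair.1 hm
      have hz := hT.polar h1.2 hmM hmM hc
      have ha : e1 ∈ Submodule.span ℝ {e1, e2} := Submodule.subset_span (by simp)
      have hb : e2 ∈ Submodule.span ℝ {e1, e2} := Submodule.subset_span (by simp)
      have hz2 : s * p ^ 2 + t * q ^ 2 = 0 := by
        simp only [map_add, map_smul, LinearMap.add_apply, LinearMap.smul_apply, smul_eq_mul,
          hT.left e2 e1, hT.polar hf.line ha ha ha, hT.polar hf.line ha ha hb,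
          hT.polar hf.line ha hb ha, hT.polar hf.line ha hb hb, hT.polar hf.line hb hb ha,
          hT.polar hf.line hb hb hb, hf.h111, hf.h121, hf.h221, hf.h112, hf.h122, hf.h222] at hz
        linear_combination hz
      have hpq : 0 < p ^ 2 + q ^ 2 := by
        by_contra hcon
        have hp : p = 0 := by nlinarith [sq_nonneg p, sq_nonneg q]
        have hq : q = 0 := by nlinarith [sq_nonneg p, sq_nonneg q]
        subst hp hq
        simp at hm0
      have hst : ¬ (s = 0 ∧ t = 0) := by
        rintro ⟨rfl, rfl⟩
        apply hcE
        simpa using Submodule.mem_span_pair.2 ⟨x, y, rfl⟩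
      have hst0 : s - t ≠ 0 := by
        intro h0
        obtain rfl : s = t := by linarith
        have : s = 0 := by
          have : s * (p ^ 2 + q ^ 2) = 0 := by linarith
          simpa [hpq.ne'] using this
        exact hst ⟨this, this⟩
      have hv : -t / (s - t) = p ^ 2 / (p ^ 2 + q ^ 2) := by
        rw [div_eq_div_iff hst0 hpq.ne']
        linear_combination -hz2
      have hv0 : 0 ≤ -t / (s - t) := by rw [hv]; positivity
      have hv1 : -t / (s - t) ≤ 1 := by
        rw [hv, div_le_one hpq]; nlinarith [sq_nonneg q]
      have hMeets : Meets T e1 e2 ((1 - -t / (s - t)) • n1 - (-t / (s - t)) • n2) M := by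
        refine ⟨h1, ⟨_, hmM, hm, hm0⟩, x / (s - t), y / (s - t), ?_⟩
        convert M.smul_mem (s - t)⁻¹ hc using 1
        have e1 : 1 - -t / (s - t) = s / (s - t) := by field_simp; ring
        rw [e1]
        simp only [div_eq_mul_inv]
        module
      have hvR := (hR _).2 ((hfib _ hv0 hv1).1 M hMeets)
      exact ⟨_, hvR, ((hS _ hvR).1 M).2 hMeets⟩
  · rw [Finset.sum_biUnion]
    · rw [Finset.sum_congr rfl fun v hv => (hS v hv).2, ← Finset.mul_sum, hsum]; rfl
    · intro v hv v' hv' hne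
      rw [Function.onFun, Finset.disjoint_left]
      intro M hM hM'
      obtain ⟨h1, ⟨m, hm, hm', hm0⟩, x, y, h3⟩ := ((hS v hv).1 M).1 hM
      obtain ⟨-, -, x', y', h3'⟩ := ((hS v' hv').1 M).1 hM'
      have hcE := hnotmem v _ (Submodule.mem_span_pair.2 ⟨x, y, rfl⟩)
      have hspan := span_pair_eq_of_mem h1.1 hm h3 (indep2_of_notMem hm' hm0 hcE)
      rw [hspan] at h3'
      obtain ⟨α, β, hαβ⟩ := Submodule.mem_span_pair.1 h3'
      obtain ⟨p, q, rfl⟩ := Submodule.mem_span_pair.1 hm'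
      obtain ⟨-, -, k3, k4⟩ := hf.frame (α * p + β * x - x') (α * q + β * y - y')
        (β * (1 - v) - (1 - v')) (-(β * v) + v') (by
          rw [← sub_eq_zero] at hαβ; rw [← hαβ]; module)
      apply hne
      have hβ : β = 1 := by linarith
      subst hβ
      linarith

end MeetingSum

section LineCount
variable {V : Type*} [AddCommGroup V] [Module ℝ V] {T : V →ₗ[ℝ] V →ₗ[ℝ] V →ₗ[ℝ] ℝ}

theorem segre_eq_one_iff {E : Submodule ℝ V} : segre T E = 1 ↔ Hyp T E := by
  unfold segre; split_ifs with h <;> simp [h]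

theorem segre_eq_or (E : Submodule ℝ V) : segre T E = 1 ∨ segre T E = -1 := by
  unfold segre; split_ifs <;> simp

theorem det_neg_of_not_hyp (hV : Module.finrank ℝ V = 4) (hT : SymTri T) {a b m n : V}
    (hE : ∀ x ∈ Submodule.span ℝ {a, b}, T x x x = 0) (hf : Frame ℝ a b m n)
    (hh : ¬ Hyp T (Submodule.span ℝ {a, b})) {s t : ℝ} (hst : ¬ (s = 0 ∧ t = 0)) :
    (s * T a a m + t * T a a n) * (s * T b b m + t * T b b n) -
      (s * T a b m + t * T a b n) ^ 2 < 0 := by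
  rw [hyp_iff hV hT hE hf, not_le, resTri] at hh
  generalize T a a m = a0 at *
  generalize T a b m = a1 at *
  generalize T b b m = a2 at *
  generalize T a a n = b0 at *
  generalize T a b n = b1 at *
  generalize T b b n = b2 at *
  have key : ∀ s t : ℝ, 4 * (a0 * a2 - a1 ^ 2) *
      ((s * a0 + t * b0) * (s * a2 + t * b2) - (s * a1 + t * b1) ^ 2) =
      (2 * (a0 * a2 - a1 ^ 2) * s + (a0 * b2 + a2 * b0 - 2 * a1 * b1) * t) ^ 2 +
      (4 * (a0 * a2 - a1 ^ 2) * (b0 * b2 - b1 ^ 2) -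
        (a0 * b2 + a2 * b0 - 2 * a1 * b1) ^ 2) * t ^ 2 := by
    intro s t; ring
  have hP0 : a0 * a2 - a1 ^ 2 ≠ 0 := by
    intro h0; rw [h0] at hh; nlinarith [sq_nonneg (a0 * b2 + a2 * b0 - 2 * a1 * b1)]
  have pos : ∀ s t : ℝ, ¬ (s = 0 ∧ t = 0) → 0 < 4 * (a0 * a2 - a1 ^ 2) *
      ((s * a0 + t * b0) * (s * a2 + t * b2) - (s * a1 + t * b1) ^ 2) := by
    intro s t hst
    rw [key]
    rcases eq_or_ne t 0 with rfl | ht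
    · have hs : s ≠ 0 := fun h => hst ⟨h, rfl⟩
      have : (2 * (a0 * a2 - a1 ^ 2) * s) ≠ 0 := by positivity
      have := sq_pos_of_ne_zero this
      nlinarith
    · have := mul_pos (neg_pos.2 hh) (sq_pos_of_ne_zero ht)
      nlinarith [sq_nonneg (2 * (a0 * a2 - a1 ^ 2) * s + (a0 * b2 + a2 * b0 - 2 * a1 * b1) * t)]
  have hP : a0 * a2 - a1 ^ 2 < 0 := by
    by_contra hP
    have hP' : 0 < a0 * a2 - a1 ^ 2 := lt_of_le_of_ne (not_lt.1 hP) hP0.symm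
    have h0 : ¬ (b0 = 0 ∧ -a0 = 0) := by
      rintro ⟨rfl, h⟩
      have : a0 = 0 := by linarith
      subst this
      nlinarith [sq_nonneg a1]
    have h1 := pos b0 (-a0) h0
    have h2 := (mul_pos_iff_of_pos_left (by positivity)).1 h1
    nlinarith [sq_nonneg (b0 * a1 + -a0 * b1)]
  have := pos s t hst
  by_contra hcon
  nlinarith [mul_nonneg (neg_nonneg.2 hP.le) (not_lt.1 hcon)]

/-- An elliptic line meets another real line of the surface. -/
theorem exists_meeting_of_not_hyp (hV : Module.finrank ℝ V = 4) (hT : SymTri T)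
    {E : Submodule ℝ V} (hE : OnCubic T E) (hh : ¬ Hyp T E) :
    ∃ M, OnCubic T M ∧ E ≠ M ∧ E ⊓ M ≠ ⊥ := by
  have hne : E ≠ ⊥ := by rintro rfl; simpa using hE.1
  obtain ⟨a, haE, ha0⟩ := Submodule.exists_mem_ne_zero_of_ne_bot hne
  obtain ⟨b, -, hab, rfl⟩ := exists_pair_of_finrank_two hE.1 haE ha0
  obtain ⟨m, n, hf⟩ := exists_frame hV hab
  have ha : a ∈ Submodule.span ℝ {a, b} := Submodule.subset_span (by simp)
  have hb : b ∈ Submodule.span ℝ {a, b} := Submodule.subset_span (by simp)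
  let D : V → ℝ := fun w =>
    (T a a w * T b b w - T a b w ^ 2) * T w w w / 3 -
      (T a a w * T b w w ^ 2 - 2 * T a b w * T a w w * T b w w + T b b w * T a w w ^ 2) / 4
  let w : ℝ → V := fun v => Real.cos v • m + Real.sin v • n
  have hcont : Continuous fun v => D (w v) := by
    simp only [D, w, map_add, map_smul, LinearMap.add_apply, LinearMap.smul_apply, smul_eq_mul]
    fun_prop
  have hodd : D (w Real.pi) = -D (w 0) := by
    simp only [D, w, Real.cos_pi, Real.sin_pi, Real.cos_zero, Real.sin_zero, map_add, map_smul,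
      LinearMap.add_apply, LinearMap.smul_apply, smul_eq_mul]
    ring
  obtain ⟨v, hv⟩ : ∃ v, D (w v) = 0 := by
    rcases le_total (D (w 0)) 0 with h0 | h0
    · obtain ⟨v, -, hv⟩ := intermediate_value_Icc Real.pi_pos.le hcont.continuousOn
        ⟨h0, by rw [hodd]; linarith⟩
      exact ⟨v, hv⟩
    · obtain ⟨v, -, hv⟩ := intermediate_value_Icc' Real.pi_pos.le hcont.continuousOn
        ⟨by rw [hodd]; linarith, h0⟩
      exact ⟨v, hv⟩
  have hst : ¬ (Real.cos v = 0 ∧ Real.sin v = 0) := by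
    rintro ⟨h1, h2⟩
    have := Real.sin_sq_add_cos_sq v
    rw [h1, h2] at this
    norm_num at this
  have hdet := det_neg_of_not_hyp hV hT hE.2 hf hh hst
  have hdet : T a a (w v) * T b b (w v) - T a b (w v) ^ 2 < 0 := by
    simpa only [w, map_add, map_smul, smul_eq_mul] using hdet
  have hwE : ∀ e ∈ Submodule.span ℝ {a, b}, e + w v ∉ Submodule.span ℝ {a, b} := by
    intro e he
    simpa only [w, add_assoc] using hf.notMem_span hst e he
  simp only [D] at hv
  generalize w v = w at *
  obtain ⟨x, y, hxy, hq⟩ := (exists_binary_quadratic_zero_iff (P := T a a w) (Q := 2 * T a b w)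
    (R := T b b w)).2 (by nlinarith)
  obtain ⟨d, hd⟩ : ∃ d, d = T a a w * T b b w - T a b w ^ 2 := ⟨_, rfl⟩
  rw [← hd] at hdet
  have hd0 := hdet.ne
  obtain ⟨x', hx'⟩ : ∃ x', d * x' = -(T b b w * T a w w - T a b w * T b w w) / 2 :=
    ⟨_, mul_div_cancel₀ _ hd0⟩
  obtain ⟨y', hy'⟩ : ∃ x', d * x' = -(T a a w * T b w w - T a b w * T a w w) / 2 :=
    ⟨_, mul_div_cancel₀ _ hd0⟩
  have e1 : T a a w * x' + T a b w * y' + T a w w / 2 = 0 := by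
    apply mul_left_cancel₀ hd0
    linear_combination T a a w * hx' + T a b w * hy' + (T a w w) / 2 * hd
  have e2 : T a b w * x' + T b b w * y' + T b w w / 2 = 0 := by
    apply mul_left_cancel₀ hd0
    linear_combination T a b w * hx' + T b b w * hy' + (T b w w) / 2 * hd
  have e3 : T a w w / 2 * x' + T b w w / 2 * y' + T w w w / 3 = 0 := by
    apply mul_left_cancel₀ hd0
    linear_combination T a w w / 2 * hx' + T b w w / 2 * hy' + hv + (T w w w) / 3 * hd
  have hmem : x • a + y • b ∈ Submodule.span ℝ {a, b} := Submodule.mem_span_pair.2 ⟨_, _, rfl⟩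
  have hmem' : x' • a + y' • b ∈ Submodule.span ℝ {a, b} := Submodule.mem_span_pair.2 ⟨_, _, rfl⟩
  have hm0 : x • a + y • b ≠ 0 := fun h0 => hxy (hab _ _ h0)
  have hcE := hwE _ hmem'
  have zs : T a a a = 0 ∧ T a a b = 0 ∧ T a b a = 0 ∧ T a b b = 0 ∧ T b b a = 0 ∧ T b b b = 0 :=
    ⟨hT.polar hE.2 ha ha ha, hT.polar hE.2 ha ha hb, hT.polar hE.2 ha hb ha,
      hT.polar hE.2 ha hb hb, hT.polar hE.2 hb hb ha, hT.polar hE.2 hb hb hb⟩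
  obtain ⟨z1, z2, z3, z4, z5, z6⟩ := zs
  refine ⟨Submodule.span ℝ {x • a + y • b, x' • a + y' • b + w},
    onCubic_span hT (indep2_of_notMem hmem hm0 hcE) (hE.2 _ hmem) ?_ ?_ ?_, ?_, ?_⟩
  · simp only [map_add, map_smul, LinearMap.add_apply, LinearMap.smul_apply, smul_eq_mul,
      hT.left b a, z1, z2, z3, z4, z5, z6]
    linear_combination hq
  · simp only [map_add, map_smul, LinearMap.add_apply, LinearMap.smul_apply, smul_eq_mul,
      hT.left b a, hT.right _ w a, hT.right _ w b, z1, z2, z3, z4, z5, z6]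
    linear_combination 2 * x * e1 + 2 * y * e2
  · simp only [map_add, map_smul, LinearMap.add_apply, LinearMap.smul_apply, smul_eq_mul,
      hT.left b a, hT.left w a, hT.left w b, hT.right _ w a, hT.right _ w b, z1, z2, z3, z4, z5, z6]
    linear_combination 3 * x' * e1 + 3 * y' * e2 + 3 * e3
  · intro h
    apply hcE
    rw [h]
    exact Submodule.subset_span (by simp)
  · intro h
    have : x • a + y • b ∈ Submodule.span ℝ {a, b} ⊓
      Submodule.span ℝ {x • a + y • b, x' • a + y' • b + w} :=
      ⟨hmem, Submodule.subset_span (by simp)⟩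
    rw [h] at this
    exact hm0 (by simpa using this)

theorem exists_hyp_line (hV : Module.finrank ℝ V = 4) (hT : SymTri T) (hs : SmoothTri T)
    {E : Submodule ℝ V} (hE : OnCubic T E) : ∃ E', OnCubic T E' ∧ Hyp T E' := by
  by_cases hh : Hyp T E
  · exact ⟨E, hE, hh⟩
  obtain ⟨M, hM, hne, hi⟩ := exists_meeting_of_not_hyp hV hT hE hh
  obtain ⟨C, hC, hprod⟩ := exists_third_line hV hT hs hE hM hne hi
  by_contra! hcon
  have h1 := hcon M hM
  have h2 := hcon C hC.lineC
  simp [segre, hh, h1, h2] at hprod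

theorem exists_hyp_tritangent (hV : Module.finrank ℝ V = 4) (hT : SymTri T) (hs : SmoothTri T)
    {E : Submodule ℝ V} (hE : OnCubic T E) (hh : Hyp T E) :
    ∃ P A B, IsTritangent T P E A B ∧ Hyp T A ∧ Hyp T B := by
  obtain ⟨S, hS, hsum⟩ := sum_segre_meeting hV hT hs hE hh
  obtain ⟨A, hAS, hA⟩ : ∃ A ∈ S, 0 < segre T A := by
    by_contra! hc
    have := Finset.sum_nonpos hc
    omega
  obtain ⟨hA1, hA2, hA3⟩ := (hS A).1 hAS
  obtain ⟨B, hB, hprod⟩ := exists_third_line hV hT hs hE hA1 hA2.symm hA3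
  have hA' : segre T A = 1 := by rcases segre_eq_or (T := T) A with h | h <;> omega
  rw [segre_eq_one_iff.2 hh, hA'] at hprod
  exact ⟨_, A, B, hB, segre_eq_one_iff.1 hA', segre_eq_one_iff.1 (by simpa using hprod)⟩

theorem inf_ne_bot_of_le {P A B : Submodule ℝ V} (hP : Module.finrank ℝ P = 3)
    (hA : Module.finrank ℝ A = 2) (hB : Module.finrank ℝ B = 2) (hAP : A ≤ P) (hBP : B ≤ P) :
    A ⊓ B ≠ ⊥ := by
  have fP : FiniteDimensional ℝ P := FiniteDimensional.of_finrank_pos (by omega)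
  have fA : FiniteDimensional ℝ A := FiniteDimensional.of_finrank_pos (by omega)
  have fB : FiniteDimensional ℝ B := FiniteDimensional.of_finrank_pos (by omega)
  intro h
  have h1 := Submodule.finrank_sup_add_finrank_inf_eq A B
  have h2 := Submodule.finrank_mono (sup_le hAP hBP)
  rw [h, finrank_bot] at h1
  omega

theorem IsTritangent.not_le {P A B C M : Submodule ℝ V} (h : IsTritangent T P A B C)
    (hM : OnCubic T M) (hMA : M ≠ A) (hMB : M ≠ B) (hMC : M ≠ C) : ¬ M ≤ P := by
  intro hMP
  have hne : M ≠ ⊥ := by rintro rfl; simpa using hM.1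
  obtain ⟨u, hu, hu0⟩ := Submodule.exists_mem_ne_zero_of_ne_bot hne
  obtain ⟨v, hv, huv, -⟩ := exists_pair_of_finrank_two hM.1 hu hu0
  have hcov : ∀ i : Fin 4, ∃ j : Fin 3, u + ((i : ℕ) : ℝ) • v ∈ ![A, B, C] j := by
    intro i
    have hm := M.add_mem hu (M.smul_mem ((i : ℕ) : ℝ) hv)
    rcases h.mem _ (hMP hm) (hM.2 _ hm) with h | h | h
    · exact ⟨0, h⟩
    · exact ⟨1, h⟩
    · exact ⟨2, h⟩
  choose j hj using hcov
  obtain ⟨i, i', hii, hjj⟩ := Fintype.exists_ne_map_eq_of_card_lt j (by simp)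
  have key : ∀ L : Submodule ℝ V, OnCubic T L → M ≠ L → u + ((i : ℕ) : ℝ) • v ∈ L →
      u + ((i' : ℕ) : ℝ) • v ∈ L → False := by
    intro L hL hML h1 h2
    have hii' : ((i : ℕ) : ℝ) - ((i' : ℕ) : ℝ) ≠ 0 := by
      rw [sub_ne_zero]; exact_mod_cast fun h => hii (Fin.ext h)
    have hvL : v ∈ L := by
      have := L.smul_mem (((i : ℕ) : ℝ) - ((i' : ℕ) : ℝ))⁻¹ (L.sub_mem h1 h2)
      rwa [show u + ((i : ℕ) : ℝ) • v - (u + ((i' : ℕ) : ℝ) • v) =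
        (((i : ℕ) : ℝ) - ((i' : ℕ) : ℝ)) • v by module, smul_smul, inv_mul_cancel₀ hii',
        one_smul] at this
    have huL : u ∈ L := by
      have := L.sub_mem h1 (L.smul_mem ((i : ℕ) : ℝ) hvL)
      rwa [add_sub_cancel_right] at this
    exact hML ((span_pair_eq_of_mem hM.1 hu hv huv).trans
      (span_pair_eq_of_mem hL.1 huL hvL huv).symm)
  have h1 := hj i
  have h2 := hj i'
  rw [← hjj] at h2
  generalize j i = k at h1 h2
  fin_cases k
  · exact key A h.lineA hMA h1 h2
  · exact key B h.lineB hMB h1 h2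
  · exact key C h.lineC hMC h1 h2

theorem IsTritangent.meets (hV : Module.finrank ℝ V = 4) {P A B C M : Submodule ℝ V}
    (h : IsTritangent T P A B C) (hM : OnCubic T M) :
    A ⊓ M ≠ ⊥ ∨ B ⊓ M ≠ ⊥ ∨ C ⊓ M ≠ ⊥ := by
  have fV : FiniteDimensional ℝ V := FiniteDimensional.of_finrank_pos (by omega)
  have h1 := Submodule.finrank_sup_add_finrank_inf_eq P M
  have h2 := Submodule.finrank_le (P ⊔ M)
  have h3 : P ⊓ M ≠ ⊥ := by
    intro h0
    rw [h0, finrank_bot, h.finrank, hM.1] at h1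
    omega
  obtain ⟨x, ⟨hxP, hxM⟩, hx0⟩ := Submodule.exists_mem_ne_zero_of_ne_bot h3
  have key : ∀ L : Submodule ℝ V, x ∈ L → L ⊓ M ≠ ⊥ := fun L hL h0 => by
    have : x ∈ L ⊓ M := ⟨hL, hxM⟩
    rw [h0] at this
    exact hx0 (by simpa using this)
  rcases h.mem x hxP (hM.2 x hxM) with h | h | h
  · exact .inl (key _ h)
  · exact .inr (.inl (key _ h))
  · exact .inr (.inr (key _ h))

theorem IsTritangent.not_meets_two (hV : Module.finrank ℝ V = 4) (hT : SymTri T)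
    (hs : SmoothTri T) {P A B C M : Submodule ℝ V} (h : IsTritangent T P A B C)
    (hM : OnCubic T M) (hMP : ¬ M ≤ P) : ¬ (A ⊓ M ≠ ⊥ ∧ B ⊓ M ≠ ⊥) := by
  rintro ⟨hA, hB⟩
  have fV : FiniteDimensional ℝ V := FiniteDimensional.of_finrank_pos (by omega)
  obtain ⟨x, ⟨hxA, hxM⟩, hx0⟩ := Submodule.exists_mem_ne_zero_of_ne_bot hA
  obtain ⟨y, ⟨hyB, hyM⟩, hy0⟩ := Submodule.exists_mem_ne_zero_of_ne_bot hB
  obtain ⟨c, hc, hxc, hMxc⟩ := exists_pair_of_finrank_two hM.1 hxM hx0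
  have hcP : c ∉ P := by
    intro hcP
    apply hMP
    rw [hMxc, Submodule.span_le]
    rintro z (rfl | rfl)
    · exact h.leA hxA
    · exact hcP
  have hxB : x ∈ B := by
    obtain ⟨p, q, rfl⟩ := Submodule.mem_span_pair.1 (hMxc ▸ hyM)
    have hq : q = 0 := by
      by_contra hq
      apply hcP
      have h1 := P.smul_mem q⁻¹ (P.sub_mem (h.leB hyB) (P.smul_mem p (h.leA hxA)))
      rwa [add_sub_cancel_left, smul_smul, inv_mul_cancel₀ hq, one_smul] at h1
    subst hq
    have hp : p ≠ 0 := by rintro rfl; simp at hy0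
    have h1 := B.smul_mem p⁻¹ hyB
    rwa [zero_smul, add_zero, smul_smul, inv_mul_cancel₀ hp, one_smul] at h1
  have hsup : A ⊔ B = P := by
    apply Submodule.eq_of_le_of_finrank_eq (sup_le h.leA h.leB)
    rw [h.finrank, finrank_sup_of_inf_ne_bot h.lineA.1 h.lineB.1 h.neAB
      (inf_ne_bot_of_le h.finrank h.lineA.1 h.lineB.1 h.leA h.leB)]
  have htop : P ⊔ M = ⊤ := by
    apply Submodule.eq_top_of_finrank_eq
    have h1 := Submodule.finrank_lt_finrank_of_lt (left_lt_sup.2 hMP)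
    have h2 := Submodule.finrank_le (P ⊔ M)
    rw [h.finrank] at h1
    omega
  have hker : ∀ L : Submodule ℝ V, OnCubic T L → x ∈ L → L ≤ LinearMap.ker (T x x) :=
    fun L hL hx z hz => hT.polar hL.2 hx hx hz
  have hall : ⊤ ≤ LinearMap.ker (T x x) := by
    rw [← htop, ← hsup]
    exact sup_le (sup_le (hker A h.lineA hxA) (hker B h.lineB hxB)) (hker M hM hxM)
  refine hx0 (hs x 0 fun w => ?_).1
  have : T x x w = 0 := hall Submodule.mem_top
  simp [this]

theorem sum_segre_sdiff {S : Finset (Submodule ℝ V)} {A B : Submodule ℝ V}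
    [DecidableEq (Submodule ℝ V)] (hsum : ∑ M ∈ S, segre T M = 2)
    (hA : A ∈ S) (hB : B ∈ S) (hne : A ≠ B)
    (hhA : Hyp T A) (hhB : Hyp T B) : ∑ M ∈ S \ {A, B}, segre T M = 0 := by
  have h := Finset.sum_sdiff (f := segre T) (s₁ := {A, B}) (s₂ := S) (by
    intro x hx
    rcases Finset.mem_insert.1 hx with rfl | hx
    · exact hA
    · rwa [Finset.mem_singleton.1 hx])
  rw [hsum, Finset.sum_pair hne, segre_eq_one_iff.2 hhA, segre_eq_one_iff.2 hhB] at h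
  linarith

/-- The signed count of the real lines of a smooth real cubic surface containing a real line. -/
theorem sum_segre (hV : Module.finrank ℝ V = 4) (hT : SymTri T) (hs : SmoothTri T)
    (hex : ∃ E, OnCubic T E) :
    ∃ S : Finset (Submodule ℝ V), (∀ M, M ∈ S ↔ OnCubic T M) ∧ ∑ M ∈ S, segre T M = 3 := by
  classical
  obtain ⟨E0, hE0⟩ := hex
  obtain ⟨A, hA, hhA⟩ := exists_hyp_line hV hT hs hE0
  obtain ⟨P, B, C, h, hhB, hhC⟩ := exists_hyp_tritangent hV hT hs hA hhA
  obtain ⟨SA, hSA, sumA⟩ := sum_segre_meeting hV hT hs h.lineA hhA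
  obtain ⟨SB, hSB, sumB⟩ := sum_segre_meeting hV hT hs h.lineB hhB
  obtain ⟨SC, hSC, sumC⟩ := sum_segre_meeting hV hT hs h.lineC hhC
  have hi := fun {L L'} (hL : OnCubic T L) (hL' : OnCubic T L') =>
    inf_ne_bot_of_le h.finrank hL.1 hL'.1
  have sA := sum_segre_sdiff sumA ((hSA B).2 ⟨h.lineB, h.neAB.symm, hi h.lineA h.lineB h.leA h.leB⟩)
    ((hSA C).2 ⟨h.lineC, h.neAC.symm, hi h.lineA h.lineC h.leA h.leC⟩) h.neBC hhB hhC
  have sB := sum_segre_sdiff sumB ((hSB A).2 ⟨h.lineA, h.neAB, hi h.lineB h.lineA h.leB h.leA⟩)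
    ((hSB C).2 ⟨h.lineC, h.neBC.symm, hi h.lineB h.lineC h.leB h.leC⟩) h.neAC hhA hhC
  have sC := sum_segre_sdiff sumC ((hSC A).2 ⟨h.lineA, h.neAC, hi h.lineC h.lineA h.leC h.leA⟩)
    ((hSC B).2 ⟨h.lineB, h.neBC, hi h.lineC h.lineB h.leC h.leB⟩) h.neAB hhA hhB
  have mA : ∀ M, M ∈ SA \ {B, C} ↔ (OnCubic T M ∧ M ≠ A ∧ A ⊓ M ≠ ⊥) ∧ M ≠ B ∧ M ≠ C := by
    intro M; simp [hSA]
  have mB : ∀ M, M ∈ SB \ {A, C} ↔ (OnCubic T M ∧ M ≠ B ∧ B ⊓ M ≠ ⊥) ∧ M ≠ A ∧ M ≠ C := by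
    intro M; simp [hSB]
  have mC : ∀ M, M ∈ SC \ {A, B} ↔ (OnCubic T M ∧ M ≠ C ∧ C ⊓ M ≠ ⊥) ∧ M ≠ A ∧ M ≠ B := by
    intro M; simp [hSC]
  have dAB : Disjoint (SA \ {B, C}) (SB \ {A, C}) := Finset.disjoint_left.2 fun M h1 h2 => by
    rw [mA] at h1
    rw [mB] at h2
    exact h.not_meets_two hV hT hs h1.1.1 (h.not_le h1.1.1 h1.1.2.1 h1.2.1 h1.2.2)
      ⟨h1.1.2.2, h2.1.2.2⟩
  have dAC : Disjoint (SA \ {B, C}) (SC \ {A, B}) := Finset.disjoint_left.2 fun M h1 h2 => by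
    rw [mA] at h1
    rw [mC] at h2
    exact h.rotate.not_meets_two hV hT hs h1.1.1 (h.not_le h1.1.1 h1.1.2.1 h1.2.1 h1.2.2)
      ⟨h2.1.2.2, h1.1.2.2⟩
  have dBC : Disjoint (SB \ {A, C}) (SC \ {A, B}) := Finset.disjoint_left.2 fun M h1 h2 => by
    rw [mB] at h1
    rw [mC] at h2
    exact h.rotate.rotate.not_meets_two hV hT hs h1.1.1
      (h.not_le h1.1.1 h1.2.1 h1.1.2.1 h1.2.2) ⟨h1.1.2.2, h2.1.2.2⟩
  have d0 : Disjoint ({A, B, C} : Finset (Submodule ℝ V))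
      (SA \ {B, C} ∪ (SB \ {A, C} ∪ SC \ {A, B})) := Finset.disjoint_left.2 fun M h1 h2 => by
    simp only [Finset.mem_union, mA, mB, mC] at h2
    simp only [Finset.mem_insert, Finset.mem_singleton] at h1
    tauto
  refine ⟨{A, B, C} ∪ (SA \ {B, C} ∪ (SB \ {A, C} ∪ SC \ {A, B})), fun M => ?_, ?_⟩
  · simp only [Finset.mem_union, mA, mB, mC, Finset.mem_insert, Finset.mem_singleton]
    constructor
    · rintro ((rfl | rfl | rfl) | h' | h' | h')
      · exact h.lineA
      · exact h.lineB
      · exact h.lineC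
      all_goals exact h'.1.1
    · intro hM
      have := h.meets hV hM
      tauto
  · rw [Finset.sum_union d0, Finset.sum_union (Finset.disjoint_union_right.2 ⟨dAB, dAC⟩),
      Finset.sum_union dBC, sA, sB, sC, Finset.sum_insert (by simp [h.neAB, h.neAC]),
      Finset.sum_pair h.neBC, segre_eq_one_iff.2 hhA, segre_eq_one_iff.2 hhB,
      segre_eq_one_iff.2 hhC]
    norm_num

end LineCount

section Resultant

/-- The resultant of the binary forms `b0 x² + b1 xy + b2 y²` and
`c0 x³ + c1 x² y + c2 x y² + c3 y³`. -/
def res23 (b0 b1 b2 c0 c1 c2 c3 : ℝ) : ℝ :=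
  b0 ^ 3 * c3 ^ 2 - b0 ^ 2 * b1 * c2 * c3 - 2 * b0 ^ 2 * b2 * c1 * c3 + b0 ^ 2 * b2 * c2 ^ 2 +
    b0 * b1 ^ 2 * c1 * c3 + 3 * b0 * b1 * b2 * c0 * c3 - b0 * b1 * b2 * c1 * c2 -
    2 * b0 * b2 ^ 2 * c0 * c2 + b0 * b2 ^ 2 * c1 ^ 2 - b1 ^ 3 * c0 * c3 + b1 ^ 2 * b2 * c0 * c2 -
    b1 * b2 ^ 2 * c0 * c1 + b2 ^ 3 * c0 ^ 2

set_option maxHeartbeats 4000000 in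
theorem res23_subst (b0 b1 b2 c0 c1 c2 c3 p q p' q' : ℝ) :
    res23 (b0 * p ^ 2 + b1 * p * q + b2 * q ^ 2)
      (2 * b0 * p * p' + b1 * (p * q' + p' * q) + 2 * b2 * q * q')
      (b0 * p' ^ 2 + b1 * p' * q' + b2 * q' ^ 2)
      (c0 * p ^ 3 + c1 * p ^ 2 * q + c2 * p * q ^ 2 + c3 * q ^ 3)
      (3 * c0 * p ^ 2 * p' + c1 * (2 * p * p' * q + p ^ 2 * q') +
        c2 * (p' * q ^ 2 + 2 * p * q * q') + 3 * c3 * q ^ 2 * q')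
      (3 * c0 * p * p' ^ 2 + c1 * (2 * p * p' * q' + p' ^ 2 * q) +
        c2 * (p * q' ^ 2 + 2 * p' * q * q') + 3 * c3 * q * q' ^ 2)
      (c0 * p' ^ 3 + c1 * p' ^ 2 * q' + c2 * p' * q' ^ 2 + c3 * q' ^ 3) =
      (p * q' - p' * q) ^ 6 * res23 b0 b1 b2 c0 c1 c2 c3 := by
  unfold res23; ring

theorem res23_add (b0 b1 b2 c0 c1 c2 c3 r r' : ℝ) :
    res23 b0 b1 b2 (c0 + r * b0) (c1 + r * b1 + r' * b0) (c2 + r * b2 + r' * b1) (c3 + r' * b2) =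
      res23 b0 b1 b2 c0 c1 c2 c3 := by
  unfold res23; ring

theorem exists_binary_cubic_zero (c0 c1 c2 c3 : ℝ) : ∃ x y : ℝ, ¬ (x = 0 ∧ y = 0) ∧
    c0 * x ^ 3 + c1 * x ^ 2 * y + c2 * x * y ^ 2 + c3 * y ^ 3 = 0 := by
  let D : ℝ → ℝ := fun v => c0 * Real.cos v ^ 3 + c1 * Real.cos v ^ 2 * Real.sin v +
    c2 * Real.cos v * Real.sin v ^ 2 + c3 * Real.sin v ^ 3
  have hcont : Continuous D := by fun_prop
  have hodd : D Real.pi = -D 0 := by simp [D]; ring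
  obtain ⟨v, hv⟩ : ∃ v, D v = 0 := by
    rcases le_total (D 0) 0 with h0 | h0
    · obtain ⟨v, -, hv⟩ := intermediate_value_Icc Real.pi_pos.le hcont.continuousOn
        ⟨h0, by rw [hodd]; linarith⟩
      exact ⟨v, hv⟩
    · obtain ⟨v, -, hv⟩ := intermediate_value_Icc' Real.pi_pos.le hcont.continuousOn
        ⟨by rw [hodd]; linarith, h0⟩
      exact ⟨v, hv⟩
  refine ⟨Real.cos v, Real.sin v, ?_, hv⟩
  rintro ⟨h1, h2⟩
  have := Real.sin_sq_add_cos_sq v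
  rw [h1, h2] at this
  norm_num at this

theorem common_zero_or_factor_aux {b0 b1 b2 c0 c1 c2 c3 : ℝ} (hb : b0 ≠ 0)
    (h : res23 b0 b1 b2 c0 c1 c2 c3 = 0) :
    (∃ x y : ℝ, ¬ (x = 0 ∧ y = 0) ∧ b0 * x ^ 2 + b1 * x * y + b2 * y ^ 2 = 0 ∧
      c0 * x ^ 3 + c1 * x ^ 2 * y + c2 * x * y ^ 2 + c3 * y ^ 3 = 0) ∨
    ∃ l0 l1 : ℝ, ∀ x y : ℝ, c0 * x ^ 3 + c1 * x ^ 2 * y + c2 * x * y ^ 2 + c3 * y ^ 3 =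
      (b0 * x ^ 2 + b1 * x * y + b2 * y ^ 2) * (l0 * x + l1 * y) := by
  obtain ⟨r0, h0⟩ : ∃ r0, r0 = b0 ^ 2 * c2 - b0 * c0 * b2 - b1 * (b0 * c1 - b1 * c0) := ⟨_, rfl⟩
  obtain ⟨r1, h1⟩ : ∃ r1, r1 = b0 ^ 2 * c3 - b2 * (b0 * c1 - b1 * c0) := ⟨_, rfl⟩
  have hr : b0 * r1 ^ 2 - b1 * r0 * r1 + b2 * r0 ^ 2 = 0 := by
    unfold res23 at h
    rw [h0, h1]
    linear_combination b0 ^ 2 * h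
  have hdiv : ∀ x y : ℝ, b0 ^ 2 * (c0 * x ^ 3 + c1 * x ^ 2 * y + c2 * x * y ^ 2 + c3 * y ^ 3) =
      (b0 * x ^ 2 + b1 * x * y + b2 * y ^ 2) * (b0 * c0 * x + (b0 * c1 - b1 * c0) * y) +
        y ^ 2 * (r0 * x + r1 * y) := by
    intro x y; rw [h0, h1]; ring
  have hb2 : b0 ^ 2 ≠ 0 := pow_ne_zero _ hb
  by_cases hz : r1 = 0 ∧ r0 = 0
  · right
    refine ⟨b0 * c0 / b0 ^ 2, (b0 * c1 - b1 * c0) / b0 ^ 2, fun x y => ?_⟩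
    apply mul_left_cancel₀ hb2
    rw [hdiv, hz.1, hz.2]
    field_simp
    ring
  · left
    have hB : b0 * r1 ^ 2 + b1 * r1 * (-r0) + b2 * (-r0) ^ 2 = 0 := by linear_combination hr
    refine ⟨r1, -r0, by simpa using hz, hB, ?_⟩
    apply mul_left_cancel₀ hb2
    rw [hdiv, hB]
    ring

theorem common_zero_or_factor {b0 b1 b2 c0 c1 c2 c3 : ℝ}
    (h : res23 b0 b1 b2 c0 c1 c2 c3 = 0) :
    (∃ x y : ℝ, ¬ (x = 0 ∧ y = 0) ∧ b0 * x ^ 2 + b1 * x * y + b2 * y ^ 2 = 0 ∧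
      c0 * x ^ 3 + c1 * x ^ 2 * y + c2 * x * y ^ 2 + c3 * y ^ 3 = 0) ∨
    ∃ l0 l1 : ℝ, ∀ x y : ℝ, c0 * x ^ 3 + c1 * x ^ 2 * y + c2 * x * y ^ 2 + c3 * y ^ 3 =
      (b0 * x ^ 2 + b1 * x * y + b2 * y ^ 2) * (l0 * x + l1 * y) := by
  by_cases hb0 : b0 = 0
  swap
  · exact common_zero_or_factor_aux hb0 h
  by_cases hb2 : b2 = 0
  swap
  · have h' : res23 b2 b1 b0 c3 c2 c1 c0 = 0 := by
      rw [← h]; unfold res23; ring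
    rcases common_zero_or_factor_aux hb2 h' with ⟨x, y, hxy, e1, e2⟩ | ⟨l0, l1, hl⟩
    · exact .inl ⟨y, x, fun h => hxy h.symm, by linear_combination e1, by linear_combination e2⟩
    · exact .inr ⟨l1, l0, fun x y => by linear_combination hl y x⟩
  subst hb0 hb2
  left
  by_cases hb1 : b1 = 0
  · subst hb1
    obtain ⟨x, y, hxy, hc⟩ := exists_binary_cubic_zero c0 c1 c2 c3
    exact ⟨x, y, hxy, by ring, hc⟩
  · have h0 : b1 ^ 3 * (c0 * c3) = 0 := by
      unfold res23 at h; linear_combination -h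
    rcases mul_eq_zero.1 ((mul_eq_zero.1 h0).resolve_left (pow_ne_zero _ hb1)) with rfl | rfl
    · exact ⟨1, 0, by simp, by simp, by simp⟩
    · exact ⟨0, 1, by simp, by simp, by simp⟩

end Resultant

section Existence
variable {V : Type*} [AddCommGroup V] [Module ℝ V] {T : V →ₗ[ℝ] V →ₗ[ℝ] V →ₗ[ℝ] ℝ}

/-- The resultant detecting lines through `P` in the plane `⟨P, u, v⟩`. -/
def lineRes (T : V →ₗ[ℝ] V →ₗ[ℝ] V →ₗ[ℝ] ℝ) (P u v : V) : ℝ :=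
  res23 (T P u u) (2 * T P u v) (T P v v) (T u u u) (3 * T u u v) (3 * T u v v) (T v v v)

theorem lineRes_subst (hT : SymTri T) {P u v : V} (h0 : T P P P = 0) (h1 : T P P u = 0)
    (h2 : T P P v = 0) (p q r p' q' r' : ℝ) :
    lineRes T P (p • u + q • v + r • P) (p' • u + q' • v + r' • P) =
      (p * q' - p' * q) ^ 6 * lineRes T P u v := by
  unfold lineRes
  rw [← res23_subst]
  refine Eq.trans ?_ (res23_add _ _ _ _ _ _ _ (3 * r) (3 * r'))
  congr 1
  all_goals
    simp only [map_add, map_smul, LinearMap.add_apply, LinearMap.smul_apply, smul_eq_mul,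
      hT.left u P, hT.left v P, hT.left v u, hT.right _ u P, hT.right _ v P, hT.right _ v u,
      h0, h1, h2]
    ring

theorem lineRes_neg (T : V →ₗ[ℝ] V →ₗ[ℝ] V →ₗ[ℝ] ℝ) (P u v : V) :
    lineRes T (-P) u v = -lineRes T P u v := by
  unfold lineRes res23
  simp only [map_neg, LinearMap.neg_apply]
  ring

theorem exists_line_of_lineRes_eq_zero (hT : SymTri T) {P u v : V}
    (hi : ∀ x y z : ℝ, x • P + y • u + z • v = 0 → x = 0 ∧ y = 0 ∧ z = 0)
    (h0 : T P P P = 0) (h1 : T P P u = 0) (h2 : T P P v = 0) (h : lineRes T P u v = 0) :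
    ∃ E, OnCubic T E := by
  rcases common_zero_or_factor h with ⟨x, y, hxy, e1, e2⟩ | ⟨l0, l1, hl⟩
  · refine ⟨Submodule.span ℝ {P, x • u + y • v}, onCubic_span hT ?_ h0 ?_ ?_ ?_⟩
    · intro s t hst
      obtain ⟨k1, k2, k3⟩ := hi s (t * x) (t * y) (by rw [← hst]; module)
      refine ⟨k1, ?_⟩
      by_contra ht
      exact hxy ⟨by simpa [ht] using k2, by simpa [ht] using k3⟩
    · simp [h1, h2]
    · simp only [map_add, map_smul, LinearMap.add_apply, LinearMap.smul_apply, smul_eq_mul,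
        hT.right _ v u]
      linear_combination e1
    · simp only [map_add, map_smul, LinearMap.add_apply, LinearMap.smul_apply, smul_eq_mul,
        hT.right _ v u, hT.left v u]
      linear_combination e2
  · refine ⟨Submodule.span ℝ {u - (l0 / 3) • P, v - (l1 / 3) • P}, finrank_span_pair ?_, ?_⟩
    · intro s t hst
      obtain ⟨-, k2, k3⟩ := hi (-(s * (l0 / 3)) - t * (l1 / 3)) s t (by rw [← hst]; module)
      exact ⟨k2, k3⟩
    · intro w hw
      obtain ⟨s, t, rfl⟩ := Submodule.mem_span_pair.1 hw
      simp only [map_add, map_sub, map_smul, LinearMap.add_apply, LinearMap.sub_apply,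
        LinearMap.smul_apply, smul_eq_mul,
        hT.left u P, hT.left v P, hT.left v u, hT.right _ u P, hT.right _ v P, hT.right _ v u,
        h0, h1, h2]
      linear_combination hl s t

/-- Tangent vectors at `P` obtained from pairs of vectors. -/
def tangentVec (T : V →ₗ[ℝ] V →ₗ[ℝ] V →ₗ[ℝ] ℝ) (P a b : V) : V := T P P a • b - T P P b • a

theorem tangentVec_tangent (P a b : V) : T P P (tangentVec T P a b) = 0 := by
  simp only [tangentVec, map_sub, map_smul, smul_eq_mul]; ring

/-- Sum of line resultants over tangent vectors coming from a basis. -/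
def lineSum (T : V →ₗ[ℝ] V →ₗ[ℝ] V →ₗ[ℝ] ℝ) (e : Fin 4 → V) (P : V) : ℝ :=
  ∑ i, ∑ j, ∑ k, lineRes T P (tangentVec T P (e i) (e j)) (tangentVec T P (e i) (e k))

theorem lineSum_neg (T : V →ₗ[ℝ] V →ₗ[ℝ] V →ₗ[ℝ] ℝ) (e : Fin 4 → V) (P : V) :
    lineSum T e (-P) = -lineSum T e P := by
  have h : ∀ a b, tangentVec T (-P) a b = tangentVec T P a b := fun a b => by simp [tangentVec]
  simp only [lineSum, h, lineRes_neg, Finset.sum_neg_distrib]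

theorem exists_line_of_lineSum_eq_zero (hT : SymTri T) (hs : SmoothTri T)
    (e : Module.Basis (Fin 4) ℝ V) {P : V} (hP : P ≠ 0) (h0 : T P P P = 0)
    (h : lineSum T e P = 0) : ∃ E, OnCubic T E := by
  classical
  have hV : Module.finrank ℝ V = 4 := by simpa using Module.finrank_eq_card_basis e
  obtain ⟨i, hi⟩ : ∃ i, T P P (e i) ≠ 0 := by
    by_contra! hc
    have : T P P = 0 := e.ext (by simpa using hc)
    exact hP (hs P 0 fun w => by simp [this]).1
  obtain ⟨n, hn⟩ : ∃ n, e i = n := ⟨_, rfl⟩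
  rw [hn] at hi
  have hPn : Indep2 ℝ P n := by
    intro x y hxy
    have hy : y = 0 := by
      have := congrArg (T P P) hxy
      simpa [h0, hi] using this
    subst hy
    exact ⟨by simpa [hP] using hxy, rfl⟩
  obtain ⟨c, d, hF⟩ := exists_frame hV hPn
  obtain ⟨Q, hQ⟩ : ∃ Q, Q = c - (T P P c / T P P n) • n := ⟨_, rfl⟩
  obtain ⟨R, hR⟩ : ∃ R, R = d - (T P P d / T P P n) • n := ⟨_, rfl⟩
  have hgQ : T P P Q = 0 := by
    rw [hQ, map_sub, map_smul, smul_eq_mul]; field_simp; ring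
  have hgR : T P P R = 0 := by
    rw [hR, map_sub, map_smul, smul_eq_mul]; field_simp; ring
  have hind : ∀ x y z : ℝ, x • P + y • Q + z • R = 0 → x = 0 ∧ y = 0 ∧ z = 0 := by
    intro x y z hxyz
    obtain ⟨k1, -, k3, k4⟩ := hF x
      (-(y * (T P P c / T P P n)) - z * (T P P d / T P P n)) y z
      (by rw [← hxyz, hQ, hR]; module)
    exact ⟨k1, k3, k4⟩
  have hcoord : ∀ w, T P P w = 0 → ∃ x y z : ℝ, w = x • Q + y • R + z • P := by
    intro w hw
    obtain ⟨x, y, s, t, rfl⟩ := hF.coords hV w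
    have hy : y + s * (T P P c / T P P n) + t * (T P P d / T P P n) = 0 := by
      apply mul_right_cancel₀ hi
      simp only [map_add, map_smul, smul_eq_mul, h0] at hw
      field_simp
      linear_combination hw
    have hy' : y = -(s * (T P P c / T P P n)) - t * (T P P d / T P P n) := by
      linear_combination hy
    exact ⟨s, t, x, by rw [hQ, hR, hy']; module⟩
  choose a b r hu using fun j k => hcoord _ (tangentVec_tangent (T := T) P (e j) (e k))
  have hsum : lineSum T e P =
      (∑ j, ∑ k, ∑ l, (a j k * b j l - a j l * b j k) ^ 6) * lineRes T P Q R := by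
    simp only [lineSum, Finset.sum_mul]
    refine Finset.sum_congr rfl fun j _ => Finset.sum_congr rfl fun k _ =>
      Finset.sum_congr rfl fun l _ => ?_
    rw [hu j k, hu j l, lineRes_subst hT h0 hgQ hgR]
  rw [hsum] at h
  rcases mul_eq_zero.1 h with hz | hz
  swap
  · exact exists_line_of_lineRes_eq_zero hT hind h0 hgQ hgR hz
  exfalso
  have h6 : ∀ x : ℝ, 0 ≤ x ^ 6 := fun x => Even.pow_nonneg (by decide) x
  have hd : ∀ k l, a i k * b i l - a i l * b i k = 0 := by
    intro k l
    have z1 := (Finset.sum_eq_zero_iff_of_nonneg (fun j _ => Finset.sum_nonneg fun k _ =>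
      Finset.sum_nonneg fun l _ => h6 _)).1 hz i (Finset.mem_univ _)
    have z2 := (Finset.sum_eq_zero_iff_of_nonneg (fun k _ =>
      Finset.sum_nonneg fun l _ => h6 _)).1 z1 k (Finset.mem_univ _)
    have z3 := (Finset.sum_eq_zero_iff_of_nonneg (fun l _ => h6 _)).1 z2 l (Finset.mem_univ _)
    exact pow_eq_zero_iff (by norm_num) |>.1 z3
  have key : ∀ w, T P P w = 0 → T P P n • w =
      (∑ k, e.repr w k * a i k) • Q + (∑ k, e.repr w k * b i k) • R +
        (∑ k, e.repr w k * r i k) • P := by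
    intro w hw
    have e1 : ∑ k, e.repr w k • tangentVec T P (e i) (e k) = T P P n • w := by
      have e2 : ∑ k, e.repr w k * T P P (e k) = 0 := by
        have e3 := congrArg (T P P) (e.sum_repr w)
        rwa [map_sum, hw, Finset.sum_congr rfl fun k _ => map_smul (T P P) _ _] at e3
      calc _ = T P P n • ∑ k, e.repr w k • e k - (∑ k, e.repr w k * T P P (e k)) • n := by
            simp only [tangentVec, hn, Finset.smul_sum, Finset.sum_smul, ← Finset.sum_sub_distrib]
            exact Finset.sum_congr rfl fun k _ => by module
        _ = _ := by rw [e2, e.sum_repr]; simp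
    rw [← e1]
    simp only [hu, Finset.sum_smul, ← Finset.sum_add_distrib]
    exact Finset.sum_congr rfl fun k _ => by module
  have kQ := key Q hgQ
  have kR := key R hgR
  obtain ⟨-, q1, -⟩ := hind (-∑ k, e.repr Q k * r i k) (T P P n - ∑ k, e.repr Q k * a i k)
    (-∑ k, e.repr Q k * b i k) (by rw [sub_smul, kQ]; module)
  obtain ⟨-, r1, r2⟩ := hind (-∑ k, e.repr R k * r i k) (-∑ k, e.repr R k * a i k)
    (T P P n - ∑ k, e.repr R k * b i k) (by rw [sub_smul _ _ R, kR]; module)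
  have ha : ∀ k, a i k = 0 := by
    intro k
    apply mul_right_cancel₀ hi
    have e1 : a i k * (∑ l, e.repr R l * b i l) - b i k * (∑ l, e.repr R l * a i l) = 0 := by
      rw [Finset.mul_sum, Finset.mul_sum, ← Finset.sum_sub_distrib]
      exact Finset.sum_eq_zero fun l _ => by linear_combination e.repr R l * hd k l
    linear_combination e1 - b i k * r1 + a i k * r2
  exact hi (by simpa [ha] using q1)

end Existence

section LinePath

theorem continuous_res23 {b0 b1 b2 c0 c1 c2 c3 : ℝ → ℝ} (h0 : Continuous b0) (h1 : Continuous b1)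
    (h2 : Continuous b2) (k0 : Continuous c0) (k1 : Continuous c1) (k2 : Continuous c2)
    (k3 : Continuous c3) :
    Continuous fun t => res23 (b0 t) (b1 t) (b2 t) (c0 t) (c1 t) (c2 t) (c3 t) := by
  unfold res23; fun_prop

variable {V : Type*} [AddCommGroup V] [Module ℝ V] {T : V →ₗ[ℝ] V →ₗ[ℝ] V →ₗ[ℝ] ℝ}

/-- A path in `V` with continuous coordinates. -/
def ContCoords (e : Module.Basis (Fin 4) ℝ V) (f : ℝ → V) : Prop :=
  ∀ i, Continuous fun t => e.repr (f t) i

theorem ContCoords.const (e : Module.Basis (Fin 4) ℝ V) (w : V) : ContCoords e fun _ => w :=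
  fun _ => continuous_const

theorem ContCoords.add {e : Module.Basis (Fin 4) ℝ V} {f g : ℝ → V} (hf : ContCoords e f)
    (hg : ContCoords e g) : ContCoords e fun t => f t + g t := fun i => by
  simp only [map_add, Finsupp.add_apply]
  exact (hf i).add (hg i)

theorem ContCoords.sub {e : Module.Basis (Fin 4) ℝ V} {f g : ℝ → V} (hf : ContCoords e f)
    (hg : ContCoords e g) : ContCoords e fun t => f t - g t := fun i => by
  simp only [map_sub, Finsupp.sub_apply]
  exact (hf i).sub (hg i)

theorem ContCoords.smul {e : Module.Basis (Fin 4) ℝ V} {f : ℝ → V} {c : ℝ → ℝ}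
    (hc : Continuous c) (hf : ContCoords e f) : ContCoords e fun t => c t • f t := fun i => by
  simp only [map_smul, Finsupp.smul_apply, smul_eq_mul]
  exact hc.mul (hf i)

theorem ContCoords.tri {e : Module.Basis (Fin 4) ℝ V} {f g h : ℝ → V} (hf : ContCoords e f)
    (hg : ContCoords e g) (hh : ContCoords e h) (T : V →ₗ[ℝ] V →ₗ[ℝ] V →ₗ[ℝ] ℝ) :
    Continuous fun t => T (f t) (g t) (h t) := by
  have : (fun t => T (f t) (g t) (h t)) = fun t => ∑ i, ∑ j, ∑ k,
      e.repr (f t) i * (e.repr (g t) j * (e.repr (h t) k * T (e i) (e j) (e k))) := by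
    funext t
    have e1 : ∀ L : V →ₗ[ℝ] ℝ, ∀ w, L w = ∑ k, e.repr w k * L (e k) := fun L w => by
      conv_lhs => rw [← e.sum_repr w]
      simp only [map_sum, map_smul, smul_eq_mul]
    have e2 : ∀ L : V →ₗ[ℝ] V →ₗ[ℝ] ℝ, ∀ x y, L x y =
        ∑ j, ∑ k, e.repr x j * (e.repr y k * L (e j) (e k)) := fun L x y => by
      rw [show L x y = L.flip y x from rfl, e1 (L.flip y) x]
      refine Finset.sum_congr rfl fun j _ => ?_
      rw [LinearMap.flip_apply, e1 (L (e j)) y, Finset.mul_sum]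
    rw [show T (f t) (g t) (h t) = ((T.flip (g t)).flip (h t)) (f t) from rfl, e1]
    refine Finset.sum_congr rfl fun i _ => ?_
    rw [LinearMap.flip_apply, LinearMap.flip_apply, e2 (T (e i)), Finset.mul_sum]
    exact Finset.sum_congr rfl fun j _ => Finset.mul_sum _ _ _
  rw [this]
  exact continuous_finsetSum _ fun i _ => continuous_finsetSum _ fun j _ =>
    continuous_finsetSum _ fun k _ =>
      (hf i).mul ((hg j).mul ((hh k).mul continuous_const))

theorem ContCoords.lineSum {e : Module.Basis (Fin 4) ℝ V} {f : ℝ → V} (hf : ContCoords e f)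
    (T : V →ₗ[ℝ] V →ₗ[ℝ] V →ₗ[ℝ] ℝ) : Continuous fun t => lineSum T e (f t) := by
  have hc := ContCoords.const e
  have ht : ∀ i j, ContCoords e fun t => tangentVec T (f t) (e i) (e j) := fun i j =>
    ((ContCoords.smul (hf.tri hf (hc _) T) (hc _))).sub (.smul (hf.tri hf (hc _) T) (hc _))
  have h1 := fun i j k => hf.tri (ht i j) (ht i k) T
  have h2 := fun i j k l m => (ht i j).tri (ht i k) (ht l m) T
  exact continuous_finsetSum _ fun i _ => continuous_finsetSum _ fun j _ =>
    continuous_finsetSum _ fun k _ => continuous_res23 (h1 i j j)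
      (continuous_const.mul (h1 i j k)) (h1 i k k) (h2 i j j i j)
      (continuous_const.mul (h2 i j j i k)) (continuous_const.mul (h2 i j k i k)) (h2 i k k i k)

theorem exists_line (hV : Module.finrank ℝ V = 4) (hT : SymTri T) (hs : SmoothTri T)
    {p x y : V} (hi : ∀ r s t : ℝ, r • p + s • x + t • y = 0 → r = 0 ∧ s = 0 ∧ t = 0)
    (h0 : T p p p = 0) (h1 : T p p x = 0) (h2 : T p p y = 0) : ∃ E, OnCubic T E := by
  have fV : FiniteDimensional ℝ V := FiniteDimensional.of_finrank_pos (by omega)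
  obtain ⟨e⟩ : Nonempty (Module.Basis (Fin 4) ℝ V) :=
    ⟨(Module.finBasisOfFinrankEq ℝ V hV)⟩
  obtain ⟨v, hv⟩ : ∃ v : ℝ → V, ∀ t, v t = Real.cos t • x + Real.sin t • y := ⟨_, fun _ => rfl⟩
  have hv0 : ∀ t, T p p (v t) = 0 := fun t => by simp [hv, h1, h2]
  have hi' : ∀ r s t : ℝ, r • v t + s • p = 0 → r = 0 ∧ s = 0 := by
    intro r s t h
    obtain ⟨k1, k2, k3⟩ := hi s (r * Real.cos t) (r * Real.sin t) (by rw [← h, hv]; module)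
    refine ⟨?_, k1⟩
    have := Real.sin_sq_add_cos_sq t
    have h5 : r * (Real.sin t ^ 2 + Real.cos t ^ 2) = 0 := by
      linear_combination Real.cos t * k2 + Real.sin t * k3
    simpa [this] using h5
  obtain ⟨P, hP⟩ : ∃ P : ℝ → V, ∀ t, P t = (3 * T p (v t) (v t)) • v t -
      T (v t) (v t) (v t) • p := ⟨_, fun _ => rfl⟩
  have hvc : ContCoords e v := by
    rw [funext hv]
    exact (ContCoords.smul Real.continuous_cos (.const _ _)).add
      (.smul Real.continuous_sin (.const _ _))
  have hPc : ContCoords e P := by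
    rw [funext hP]
    exact (ContCoords.smul (continuous_const.mul ((ContCoords.const e p).tri hvc hvc T)) hvc).sub
      (.smul (hvc.tri hvc hvc T) (.const _ _))
  have hvpi : v Real.pi = -v 0 := by simp [hv]
  have hPpi : P Real.pi = -P 0 := by
    simp only [hP, hvpi, map_neg, LinearMap.neg_apply]; module
  have hcont := hPc.lineSum T
  have hodd : lineSum T e (P Real.pi) = -lineSum T e (P 0) := by rw [hPpi, lineSum_neg]
  obtain ⟨t, ht⟩ : ∃ t, lineSum T e (P t) = 0 := by
    rcases le_total (lineSum T e (P 0)) 0 with h | h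
    · obtain ⟨v, -, hv⟩ := intermediate_value_Icc Real.pi_pos.le hcont.continuousOn
        ⟨h, by rw [hodd]; linarith⟩
      exact ⟨v, hv⟩
    · obtain ⟨v, -, hv⟩ := intermediate_value_Icc' Real.pi_pos.le hcont.continuousOn
        ⟨by rw [hodd]; linarith, h⟩
      exact ⟨v, hv⟩
  by_cases hz : P t = 0
  · obtain ⟨k1, k2⟩ := hi' (3 * T p (v t) (v t)) (-T (v t) (v t) (v t)) t
      (by rw [← hz, hP]; module)
    refine ⟨_, onCubic_span hT (a := v t) (b := p) (fun r s => hi' r s t) ?_ ?_ ?_ h0⟩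
    · linarith
    · rw [hT.right, hT.left]; linarith
    · rw [hT.left, hT.right, hv0]
  · refine exists_line_of_lineSum_eq_zero hT hs e hz ?_ ht
    have q1 := hv0 t
    rw [hP]
    simp only [map_sub, map_smul, LinearMap.sub_apply, LinearMap.smul_apply, smul_eq_mul, h0,
      hT.left (v t) p, hT.right _ (v t) p, q1]
    ring

end LinePath

section Forms

theorem cev_euler {n : ℕ} {p : MvPolynomial (Fin 3) ℝ} (hp : p.IsHomogeneous n) (z : Fin 3 → ℂ) :
    (n : ℂ) * cev p z =
      z 0 * cev (pderiv 0 p) z + z 1 * cev (pderiv 1 p) z + z 2 * cev (pderiv 2 p) z := by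
  have h := congrArg (fun p => cev p z) hp.sum_X_mul_pderiv
  simp only [cev, cmap, Fin.sum_univ_three, map_add, map_mul, map_X, eval_X,
    nsmul_eq_mul, map_natCast] at h
  exact h.symm

theorem cev_const {p : MvPolynomial (Fin 3) ℝ} (hp : p.IsHomogeneous 0) :
    ∃ c : ℝ, ∀ z, cev p z = c := by
  rw [← totalDegree_zero_iff_isHomogeneous, totalDegree_eq_zero_iff_eq_C] at hp
  exact ⟨coeff 0 p, fun z => by rw [hp]; simp [cev, cmap]⟩

theorem cev_linear {p : MvPolynomial (Fin 3) ℝ} (hp : p.IsHomogeneous 1) :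
    ∃ c0 c1 c2 : ℝ, ∀ z, cev p z = c0 * z 0 + c1 * z 1 + c2 * z 2 := by
  obtain ⟨c0, h0⟩ := cev_const (hp.pderiv (i := 0))
  obtain ⟨c1, h1⟩ := cev_const (hp.pderiv (i := 1))
  obtain ⟨c2, h2⟩ := cev_const (hp.pderiv (i := 2))
  refine ⟨c0, c1, c2, fun z => ?_⟩
  have h := cev_euler hp z
  rw [h0, h1, h2] at h
  push_cast at h
  linear_combination h

theorem cev_quadratic {p : MvPolynomial (Fin 3) ℝ} (hp : p.IsHomogeneous 2) :
    ∃ c0 c1 c2 c3 c4 c5 : ℝ, ∀ z, cev p z = c0 * z 0 ^ 2 + c1 * z 0 * z 1 + c2 * z 1 ^ 2 +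
      z 2 * (c3 * z 0 + c4 * z 1 + c5 * z 2) := by
  obtain ⟨a0, a1, a2, h0⟩ := cev_linear (hp.pderiv (i := 0))
  obtain ⟨b0, b1, b2, h1⟩ := cev_linear (hp.pderiv (i := 1))
  obtain ⟨c0, c1, c2, h2⟩ := cev_linear (hp.pderiv (i := 2))
  refine ⟨a0 / 2, (a1 + b0) / 2, b1 / 2, (a2 + c0) / 2, (b2 + c1) / 2, c2 / 2, fun z => ?_⟩
  have h := cev_euler hp z
  rw [h0, h1, h2] at h
  push_cast at h ⊢
  linear_combination h / 2

theorem cev_cubic {p : MvPolynomial (Fin 3) ℝ} (hp : p.IsHomogeneous 3) :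
    ∃ c0 c1 c2 c3 c4 c5 c6 c7 c8 c9 : ℝ, ∀ z, cev p z =
      c0 * z 0 ^ 3 + c1 * z 0 ^ 2 * z 1 + c2 * z 0 * z 1 ^ 2 + c3 * z 1 ^ 3 +
      z 2 * (c4 * z 0 ^ 2 + c5 * z 0 * z 1 + c6 * z 1 ^ 2) + z 2 ^ 2 * (c7 * z 0 + c8 * z 1) +
      c9 * z 2 ^ 3 := by
  obtain ⟨a0, a1, a2, a3, a4, a5, h0⟩ := cev_quadratic (hp.pderiv (i := 0))
  obtain ⟨b0, b1, b2, b3, b4, b5, h1⟩ := cev_quadratic (hp.pderiv (i := 1))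
  obtain ⟨c0, c1, c2, c3, c4, c5, h2⟩ := cev_quadratic (hp.pderiv (i := 2))
  refine ⟨a0 / 3, (a1 + b0) / 3, (a2 + b1) / 3, b2 / 3, (a3 + c0) / 3, (a4 + b3 + c1) / 3,
    (b4 + c2) / 3, (a5 + c3) / 3, (b5 + c4) / 3, c5 / 3, fun z => ?_⟩
  have h := cev_euler hp z
  rw [h0, h1, h2] at h
  push_cast at h ⊢
  linear_combination h / 3

/-- The ternary cubic with coefficients `c`. -/
def cub {R : Type*} [CommRing R] (c : Fin 10 → R) (s t u : R) : R :=
  c 0 * s ^ 3 + c 1 * s ^ 2 * t + c 2 * s * t ^ 2 + c 3 * t ^ 3 +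
    u * (c 4 * s ^ 2 + c 5 * s * t + c 6 * t ^ 2) + u ^ 2 * (c 7 * s + c 8 * t) + c 9 * u ^ 3

theorem cev_quartic {p : MvPolynomial (Fin 3) ℝ} (hp : p.IsHomogeneous 4) :
    ∃ (e0 e1 e2 e3 e4 : ℝ) (c : Fin 10 → ℝ), ∀ z, cev p z =
      e0 * z 0 ^ 4 + e1 * z 0 ^ 3 * z 1 + e2 * z 0 ^ 2 * z 1 ^ 2 + e3 * z 0 * z 1 ^ 3 +
      e4 * z 1 ^ 4 + z 2 * cub (fun i => (c i : ℂ)) (z 0) (z 1) (z 2) := by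
  obtain ⟨a0, a1, a2, a3, a4, a5, a6, a7, a8, a9, h0⟩ := cev_cubic (hp.pderiv (i := 0))
  obtain ⟨b0, b1, b2, b3, b4, b5, b6, b7, b8, b9, h1⟩ := cev_cubic (hp.pderiv (i := 1))
  obtain ⟨c0, c1, c2, c3, c4, c5, c6, c7, c8, c9, h2⟩ := cev_cubic (hp.pderiv (i := 2))
  refine ⟨a0 / 4, (a1 + b0) / 4, (a2 + b1) / 4, (a3 + b2) / 4, b3 / 4,
    ![(a4 + c0) / 4, (a5 + b4 + c1) / 4, (a6 + b5 + c2) / 4, (b6 + c3) / 4,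
      (a7 + c4) / 4, (a8 + b7 + c5) / 4, (b8 + c6) / 4, (a9 + c7) / 4, (b9 + c8) / 4, c9 / 4],
    fun z => ?_⟩
  have h := cev_euler hp z
  rw [h0, h1, h2] at h
  simp [cub, Matrix.cons_val]
  push_cast at h
  linear_combination h / 4

/-- The complex vector with coordinates `s, t, u` in the real vectors `b0, b1, b2`. -/
def pt (b0 b1 b2 : Fin 3 → ℝ) (s t u : ℂ) : Fin 3 → ℂ :=
  s • cvec b0 + t • cvec b1 + u • cvec b2

theorem cev_aeval (g : Fin 3 → MvPolynomial (Fin 3) ℝ) (p : MvPolynomial (Fin 3) ℝ)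
    (z : Fin 3 → ℂ) : cev (aeval g p) z = cev p fun i => cev (g i) z := by
  induction p using MvPolynomial.induction_on with
  | C a => simp [cev, cmap]
  | add p q hp hq => simp_all [cev, cmap]
  | mul_X p n hp => simp_all [cev, cmap]

theorem cev_pt {f : MvPolynomial (Fin 3) ℝ} (hf : f.IsHomogeneous 4) (b0 b1 b2 : Fin 3 → ℝ) :
    ∃ (e0 e1 e2 e3 e4 : ℝ) (c : Fin 10 → ℝ), ∀ s t u : ℂ, cev f (pt b0 b1 b2 s t u) =
      e0 * s ^ 4 + e1 * s ^ 3 * t + e2 * s ^ 2 * t ^ 2 + e3 * s * t ^ 3 +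
      e4 * t ^ 4 + u * cub (fun i => (c i : ℂ)) s t u := by
  obtain ⟨g, hg⟩ : ∃ g : Fin 3 → MvPolynomial (Fin 3) ℝ,
      ∀ i, g i = C (b0 i) * X 0 + C (b1 i) * X 1 + C (b2 i) * X 2 := ⟨_, fun _ => rfl⟩
  have hgh : ∀ i, (g i).IsHomogeneous 1 := fun i => by
    rw [hg]
    exact (((isHomogeneous_C_mul_X _ _).add (isHomogeneous_C_mul_X _ _)).add
      (isHomogeneous_C_mul_X _ _))
  obtain ⟨e0, e1, e2, e3, e4, c, h⟩ := cev_quartic (hf.aeval g hgh)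
  refine ⟨e0, e1, e2, e3, e4, c, fun s t u => ?_⟩
  have := h ![s, t, u]
  simp only [Matrix.cons_val] at this
  rw [← this, cev_aeval]
  congr 1
  ext i
  simp [cev, cmap, hg, pt, cvec, mul_comm]

theorem hasDerivAt_eval (p : MvPolynomial (Fin 3) ℂ) (z v : Fin 3 → ℂ) :
    HasDerivAt (fun t : ℂ => eval (z + t • v) p) (∑ i, v i * eval z (pderiv i p)) 0 := by
  induction p using MvPolynomial.induction_on with
  | C a => simpa using hasDerivAt_const (0 : ℂ) a
  | add p q hp hq =>
    refine (hp.add hq).congr_deriv ?_ |>.congr_of_eventuallyEq (.of_forall fun t => ?_)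
    · simp [mul_add, Finset.sum_add_distrib]
    · simp
  | mul_X p n hp =>
    have h1 : HasDerivAt (fun t : ℂ => z n + t * v n) (v n) 0 := by
      simpa using ((hasDerivAt_id (0 : ℂ)).mul_const (v n)).const_add (z n)
    refine (hp.mul h1).congr_deriv ?_ |>.congr_of_eventuallyEq (.of_forall fun t => ?_)
    · simp only [zero_smul, add_zero, zero_mul, Derivation.leibniz, smul_eq_mul, map_add, map_mul,
        eval_X, mul_add, Finset.sum_add_distrib, Finset.sum_mul, pderiv_X, Pi.single_apply]
      rw [add_comm]
      congr 1
      · rw [Finset.sum_eq_single n (fun i _ hi => by simp [hi.symm]) (by simp)]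
        simp [mul_comm]
      · exact Finset.sum_congr rfl fun i _ => by ring
    · simp

end Forms

section Lin

theorem lin_add {R : Type*} [CommSemiring R] (l z w : Fin 3 → R) :
    lin l (z + w) = lin l z + lin l w := by
  simp [lin, mul_add, Finset.sum_add_distrib]

theorem lin_smul {R : Type*} [CommSemiring R] (l z : Fin 3 → R) (c : R) :
    lin l (c • z) = c * lin l z := by
  simp [lin, Finset.mul_sum, mul_left_comm]

theorem lin_cvec (l z : Fin 3 → ℝ) : lin (cvec l) (cvec z) = (lin l z : ℝ) := by
  simp [lin, cvec]

end Lin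

section RealSquare

theorem exists_real_sqrt_form_aux {g0 g1 g2 : ℝ} {K h0 h1 h2 : ℂ} (hK : K ≠ 0) (hh : h0 ≠ 0)
    (e0 : (g0 : ℂ) = K * h0 ^ 2) (e1 : (g1 : ℂ) = 2 * K * h0 * h1)
    (e2 : (g2 : ℂ) = K * (h1 ^ 2 + 2 * h0 * h2)) :
    ∃ (σ r0 r1 r2 : ℝ) (κ : ℂ), (σ = 1 ∨ σ = -1) ∧ κ ≠ 0 ∧ (r0 : ℂ) = κ * h0 ∧ (r1 : ℂ) = κ * h1 ∧
      (r2 : ℂ) = κ * h2 ∧ σ * κ ^ 2 = K := by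
  have hg : g0 ≠ 0 := by
    rintro rfl
    exact mul_ne_zero hK (pow_ne_zero 2 hh) (by rw [← e0]; simp)
  have hgc : (g0 : ℂ) ≠ 0 := by exact_mod_cast hg
  obtain ⟨σ, hσ, hs⟩ : ∃ σ : ℝ, (σ = 1 ∨ σ = -1) ∧ 0 < σ * g0 := by
    rcases lt_or_gt_of_ne hg with h | h
    · exact ⟨-1, .inr rfl, by linarith⟩
    · exact ⟨1, .inl rfl, by linarith⟩
  have hσ2 : (σ : ℂ) ^ 2 = 1 := by rcases hσ with rfl | rfl <;> norm_num
  obtain ⟨r, hr⟩ : ∃ r, r = Real.sqrt (σ * g0) := ⟨_, rfl⟩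
  have hr2 : r ^ 2 = σ * g0 := by rw [hr, Real.sq_sqrt hs.le]
  have hr0 : r ≠ 0 := by rw [hr]; exact (Real.sqrt_pos.2 hs).ne'
  have hrc : (r : ℂ) ≠ 0 := by exact_mod_cast hr0
  have hr2c : (r : ℂ) ^ 2 = σ * g0 := by exact_mod_cast hr2
  have k1 : h1 = h0 * (g1 / (2 * g0)) := by
    field_simp
    rw [e0, e1]; ring
  have k2 : h2 = h0 * (g2 / (2 * g0) - (g1 / (2 * g0)) ^ 2 / 2) := by
    field_simp
    rw [e0, e1, e2]; ring
  refine ⟨σ, r, r * (g1 / (2 * g0)), r * (g2 / (2 * g0) - (g1 / (2 * g0)) ^ 2 / 2), r / h0, hσ,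
    div_ne_zero hrc hh, ?_, ?_, ?_, ?_⟩
  · field_simp
  · rw [k1]; push_cast; field_simp
  · rw [k2]; push_cast; field_simp
  · rw [div_pow, hr2c, e0]
    field_simp
    linear_combination hσ2

theorem exists_real_sqrt_form {g0 g1 g2 g3 g4 : ℝ} {K h0 h1 h2 : ℂ} (hK : K ≠ 0)
    (hh : ¬ (h0 = 0 ∧ h1 = 0 ∧ h2 = 0))
    (e0 : (g0 : ℂ) = K * h0 ^ 2) (e1 : (g1 : ℂ) = 2 * K * h0 * h1)
    (e2 : (g2 : ℂ) = K * (h1 ^ 2 + 2 * h0 * h2)) (e3 : (g3 : ℂ) = 2 * K * h2 * h1)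
    (e4 : (g4 : ℂ) = K * h2 ^ 2) :
    ∃ (σ r0 r1 r2 : ℝ) (κ : ℂ), (σ = 1 ∨ σ = -1) ∧ κ ≠ 0 ∧ (r0 : ℂ) = κ * h0 ∧ (r1 : ℂ) = κ * h1 ∧
      (r2 : ℂ) = κ * h2 ∧ σ * κ ^ 2 = K := by
  by_cases z0 : h0 = 0
  swap
  · exact exists_real_sqrt_form_aux hK z0 e0 e1 e2
  by_cases z2 : h2 = 0
  swap
  · obtain ⟨σ, r0, r1, r2, κ, a, b, c, d, e, g⟩ :=
      exists_real_sqrt_form_aux (h2 := h0) hK z2 e4 e3 (by rw [e2]; ring)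
    exact ⟨σ, r2, r1, r0, κ, a, b, e, d, c, g⟩
  subst z0 z2
  obtain ⟨σ, r0, r1, r2, κ, a, b, c, -, -, g⟩ :=
    exists_real_sqrt_form_aux (g0 := g2) (g1 := 0) (g2 := 0) (h0 := h1) (h1 := 0) (h2 := 0) hK
      (fun h => hh ⟨rfl, h, rfl⟩) (by rw [e2]; ring) (by simp) (by simp)
  exact ⟨σ, 0, r0, 0, κ, a, b, by simp, c, by simp, g⟩

theorem quartic_coeff_eq {g0 g1 g2 g3 g4 k0 k1 k2 k3 k4 : ℂ}
    (h : ∀ x y : ℂ, g0 * x ^ 4 + g1 * x ^ 3 * y + g2 * x ^ 2 * y ^ 2 + g3 * x * y ^ 3 + g4 * y ^ 4 =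
      k0 * x ^ 4 + k1 * x ^ 3 * y + k2 * x ^ 2 * y ^ 2 + k3 * x * y ^ 3 + k4 * y ^ 4) :
    g0 = k0 ∧ g1 = k1 ∧ g2 = k2 ∧ g3 = k3 ∧ g4 = k4 := by
  have a := h 1 0
  have b := h 0 1
  have c := h 1 1
  have d := h 1 (-1)
  have e := h 1 2
  norm_num at a b c d e
  subst a b
  have k2 : g2 = k2 := by linear_combination (c + d) / 2
  subst k2
  have k3 : g3 = k3 := by linear_combination e / 6 - c / 3
  subst k3
  exact ⟨rfl, by linear_combination c, rfl, rfl, rfl⟩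

theorem exists_proportional {A B x y : ℂ} (hxy : ¬ (x = 0 ∧ y = 0)) (hAB : ¬ (A = 0 ∧ B = 0))
    (h : x * A + y * B = 0) : ∃ k : ℂ, k ≠ 0 ∧ A = k * y ∧ B = -(k * x) := by
  by_cases hy : y = 0
  · have hx : x ≠ 0 := fun h => hxy ⟨h, hy⟩
    have hA : A = 0 := by simpa [hy, hx] using h
    refine ⟨-(B / x), ?_, by simp [hA, hy], by field_simp⟩
    exact neg_ne_zero.2 (div_ne_zero (fun h => hAB ⟨hA, h⟩) hx)
  · have hB : B = -(A / y * x) := by field_simp; linear_combination h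
    refine ⟨A / y, fun h0 => ?_, by field_simp, hB⟩
    exact hAB ⟨by simpa [hy] using h0, by rw [hB, h0]; simp⟩

end RealSquare

section Bitangent

/-- `a, b` is a real basis of the line `V(ℓ)`. -/
structure LineBasis (l a b : Fin 3 → ℝ) : Prop where
  mem : ∀ x y : ℂ, lin (cvec l) (x • cvec a + y • cvec b) = 0
  span : ∀ z, lin (cvec l) z = 0 → ∃ x y : ℂ, z = x • cvec a + y • cvec b
  indep : ∀ x y : ℂ, x • cvec a + y • cvec b = 0 → x = 0 ∧ y = 0

theorem IsBitangentAt.exists_form {f : MvPolynomial (Fin 3) ℝ} (hf : f.IsHomogeneous 4)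
    {l a b : Fin 3 → ℝ} (hl : LineBasis l a b) {z₁ z₂ : Fin 3 → ℂ}
    (h : IsBitangentAt f (cvec l) z₁ z₂) :
    ∃ (σ r0 r1 r2 : ℝ) (κ x₁ y₁ x₂ y₂ : ℂ), (σ = 1 ∨ σ = -1) ∧ κ ≠ 0 ∧
      ¬ (x₁ = 0 ∧ y₁ = 0) ∧ ¬ (x₂ = 0 ∧ y₂ = 0) ∧
      z₁ = x₁ • cvec a + y₁ • cvec b ∧ z₂ = x₂ • cvec a + y₂ • cvec b ∧
      (r0 : ℂ) = κ * (y₁ * y₂) ∧ (r1 : ℂ) = κ * (-(x₁ * y₂ + x₂ * y₁)) ∧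
      (r2 : ℂ) = κ * (x₁ * x₂) ∧
      ∀ x y : ℂ, cev f (x • cvec a + y • cvec b) =
        σ * (r0 * x ^ 2 + r1 * x * y + r2 * y ^ 2) ^ 2 := by
  obtain ⟨-, n1, n2, v1, v2, m1, m2, c, hc, w1, w2, ⟨p1, p1l, p1m⟩, ⟨p2, p2l, p2m⟩, hm⟩ := h
  have aux : ∀ z m p : Fin 3 → ℂ, z ≠ 0 → lin (cvec l) z = 0 → lin m z = 0 → lin (cvec l) p = 0 →
      lin m p ≠ 0 → ∃ x y k : ℂ, ¬ (x = 0 ∧ y = 0) ∧ z = x • cvec a + y • cvec b ∧ k ≠ 0 ∧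
        ∀ x' y' : ℂ, lin m (x' • cvec a + y' • cvec b) = k * (x' * y - y' * x) := by
    intro z m p hz hzl hzm hpl hpm
    obtain ⟨x, y, rfl⟩ := hl.span z hzl
    obtain ⟨x', y', rfl⟩ := hl.span p hpl
    simp only [lin_add, lin_smul] at hzm hpm ⊢
    have hxy : ¬ (x = 0 ∧ y = 0) := by rintro ⟨rfl, rfl⟩; simp at hz
    obtain ⟨k, hk, kA, kB⟩ := exists_proportional hxy
      (fun h => hpm (by rw [h.1, h.2]; simp)) hzm
    exact ⟨x, y, k, hxy, rfl, hk, fun x' y' => by rw [kA, kB]; ring⟩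
  obtain ⟨x1, y1, k1, hxy1, rfl, hk1, hm1⟩ := aux z₁ m1 p1 n1 v1 w1 p1l p1m
  obtain ⟨x2, y2, k2, hxy2, rfl, hk2, hm2⟩ := aux z₂ m2 p2 n2 v2 w2 p2l p2m
  obtain ⟨g0, g1, g2, g3, g4, d, hg⟩ := cev_pt hf a b 0
  have hg' : ∀ x y : ℂ, cev f (x • cvec a + y • cvec b) =
      g0 * x ^ 4 + g1 * x ^ 3 * y + g2 * x ^ 2 * y ^ 2 + g3 * x * y ^ 3 + g4 * y ^ 4 := by
    intro x y
    have := hg x y 0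
    simpa [pt] using this
  obtain ⟨K, hK⟩ : ∃ K, K = c * (k1 * k2) ^ 2 := ⟨_, rfl⟩
  have hK0 : K ≠ 0 := by rw [hK]; exact mul_ne_zero hc (pow_ne_zero 2 (mul_ne_zero hk1 hk2))
  have hmul : ∀ x y : ℂ, cev f (x • cvec a + y • cvec b) =
      K * (y1 * y2 * x ^ 2 + -(x1 * y2 + x2 * y1) * x * y + x1 * x2 * y ^ 2) ^ 2 := by
    intro x y
    rw [hm _ (hl.mem x y), hm1, hm2, hK]
    ring
  have hn : ¬ (y1 * y2 = 0 ∧ -(x1 * y2 + x2 * y1) = 0 ∧ x1 * x2 = 0) := by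
    rintro ⟨q0, q1, q2⟩
    rcases mul_eq_zero.1 q0 with q | q
    · have hx : x1 ≠ 0 := fun h => hxy1 ⟨h, q⟩
      have hx2 : x2 = 0 := by simpa [hx] using q2
      rw [q, hx2] at q1
      exact hxy2 ⟨hx2, by simpa [hx] using q1⟩
    · have hx : x2 ≠ 0 := fun h => hxy2 ⟨h, q⟩
      have hx2 : x1 = 0 := by simpa [hx] using q2
      rw [q, hx2] at q1
      exact hxy1 ⟨hx2, by simpa [hx] using q1⟩
  obtain ⟨e0, e1, e2, e3, e4⟩ := quartic_coeff_eq (g0 := g0) (g1 := g1) (g2 := g2) (g3 := g3)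
    (g4 := g4) (k0 := K * (y1 * y2) ^ 2) (k1 := 2 * K * (y1 * y2) * (-(x1 * y2 + x2 * y1)))
    (k2 := K * ((-(x1 * y2 + x2 * y1)) ^ 2 + 2 * (y1 * y2) * (x1 * x2)))
    (k3 := 2 * K * (x1 * x2) * (-(x1 * y2 + x2 * y1))) (k4 := K * (x1 * x2) ^ 2)
    (fun x y => by rw [← hg', hmul]; ring)
  obtain ⟨σ, r0, r1, r2, κ, hσ, hκ, q0, q1, q2, hs⟩ := exists_real_sqrt_form hK0 hn e0 e1 e2 e3 e4
  refine ⟨σ, r0, r1, r2, κ, x1, y1, x2, y2, hσ, hκ, hxy1, hxy2, rfl, rfl, q0, q1, q2, fun x y => ?_⟩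
  rw [hmul, q0, q1, q2, ← hs]
  ring

end Bitangent

section NormalForms

/-- The binary quadratic form with coefficients `q`. -/
def quad {R : Type*} [CommRing R] (q : Fin 3 → R) (s t : R) : R :=
  q 0 * s ^ 2 + q 1 * s * t + q 2 * t ^ 2

/-- The directional derivative of `quad q`. -/
def quadD {R : Type*} [CommRing R] (q : Fin 3 → R) (s t α β : R) : R :=
  2 * q 0 * s * α + q 1 * (s * β + t * α) + 2 * q 2 * t * β

/-- The directional derivative of `cub c`. -/
def cubD {R : Type*} [CommRing R] (c : Fin 10 → R) (s t u α β γ : R) : R :=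
  (3 * c 0 * s ^ 2 + 2 * c 1 * s * t + c 2 * t ^ 2 + u * (2 * c 4 * s + c 5 * t) +
    u ^ 2 * c 7) * α +
  (c 1 * s ^ 2 + 2 * c 2 * s * t + 3 * c 3 * t ^ 2 + u * (c 5 * s + 2 * c 6 * t) +
    u ^ 2 * c 8) * β +
  (c 4 * s ^ 2 + c 5 * s * t + c 6 * t ^ 2 + 2 * u * (c 7 * s + c 8 * t) + 3 * c 9 * u ^ 2) * γ

theorem hasDerivAt_quad (q : Fin 3 → ℂ) (s t α β : ℂ) :
    HasDerivAt (fun ε : ℂ => quad q (s + ε * α) (t + ε * β)) (quadD q s t α β) 0 := by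
  have h : ∀ a b : ℂ, HasDerivAt (fun ε : ℂ => a + ε * b) b 0 := fun a b => by
    simpa using ((hasDerivAt_id (0 : ℂ)).mul_const b).const_add a
  have k := ((((h s α).pow 2).const_mul (q 0)).add (((h s α).const_mul (q 1)).mul (h t β))).add
    (((h t β).pow 2).const_mul (q 2))
  refine k.congr_deriv ?_
  unfold quadD
  norm_num
  ring

theorem hasDerivAt_cub (c : Fin 10 → ℂ) (s t u α β γ : ℂ) :
    HasDerivAt (fun ε : ℂ => cub c (s + ε * α) (t + ε * β) (u + ε * γ)) (cubD c s t u α β γ) 0 := by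
  have h : ∀ a b : ℂ, HasDerivAt (fun ε : ℂ => a + ε * b) b 0 := fun a b => by
    simpa using ((hasDerivAt_id (0 : ℂ)).mul_const b).const_add a
  have hs := h s α
  have ht := h t β
  have hu := h u γ
  have k1 := ((((hs.pow 3).const_mul (c 0)).add (((hs.pow 2).const_mul (c 1)).mul ht)).add
    ((hs.const_mul (c 2)).mul (ht.pow 2))).add ((ht.pow 3).const_mul (c 3))
  have k2 := hu.mul ((((hs.pow 2).const_mul (c 4)).add ((hs.const_mul (c 5)).mul ht)).add
    ((ht.pow 2).const_mul (c 6)))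
  have k3 := (hu.pow 2).mul ((hs.const_mul (c 7)).add (ht.const_mul (c 8)))
  have k := ((k1.add k2).add k3).add ((hu.pow 3).const_mul (c 9))
  refine k.congr_deriv ?_
  unfold cubD
  norm_num
  ring

/-- Coordinates adapted to the line `V(ℓ)` in which the quartic is `σ (q² + ℓ C)`. -/
structure NormalForm (f : MvPolynomial (Fin 3) ℝ) (l : Fin 3 → ℝ) where
  (b0 b1 b2 d0 d1 : Fin 3 → ℝ)
  (σ : ℝ)
  (q : Fin 3 → ℝ)
  (c : Fin 10 → ℝ)
  coords : ∀ z, pt b0 b1 b2 (lin (cvec d0) z) (lin (cvec d1) z) (lin (cvec l) z) = z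
  lin0 : ∀ s t u, lin (cvec d0) (pt b0 b1 b2 s t u) = s
  lin1 : ∀ s t u, lin (cvec d1) (pt b0 b1 b2 s t u) = t
  lin2 : ∀ s t u, lin (cvec l) (pt b0 b1 b2 s t u) = u
  sign : σ = 1 ∨ σ = -1
  eq : ∀ s t u : ℂ, cev f (pt b0 b1 b2 s t u) =
    σ * (quad (fun i => (q i : ℂ)) s t ^ 2 + u * cub (fun i => (c i : ℂ)) s t u)

theorem exists_dual_basis {l : Fin 3 → ℝ} (hl : l ≠ 0) : ∃ b0 b1 b2 d0 d1 : Fin 3 → ℝ,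
    (∀ z, pt b0 b1 b2 (lin (cvec d0) z) (lin (cvec d1) z) (lin (cvec l) z) = z) ∧
    (∀ s t u, lin (cvec d0) (pt b0 b1 b2 s t u) = s) ∧
    (∀ s t u, lin (cvec d1) (pt b0 b1 b2 s t u) = t) ∧
    (∀ s t u, lin (cvec l) (pt b0 b1 b2 s t u) = u) := by
  by_cases h2 : l 2 = 0
  swap
  · have h2' : (l 2 : ℂ) ≠ 0 := by exact_mod_cast h2
    refine ⟨![1, 0, -(l 0 / l 2)], ![0, 1, -(l 1 / l 2)], ![0, 0, 1 / l 2], ![1, 0, 0], ![0, 1, 0],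
      fun z => ?_, fun s t u => ?_, fun s t u => ?_, fun s t u => ?_⟩
    · ext i
      fin_cases i
      all_goals
        simp [pt, lin, cvec, Fin.sum_univ_three, Matrix.cons_val]
        try field_simp
        try ring
    all_goals
      simp [pt, lin, cvec, Fin.sum_univ_three, Matrix.cons_val]
      try field_simp
      try ring
  by_cases h1 : l 1 = 0
  swap
  · have h1' : (l 1 : ℂ) ≠ 0 := by exact_mod_cast h1
    refine ⟨![1, -(l 0 / l 1), 0], ![0, -(l 2 / l 1), 1], ![0, 1 / l 1, 0], ![1, 0, 0], ![0, 0, 1],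
      fun z => ?_, fun s t u => ?_, fun s t u => ?_, fun s t u => ?_⟩
    · ext i
      fin_cases i
      all_goals
        simp [pt, lin, cvec, Fin.sum_univ_three, Matrix.cons_val]
        try field_simp
        try ring
    all_goals
      simp [pt, lin, cvec, Fin.sum_univ_three, Matrix.cons_val]
      try field_simp
      try ring
  have h0 : l 0 ≠ 0 := fun h0 => hl (by ext i; fin_cases i <;> simp [h0, h1, h2])
  have h0' : (l 0 : ℂ) ≠ 0 := by exact_mod_cast h0
  refine ⟨![-(l 1 / l 0), 1, 0], ![-(l 2 / l 0), 0, 1], ![1 / l 0, 0, 0], ![0, 1, 0], ![0, 0, 1],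
    fun z => ?_, fun s t u => ?_, fun s t u => ?_, fun s t u => ?_⟩
  · ext i
    fin_cases i
    all_goals
      simp [pt, lin, cvec, Fin.sum_univ_three, Matrix.cons_val]
      try field_simp
      try ring
  all_goals
    simp [pt, lin, cvec, Fin.sum_univ_three, Matrix.cons_val]
    try field_simp
    try ring

theorem exists_normalForm {f : MvPolynomial (Fin 3) ℝ} (hf : f.IsHomogeneous 4) {l : Fin 3 → ℝ}
    (hl : l ≠ 0) (h : IsBitangent f (cvec l)) : Nonempty (NormalForm f l) := by
  obtain ⟨b0, b1, b2, d0, d1, hc, h0, h1, h2⟩ := exists_dual_basis hl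
  have hpt : ∀ x y : ℂ, x • cvec b0 + y • cvec b1 = pt b0 b1 b2 x y 0 := fun x y => by simp [pt]
  have hb : LineBasis l b0 b1 := by
    refine ⟨fun x y => by rw [hpt, h2], fun z hz => ?_, fun x y hxy => ?_⟩
    · refine ⟨lin (cvec d0) z, lin (cvec d1) z, ?_⟩
      rw [hpt, ← hz, hc]
    · rw [hpt] at hxy
      have e0 := h0 x y 0
      have e1 := h1 x y 0
      rw [hxy] at e0 e1
      exact ⟨by rw [← e0]; simp [lin], by rw [← e1]; simp [lin]⟩
  obtain ⟨z₁, z₂, hz⟩ := h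
  obtain ⟨σ, r0, r1, r2, -, -, -, -, -, hσ, -, -, -, -, -, -, -, -, hq⟩ := hz.exists_form hf hb
  obtain ⟨e0, e1, e2, e3, e4, c, hg⟩ := cev_pt hf b0 b1 b2
  have hσ2 : (σ : ℂ) ^ 2 = 1 := by rcases hσ with rfl | rfl <;> norm_num
  refine ⟨⟨b0, b1, b2, d0, d1, σ, ![r0, r1, r2], fun i => σ * c i, hc, h0, h1, h2, hσ,
    fun s t u => ?_⟩⟩
  have k0 := hg s t 0
  rw [← hpt, hq] at k0
  rw [hg]
  simp only [quad, cub, Matrix.cons_val] at k0 ⊢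
  push_cast
  linear_combination (-1 : ℂ) * k0 - u * (c 0 * s ^ 3 + c 1 * s ^ 2 * t + c 2 * s * t ^ 2 +
    c 3 * t ^ 3 + u * (c 4 * s ^ 2 + c 5 * s * t + c 6 * t ^ 2) + u ^ 2 * (c 7 * s + c 8 * t) +
    c 9 * u ^ 3) * hσ2

variable {f : MvPolynomial (Fin 3) ℝ} {l : Fin 3 → ℝ} (N : NormalForm f l)

/-- The point with coordinates `s, t, u`. -/
def NormalForm.pt (s t u : ℂ) : Fin 3 → ℂ := _root_.pt N.b0 N.b1 N.b2 s t u

/-- The complexified quadratic form of a normal form. -/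
def NormalForm.cq : Fin 3 → ℂ := fun i => N.q i

/-- The complexified cubic form of a normal form. -/
def NormalForm.cc : Fin 10 → ℂ := fun i => N.c i

theorem NormalForm.cev_pt (s t u : ℂ) :
    cev f (N.pt s t u) = N.σ * (quad N.cq s t ^ 2 + u * cub N.cc s t u) := N.eq s t u

theorem NormalForm.deriv_pt (s t u α β γ : ℂ) :
    ∑ i, N.pt α β γ i * eval (N.pt s t u) (pderiv i (cmap f)) =
      N.σ * (2 * quad N.cq s t * quadD N.cq s t α β + γ * cub N.cc s t u +
        u * cubD N.cc s t u α β γ) := by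
  have h1 := hasDerivAt_eval (cmap f) (N.pt s t u) (N.pt α β γ)
  have hu : HasDerivAt (fun ε : ℂ => u + ε * γ) γ 0 := by
    simpa using ((hasDerivAt_id (0 : ℂ)).mul_const γ).const_add u
  have h2 := (((hasDerivAt_quad N.cq s t α β).pow 2).add
    (hu.mul (hasDerivAt_cub N.cc s t u α β γ))).const_mul (N.σ : ℂ)
  have h3 : (fun ε : ℂ => eval (N.pt s t u + ε • N.pt α β γ) (cmap f)) = fun ε : ℂ =>
      N.σ * (quad N.cq (s + ε * α) (t + ε * β) ^ 2 +
        (u + ε * γ) * cub N.cc (s + ε * α) (t + ε * β) (u + ε * γ)) := by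
    funext ε
    rw [← N.cev_pt]
    congr 2
    simp only [NormalForm.pt, _root_.pt]
    module
  rw [h3] at h1
  rw [h1.unique h2]
  simp [add_assoc]

theorem NormalForm.smooth (hs : SmoothQuartic f) {s t u : ℂ}
    (h0 : quad N.cq s t ^ 2 + u * cub N.cc s t u = 0)
    (h1 : ∀ α β γ : ℂ, 2 * quad N.cq s t * quadD N.cq s t α β + γ * cub N.cc s t u +
        u * cubD N.cc s t u α β γ = 0) : s = 0 ∧ t = 0 ∧ u = 0 := by
  by_cases hz : N.pt s t u = 0
  · have e0 := N.lin0 s t u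
    have e1 := N.lin1 s t u
    have e2 := N.lin2 s t u
    rw [show _root_.pt N.b0 N.b1 N.b2 s t u = 0 from hz] at e0 e1 e2
    exact ⟨by rw [← e0]; simp [lin], by rw [← e1]; simp [lin], by rw [← e2]; simp [lin]⟩
  · obtain ⟨i, hi⟩ := hs _ hz (by rw [N.cev_pt, h0, mul_zero])
    refine absurd ?_ hi
    have h2 := N.deriv_pt s t u (lin (cvec N.d0) (Pi.single i 1)) (lin (cvec N.d1) (Pi.single i 1))
      (lin (cvec l) (Pi.single i 1))
    rw [h1, mul_zero, show N.pt _ _ _ = Pi.single i 1 from N.coords _] at h2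
    simpa [Pi.single_apply] using h2

end NormalForms

section Surface

/-- The polar form of the cubic `u w² + 2 q(s,t) w - C(s,t,u)`. -/
def triVal {R : Type*} [Field R] (q : Fin 3 → R) (c : Fin 10 → R) (x y z : Fin 4 → R) : R :=
  (x 2 * y 3 * z 3 + x 3 * y 2 * z 3 + x 3 * y 3 * z 2) / 3 +
  2 / 3 * ((q 0 * x 0 * y 0 + q 1 / 2 * (x 0 * y 1 + x 1 * y 0) + q 2 * x 1 * y 1) * z 3 +
    (q 0 * x 0 * z 0 + q 1 / 2 * (x 0 * z 1 + x 1 * z 0) + q 2 * x 1 * z 1) * y 3 +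
    (q 0 * z 0 * y 0 + q 1 / 2 * (z 0 * y 1 + z 1 * y 0) + q 2 * z 1 * y 1) * x 3) -
  (c 0 * x 0 * y 0 * z 0 + c 1 / 3 * (x 0 * y 0 * z 1 + x 0 * y 1 * z 0 + x 1 * y 0 * z 0) +
    c 2 / 3 * (x 0 * y 1 * z 1 + x 1 * y 0 * z 1 + x 1 * y 1 * z 0) + c 3 * x 1 * y 1 * z 1 +
    c 4 / 3 * (x 0 * y 0 * z 2 + x 0 * y 2 * z 0 + x 2 * y 0 * z 0) +
    c 5 / 6 * (x 0 * y 1 * z 2 + x 0 * y 2 * z 1 + x 1 * y 0 * z 2 + x 1 * y 2 * z 0 +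
      x 2 * y 0 * z 1 + x 2 * y 1 * z 0) +
    c 6 / 3 * (x 1 * y 1 * z 2 + x 1 * y 2 * z 1 + x 2 * y 1 * z 1) +
    c 7 / 3 * (x 0 * y 2 * z 2 + x 2 * y 0 * z 2 + x 2 * y 2 * z 0) +
    c 8 / 3 * (x 1 * y 2 * z 2 + x 2 * y 1 * z 2 + x 2 * y 2 * z 1) + c 9 * x 2 * y 2 * z 2)

/-- The polar form as a trilinear map. -/
def triForm (q : Fin 3 → ℝ) (c : Fin 10 → ℝ) :
    (Fin 4 → ℝ) →ₗ[ℝ] (Fin 4 → ℝ) →ₗ[ℝ] (Fin 4 → ℝ) →ₗ[ℝ] ℝ :=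
  LinearMap.mk₂ ℝ
    (fun x y =>
      { toFun := fun z => triVal q c x y z
        map_add' := fun z z' => by simp only [triVal, Pi.add_apply]; ring
        map_smul' := fun r z => by
          simp only [triVal, Pi.smul_apply, smul_eq_mul, RingHom.id_apply]; ring })
    (fun x x' y => by
      apply LinearMap.ext; intro z
      change triVal q c (x + x') y z = triVal q c x y z + triVal q c x' y z
      simp only [triVal, Pi.add_apply]; ring)
    (fun r x y => by
      apply LinearMap.ext; intro z
      change triVal q c (r • x) y z = r * triVal q c x y z
      simp only [triVal, Pi.smul_apply, smul_eq_mul]; ring)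
    (fun x y y' => by
      apply LinearMap.ext; intro z
      change triVal q c x (y + y') z = triVal q c x y z + triVal q c x y' z
      simp only [triVal, Pi.add_apply]; ring)
    (fun r x y => by
      apply LinearMap.ext; intro z
      change triVal q c x (r • y) z = r * triVal q c x y z
      simp only [triVal, Pi.smul_apply, smul_eq_mul]; ring)

theorem triVal_add_smul {R : Type*} [Field R] (q : Fin 3 → R) (c : Fin 10 → R)
    (x y z : Fin 4 → R) (r : R) : triVal q c (x + r • y) (x + r • y) z =
      triVal q c x x z + 2 * r * triVal q c x y z + r ^ 2 * triVal q c y y z := by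
  simp only [triVal, Pi.add_apply, Pi.smul_apply, smul_eq_mul]
  ring

variable (q : Fin 3 → ℝ) (c : Fin 10 → ℝ)

theorem triVal_ofReal (x y z : Fin 4 → ℝ) :
    triVal (fun i => (q i : ℂ)) (fun i => (c i : ℂ)) (fun i => (x i : ℂ)) (fun i => (y i : ℂ))
      (fun i => (z i : ℂ)) = (triVal q c x y z : ℝ) := by
  simp only [triVal]
  push_cast
  rfl

theorem triForm_apply (x y z : Fin 4 → ℝ) : triForm q c x y z = triVal q c x y z := rfl

theorem triForm_symm : SymTri (triForm q c) where
  left x y z := by simp only [triForm_apply, triVal]; ring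
  right x y z := by simp only [triForm_apply, triVal]; ring

theorem triForm_diag (x : Fin 4 → ℝ) : triForm q c x x x =
    x 2 * x 3 ^ 2 + 2 * quad q (x 0) (x 1) * x 3 - cub c (x 0) (x 1) (x 2) := by
  simp only [triForm_apply, triVal, quad, cub]; ring

variable {f : MvPolynomial (Fin 3) ℝ} {l : Fin 3 → ℝ} (N : NormalForm f l)

/-- The polar form of the cubic surface attached to a normal form. -/
def NormalForm.tri : (Fin 4 → ℝ) →ₗ[ℝ] (Fin 4 → ℝ) →ₗ[ℝ] (Fin 4 → ℝ) →ₗ[ℝ] ℝ := triForm N.q N.c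

theorem NormalForm.tri_symm : SymTri N.tri := triForm_symm _ _

theorem NormalForm.tri_smooth (hs : SmoothQuartic f) : SmoothTri N.tri := by
  intro x y h
  obtain ⟨z, hz⟩ : ∃ z : Fin 4 → ℂ, ∀ i, z i = x i + y i * Complex.I := ⟨_, fun _ => rfl⟩
  have key : ∀ w : Fin 4 → ℝ, triVal N.cq N.cc z z (fun i => (w i : ℂ)) = 0 := by
    intro w
    have h1 := (h w).1
    have h2 := (h w).2
    rw [NormalForm.tri, triForm_apply, triForm_apply] at h1
    rw [NormalForm.tri, triForm_apply] at h2
    have hz' : z = (fun i => (x i : ℂ)) + Complex.I • (fun i => (y i : ℂ)) := by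
      ext i
      simp [hz, mul_comm]
    have hc : ∀ x y : Fin 4 → ℝ, triVal N.cq N.cc (fun i => (x i : ℂ)) (fun i => (y i : ℂ))
        (fun i => (w i : ℂ)) = (triVal N.q N.c x y w : ℝ) := fun x y => triVal_ofReal _ _ x y w
    rw [hz', triVal_add_smul, hc, hc, hc, h1, h2, Complex.I_sq]
    simp
  have k0 := key (Pi.single 0 1)
  have k1 := key (Pi.single 1 1)
  have k2 := key (Pi.single 2 1)
  have k3 := key (Pi.single 3 1)
  simp [triVal] at k0 k1 k2 k3
  obtain ⟨s, hs0⟩ : ∃ s, s = z 0 := ⟨_, rfl⟩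
  obtain ⟨t, ht0⟩ : ∃ s, s = z 1 := ⟨_, rfl⟩
  obtain ⟨u, hu0⟩ : ∃ s, s = z 2 := ⟨_, rfl⟩
  obtain ⟨w, hw0⟩ : ∃ s, s = z 3 := ⟨_, rfl⟩
  rw [← hs0, ← ht0, ← hu0, ← hw0] at k0 k1 k2 k3
  have hq : quad N.cq s t = -(u * w) := by
    unfold quad; linear_combination (3 / 2) * k3
  have hd : ∀ α β γ : ℂ, cubD N.cc s t u α β γ = 2 * w * quadD N.cq s t α β + γ * w ^ 2 := by
    intro α β γ
    unfold cubD quadD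
    linear_combination -3 * α * k0 - 3 * β * k1 - 3 * γ * k2
  have hc : cub N.cc s t u = -(u * w ^ 2) := by
    have e1 : 3 * cub N.cc s t u = cubD N.cc s t u s t u := by unfold cub cubD; ring
    have e2 : quadD N.cq s t s t = 2 * quad N.cq s t := by unfold quad quadD; ring
    rw [hd, e2, hq] at e1
    linear_combination e1 / 3
  obtain ⟨s0, t0, u0⟩ := N.smooth hs (s := s) (t := t) (u := u) (by rw [hq, hc]; ring)
    (fun α β γ => by rw [hq, hc, hd]; ring)
  have w0 : w = 0 := by
    rw [s0, t0, u0] at k2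
    simpa using k2
  have hzz : ∀ i, z i = 0 := by
    intro i
    fin_cases i
    · exact hs0 ▸ s0
    · exact ht0 ▸ t0
    · exact hu0 ▸ u0
    · exact hw0 ▸ w0
  constructor
  · ext i
    have := congrArg Complex.re (hzz i)
    simpa [hz] using this
  · ext i
    have := congrArg Complex.im (hzz i)
    simpa [hz] using this

theorem NormalForm.exists_sum_segre (hs : SmoothQuartic f) :
    ∃ S : Finset (Submodule ℝ (Fin 4 → ℝ)), (∀ M, M ∈ S ↔ OnCubic N.tri M) ∧
      ∑ M ∈ S, segre N.tri M = 3 := by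
  have hV : Module.finrank ℝ (Fin 4 → ℝ) = 4 := by simp
  refine sum_segre hV N.tri_symm (N.tri_smooth hs) (exists_line hV N.tri_symm (N.tri_smooth hs)
    (p := Pi.single 3 1) (x := Pi.single 0 1) (y := Pi.single 1 1) ?_ ?_ ?_ ?_)
  · intro r s t h
    have h0 := congrFun h 0
    have h1 := congrFun h 1
    have h3 := congrFun h 3
    simp at h0 h1 h3
    exact ⟨h3, h0, h1⟩
  all_goals simp [NormalForm.tri, triForm_apply, triVal]

end Surface

section Charts

variable {f : MvPolynomial (Fin 3) ℝ} {l : Fin 3 → ℝ} (N : NormalForm f l)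

/-- The real point with coordinates `s, t, u`. -/
def NormalForm.rpt (s t u : ℝ) : Fin 3 → ℝ := s • N.b0 + t • N.b1 + u • N.b2

theorem NormalForm.cvec_rpt (s t u : ℝ) : cvec (N.rpt s t u) = N.pt s t u := by
  ext i
  simp [NormalForm.rpt, NormalForm.pt, _root_.pt, cvec]

theorem NormalForm.smul_pt_add (x y s t u s' t' u' : ℂ) : x • N.pt s t u + y • N.pt s' t' u' =
    N.pt (x * s + y * s') (x * t + y * t') (x * u + y * u') := by
  simp only [NormalForm.pt, _root_.pt]
  module

theorem NormalForm.pt_eq_zero {s t u : ℂ} (h : N.pt s t u = 0) : s = 0 ∧ t = 0 ∧ u = 0 := by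
  have e0 := N.lin0 s t u
  have e1 := N.lin1 s t u
  have e2 := N.lin2 s t u
  rw [show _root_.pt N.b0 N.b1 N.b2 s t u = 0 from h] at e0 e1 e2
  exact ⟨by rw [← e0]; simp [lin], by rw [← e1]; simp [lin], by rw [← e2]; simp [lin]⟩

/-- The line `V(l')` passes through the points with coordinates `(α 0, α 1, 1)` and
`(β 0, β 1, 0)`. -/
structure NormalForm.Chart (l' : Fin 3 → ℝ) (α β : Fin 2 → ℝ) : Prop where
  ne : ¬ (β 0 = 0 ∧ β 1 = 0)
  eq : ∃ k : ℝ, k ≠ 0 ∧ ∀ s t u : ℂ,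
    lin (cvec l') (N.pt s t u) = k * (β 1 * (s - u * α 0) - β 0 * (t - u * α 1))

variable {N} {l' : Fin 3 → ℝ} {α β : Fin 2 → ℝ}

theorem NormalForm.Chart.pt_eq (x y : ℂ) :
    x • cvec (N.rpt (α 0) (α 1) 1) + y • cvec (N.rpt (β 0) (β 1) 0) =
      N.pt (x * α 0 + y * β 0) (x * α 1 + y * β 1) x := by
  simp only [N.cvec_rpt, N.smul_pt_add]
  simp

theorem NormalForm.Chart.lin_eq_zero (H : N.Chart l' α β) {s t u : ℂ}
    (h : lin (cvec l') (N.pt s t u) = 0) :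
    ∃ y : ℂ, s = u * α 0 + y * β 0 ∧ t = u * α 1 + y * β 1 := by
  obtain ⟨k, hk, hl⟩ := H.eq
  have hk' : (k : ℂ) ≠ 0 := by exact_mod_cast hk
  rw [hl] at h
  have h := (mul_eq_zero.1 h).resolve_left hk'
  by_cases h0 : β 0 = 0
  · have h1 : (β 1 : ℂ) ≠ 0 := by exact_mod_cast fun h1 => H.ne ⟨h0, h1⟩
    refine ⟨(t - u * α 1) / β 1, ?_, by field_simp; ring⟩
    simp only [h0, Complex.ofReal_zero, zero_mul, sub_zero, mul_zero, add_zero] at h ⊢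
    linear_combination (mul_eq_zero.1 h).resolve_left h1
  · have h1 : (β 0 : ℂ) ≠ 0 := by exact_mod_cast h0
    refine ⟨(s - u * α 0) / β 0, by field_simp; ring, ?_⟩
    field_simp
    linear_combination -h

theorem NormalForm.Chart.lineBasis (H : N.Chart l' α β) :
    LineBasis l' (N.rpt (α 0) (α 1) 1) (N.rpt (β 0) (β 1) 0) where
  mem x y := by
    obtain ⟨k, hk, hl⟩ := H.eq
    rw [NormalForm.Chart.pt_eq, hl]
    ring
  span z hz := by
    have hz' : N.pt (lin (cvec N.d0) z) (lin (cvec N.d1) z) (lin (cvec l) z) = z := N.coords z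
    rw [← hz'] at hz
    obtain ⟨y, h0, h1⟩ := H.lin_eq_zero hz
    refine ⟨lin (cvec l) z, y, ?_⟩
    rw [NormalForm.Chart.pt_eq, ← h0, ← h1, hz']
  indep x y h := by
    rw [NormalForm.Chart.pt_eq] at h
    obtain ⟨h0, h1, rfl⟩ := N.pt_eq_zero h
    refine ⟨rfl, ?_⟩
    by_contra hy
    exact H.ne ⟨by simpa [hy] using h0, by simpa [hy] using h1⟩

theorem NormalForm.exists_chart (N : NormalForm f l) {l' : Fin 3 → ℝ}
    (h : ∀ k : ℝ, l' ≠ k • l) : ∃ α β, N.Chart l' α β := by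
  obtain ⟨m0, hm0⟩ : ∃ m, m = lin l' N.b0 := ⟨_, rfl⟩
  obtain ⟨m1, hm1⟩ : ∃ m, m = lin l' N.b1 := ⟨_, rfl⟩
  obtain ⟨m2, hm2⟩ : ∃ m, m = lin l' N.b2 := ⟨_, rfl⟩
  have hl : ∀ s t u : ℂ, lin (cvec l') (N.pt s t u) = s * m0 + t * m1 + u * m2 := by
    intro s t u
    simp only [NormalForm.pt, _root_.pt, lin_add, lin_smul, lin_cvec, hm0, hm1, hm2]
  have hne : ¬ (m0 = 0 ∧ m1 = 0) := by
    rintro ⟨h0, h1⟩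
    refine h m2 (funext fun i => ?_)
    have h3 : N.pt _ _ _ = Pi.single i 1 := N.coords (Pi.single i 1)
    have h2 := hl (lin (cvec N.d0) (Pi.single i 1)) (lin (cvec N.d1) (Pi.single i 1))
      (lin (cvec l) (Pi.single i 1))
    rw [h3, h0, h1] at h2
    simp [lin, cvec, Pi.single_apply] at h2
    rw [Pi.smul_apply, smul_eq_mul, mul_comm]
    exact_mod_cast h2
  have hn : m0 ^ 2 + m1 ^ 2 ≠ 0 := by
    intro h0
    exact hne ⟨by nlinarith [sq_nonneg m0, sq_nonneg m1], by nlinarith [sq_nonneg m0, sq_nonneg m1]⟩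
  have hn' : (m0 : ℂ) ^ 2 + (m1 : ℂ) ^ 2 ≠ 0 := by exact_mod_cast hn
  refine ⟨![-(m2 * m0) / (m0 ^ 2 + m1 ^ 2), -(m2 * m1) / (m0 ^ 2 + m1 ^ 2)], ![-m1, m0],
    fun h0 => hne ⟨by simpa using h0.2, by simpa using h0.1⟩, 1, one_ne_zero, fun s t u => ?_⟩
  rw [hl]
  simp
  field_simp
  ring

/-- The point `(α 0, α 1, 1, r)`. -/
def liftA (α : Fin 2 → ℝ) (r : ℝ) : Fin 4 → ℝ := ![α 0, α 1, 1, r]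

/-- The point `(β 0, β 1, 0, r)`. -/
def liftB (β : Fin 2 → ℝ) (r : ℝ) : Fin 4 → ℝ := ![β 0, β 1, 0, r]

/-- The line through `(α 0, α 1, 1, ρ 0)` and `(β 0, β 1, 0, ρ 1)`. -/
def liftLine (α β ρ : Fin 2 → ℝ) : Submodule ℝ (Fin 4 → ℝ) :=
  Submodule.span ℝ {liftA α (ρ 0), liftB β (ρ 1)}

theorem indep2_lift (h : ¬ (β 0 = 0 ∧ β 1 = 0)) (r s : ℝ) : Indep2 ℝ (liftA α r) (liftB β s) := by
  intro x y hxy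
  have h0 := congrFun hxy 0
  have h1 := congrFun hxy 1
  have h2 := congrFun hxy 2
  simp [liftA, liftB, Matrix.cons_val] at h0 h1 h2
  subst h2
  refine ⟨rfl, ?_⟩
  by_contra hy
  exact h ⟨by simpa [hy] using h0, by simpa [hy] using h1⟩

theorem NormalForm.no_common_zero (hs : SmoothQuartic f) (h : ¬ (β 0 = 0 ∧ β 1 = 0))
    (h0 : quad N.q (β 0) (β 1) = 0) (h1 : cub N.c (β 0) (β 1) 0 = 0) : False := by
  have h0' : quad N.cq (β 0) (β 1) = 0 := by
    have : ((quad N.q (β 0) (β 1) : ℝ) : ℂ) = 0 := by rw [h0]; simp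
    simpa [quad, NormalForm.cq] using this
  have h1' : cub N.cc (β 0) (β 1) 0 = 0 := by
    have : ((cub N.c (β 0) (β 1) 0 : ℝ) : ℂ) = 0 := by rw [h1]; simp
    simpa [cub, NormalForm.cc] using this
  obtain ⟨k0, k1, -⟩ := N.smooth hs (s := β 0) (t := β 1) (u := 0) (by rw [h0', h1']; ring)
    (fun a b c => by rw [h0', h1']; ring)
  exact h ⟨by exact_mod_cast k0, by exact_mod_cast k1⟩

theorem NormalForm.tri_lift (N : NormalForm f l) (α β ρ : Fin 2 → ℝ) :
    N.tri (liftA α (ρ 0)) (liftA α (ρ 0)) (liftA α (ρ 0)) =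
      ρ 0 ^ 2 + 2 * quad N.q (α 0) (α 1) * ρ 0 - cub N.c (α 0) (α 1) 1 ∧
    3 * N.tri (liftA α (ρ 0)) (liftA α (ρ 0)) (liftB β (ρ 1)) =
      2 * ρ 0 * ρ 1 + 2 * quad N.q (α 0) (α 1) * ρ 1 + 2 * quadD N.q (α 0) (α 1) (β 0) (β 1) * ρ 0
        - cubD N.c (α 0) (α 1) 1 (β 0) (β 1) 0 ∧
    3 * N.tri (liftA α (ρ 0)) (liftB β (ρ 1)) (liftB β (ρ 1)) =
      ρ 1 ^ 2 + 2 * quadD N.q (α 0) (α 1) (β 0) (β 1) * ρ 1 + 2 * quad N.q (β 0) (β 1) * ρ 0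
        - cubD N.c (β 0) (β 1) 0 (α 0) (α 1) 1 ∧
    N.tri (liftB β (ρ 1)) (liftB β (ρ 1)) (liftB β (ρ 1)) =
      2 * quad N.q (β 0) (β 1) * ρ 1 - cub N.c (β 0) (β 1) 0 := by
  simp only [NormalForm.tri, triForm_apply, triVal, liftA, liftB, Matrix.cons_val, quad, quadD, cub,
    cubD]
  refine ⟨by ring, by ring, by ring, by ring⟩

theorem NormalForm.onCubic_liftLine (h : ¬ (β 0 = 0 ∧ β 1 = 0)) (ρ : Fin 2 → ℝ) :
    OnCubic N.tri (liftLine α β ρ) ↔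
      ρ 0 ^ 2 + 2 * quad N.q (α 0) (α 1) * ρ 0 - cub N.c (α 0) (α 1) 1 = 0 ∧
      2 * ρ 0 * ρ 1 + 2 * quad N.q (α 0) (α 1) * ρ 1 + 2 * quadD N.q (α 0) (α 1) (β 0) (β 1) * ρ 0
        - cubD N.c (α 0) (α 1) 1 (β 0) (β 1) 0 = 0 ∧
      ρ 1 ^ 2 + 2 * quadD N.q (α 0) (α 1) (β 0) (β 1) * ρ 1 + 2 * quad N.q (β 0) (β 1) * ρ 0
        - cubD N.c (β 0) (β 1) 0 (α 0) (α 1) 1 = 0 ∧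
      2 * quad N.q (β 0) (β 1) * ρ 1 - cub N.c (β 0) (β 1) 0 = 0 := by
  obtain ⟨e0, e1, e2, e3⟩ := N.tri_lift α β ρ
  rw [← e0, ← e1, ← e2, ← e3]
  constructor
  · rintro ⟨-, hE⟩
    have hA : liftA α (ρ 0) ∈ liftLine α β ρ := Submodule.subset_span (by simp)
    have hB : liftB β (ρ 1) ∈ liftLine α β ρ := Submodule.subset_span (by simp)
    refine ⟨hE _ hA, ?_, ?_, hE _ hB⟩
    · rw [N.tri_symm.polar hE hA hA hB, mul_zero]
    · rw [N.tri_symm.polar hE hA hB hB, mul_zero]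
  · rintro ⟨h0, h1, h2, h3⟩
    exact onCubic_span N.tri_symm (indep2_lift h _ _) h0 (by linarith) (by linarith) h3

theorem NormalForm.quad_ne_zero (hs : SmoothQuartic f) (h : ¬ (β 0 = 0 ∧ β 1 = 0))
    {ρ : Fin 2 → ℝ} (hE : OnCubic N.tri (liftLine α β ρ)) : quad N.q (β 0) (β 1) ≠ 0 := by
  intro h0
  obtain ⟨-, -, -, h3⟩ := (NormalForm.onCubic_liftLine h ρ).1 hE
  exact NormalForm.no_common_zero hs h h0 (by linear_combination 2 * ρ 1 * h0 - h3)

theorem NormalForm.liftLine_unique (hs : SmoothQuartic f) (h : ¬ (β 0 = 0 ∧ β 1 = 0))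
    {ρ ρ' : Fin 2 → ℝ} (hE : OnCubic N.tri (liftLine α β ρ))
    (hE' : OnCubic N.tri (liftLine α β ρ')) : ρ = ρ' := by
  have hq := NormalForm.quad_ne_zero hs h hE
  obtain ⟨-, -, h2, h3⟩ := (NormalForm.onCubic_liftLine h ρ).1 hE
  obtain ⟨-, -, h2', h3'⟩ := (NormalForm.onCubic_liftLine h ρ').1 hE'
  have e1 : ρ 1 = ρ' 1 := mul_left_cancel₀ hq (by linear_combination (h3 - h3') / 2)
  have e0 : ρ 0 = ρ' 0 := by
    rw [e1] at h2
    exact mul_left_cancel₀ hq (by linear_combination (h2 - h2') / 2)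
  ext i
  fin_cases i
  · exact e0
  · exact e1

end Charts

section TangencyLifts

variable {f : MvPolynomial (Fin 3) ℝ} {l : Fin 3 → ℝ} {N : NormalForm f l} {l' : Fin 3 → ℝ}
  {α β : Fin 2 → ℝ}

theorem NormalForm.Chart.cev_eq (N : NormalForm f l) (α β : Fin 2 → ℝ) (x y : ℂ) :
    cev f (x • cvec (N.rpt (α 0) (α 1) 1) + y • cvec (N.rpt (β 0) (β 1) 0)) =
      N.σ * (((quad N.q (α 0) (α 1) : ℝ) * x ^ 2 + (quadD N.q (α 0) (α 1) (β 0) (β 1) : ℝ) * x * y +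
        (quad N.q (β 0) (β 1) : ℝ) * y ^ 2) ^ 2 +
        x * ((cub N.c (α 0) (α 1) 1 : ℝ) * x ^ 3 +
          (cubD N.c (α 0) (α 1) 1 (β 0) (β 1) 0 : ℝ) * x ^ 2 * y +
          (cubD N.c (β 0) (β 1) 0 (α 0) (α 1) 1 : ℝ) * x * y ^ 2 +
          (cub N.c (β 0) (β 1) 0 : ℝ) * y ^ 3)) := by
  rw [NormalForm.Chart.pt_eq, N.cev_pt]
  simp only [quad, quadD, cub, cubD, NormalForm.cq, NormalForm.cc]
  push_cast
  ring

theorem NormalForm.Chart.exists_liftLine (H : N.Chart l' α β) (hf : f.IsHomogeneous 4)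
    (hs : SmoothQuartic f) {z₁ z₂ : Fin 3 → ℂ} (h : IsBitangentAt f (cvec l') z₁ z₂) :
    ∃ (ρ : Fin 2 → ℝ) (κ x₁ y₁ x₂ y₂ : ℂ), OnCubic N.tri (liftLine α β ρ) ∧
      z₁ = N.pt (x₁ * α 0 + y₁ * β 0) (x₁ * α 1 + y₁ * β 1) x₁ ∧
      z₂ = N.pt (x₂ * α 0 + y₂ * β 0) (x₂ * α 1 + y₂ * β 1) x₂ ∧
      ((quad N.q (α 0) (α 1) + ρ 0 : ℝ) : ℂ) = κ * (y₁ * y₂) ∧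
      ((quadD N.q (α 0) (α 1) (β 0) (β 1) + ρ 1 : ℝ) : ℂ) = κ * (-(x₁ * y₂ + x₂ * y₁)) ∧
      ((quad N.q (β 0) (β 1) : ℝ) : ℂ) = κ * (x₁ * x₂) := by
  obtain ⟨σ, r0, r1, r2, κ, x₁, y₁, x₂, y₂, hσ, hκ, -, -, hz1, hz2, e0, e1, e2, he⟩ :=
    h.exists_form hf H.lineBasis
  rw [NormalForm.Chart.pt_eq] at hz1 hz2
  simp only [NormalForm.Chart.cev_eq] at he
  obtain ⟨Q0, hQ0⟩ : ∃ Q, Q = quad N.q (α 0) (α 1) := ⟨_, rfl⟩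
  obtain ⟨Q1, hQ1⟩ : ∃ Q, Q = quadD N.q (α 0) (α 1) (β 0) (β 1) := ⟨_, rfl⟩
  obtain ⟨Q2, hQ2⟩ : ∃ Q, Q = quad N.q (β 0) (β 1) := ⟨_, rfl⟩
  obtain ⟨D0, hD0⟩ : ∃ Q, Q = cub N.c (α 0) (α 1) 1 := ⟨_, rfl⟩
  obtain ⟨D1, hD1⟩ : ∃ Q, Q = cubD N.c (α 0) (α 1) 1 (β 0) (β 1) 0 := ⟨_, rfl⟩
  obtain ⟨D2, hD2⟩ : ∃ Q, Q = cubD N.c (β 0) (β 1) 0 (α 0) (α 1) 1 := ⟨_, rfl⟩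
  obtain ⟨D3, hD3⟩ : ∃ Q, Q = cub N.c (β 0) (β 1) 0 := ⟨_, rfl⟩
  simp only [NormalForm.onCubic_liftLine H.ne]
  have hsing := NormalForm.no_common_zero (N := N) hs H.ne
  rw [← hQ2, ← hD3] at hsing
  simp only [← hQ0, ← hQ1, ← hQ2, ← hD0, ← hD1, ← hD2, ← hD3] at he ⊢
  obtain ⟨k0, k1, k2, k3, k4⟩ := quartic_coeff_eq (g0 := N.σ * (Q0 ^ 2 + D0))
    (g1 := N.σ * (2 * Q0 * Q1 + D1)) (g2 := N.σ * (Q1 ^ 2 + 2 * Q0 * Q2 + D2))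
    (g3 := N.σ * (2 * Q1 * Q2 + D3)) (g4 := N.σ * Q2 ^ 2) (k0 := σ * r0 ^ 2)
    (k1 := σ * (2 * r0 * r1)) (k2 := σ * (r1 ^ 2 + 2 * r0 * r2))
    (k3 := σ * (2 * r1 * r2)) (k4 := σ * r2 ^ 2)
    (fun x y => by linear_combination he x y)
  have k0 : N.σ * (Q0 ^ 2 + D0) = σ * r0 ^ 2 := by exact_mod_cast k0
  have k1 : N.σ * (2 * Q0 * Q1 + D1) = σ * (2 * r0 * r1) := by exact_mod_cast k1
  have k2 : N.σ * (Q1 ^ 2 + 2 * Q0 * Q2 + D2) = σ * (r1 ^ 2 + 2 * r0 * r2) := by exact_mod_cast k2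
  have k3 : N.σ * (2 * Q1 * Q2 + D3) = σ * (2 * r1 * r2) := by exact_mod_cast k3
  have k4 : N.σ * Q2 ^ 2 = σ * r2 ^ 2 := by exact_mod_cast k4
  have hN0 : N.σ ≠ 0 := by rcases N.sign with h | h <;> rw [h] <;> norm_num
  have hσ0 : σ ≠ 0 := by rcases hσ with h | h <;> rw [h] <;> norm_num
  have hQ : Q2 ≠ 0 := by
    intro h0
    rw [h0] at k4 k3
    have hr : r2 = 0 := by simpa [hσ0] using k4.symm
    rw [hr] at k3
    exact hsing h0 (by simpa [hN0] using k3)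
  have hσN : N.σ = σ := by
    have hQp : 0 < Q2 ^ 2 := by positivity
    rcases N.sign with h | h <;> rcases hσ with h' | h' <;> rw [h, h'] at k4 ⊢ <;>
      nlinarith [sq_nonneg r2]
  rw [hσN] at k0 k1 k2 k3 k4
  replace k0 := mul_left_cancel₀ hσ0 k0
  replace k1 := mul_left_cancel₀ hσ0 k1
  replace k2 := mul_left_cancel₀ hσ0 k2
  replace k3 := mul_left_cancel₀ hσ0 k3
  replace k4 := mul_left_cancel₀ hσ0 k4
  obtain ⟨e, he, hr⟩ : ∃ e : ℝ, e ^ 2 = 1 ∧ Q2 = e * r2 := by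
    rcases sq_eq_sq_iff_eq_or_eq_neg.1 k4 with h | h
    · exact ⟨1, by norm_num, by rw [h]; ring⟩
    · exact ⟨-1, by norm_num, by rw [h]; ring⟩
  refine ⟨![e * r0 - Q0, e * r1 - Q1], e * κ, x₁, y₁, x₂, y₂, ⟨?_, ?_, ?_, ?_⟩, hz1, hz2,
    ?_, ?_, ?_⟩
  · simp only [Matrix.cons_val]
    linear_combination r0 ^ 2 * he - k0
  · simp only [Matrix.cons_val]
    linear_combination 2 * r0 * r1 * he - k1
  · simp only [Matrix.cons_val]
    linear_combination r1 ^ 2 * he - k2 + 2 * e * r0 * hr + 2 * r0 * r2 * he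
  · simp only [Matrix.cons_val]
    linear_combination 2 * e * r1 * hr + 2 * r1 * r2 * he - k3
  · simp only [Matrix.cons_val]
    push_cast
    linear_combination (e : ℂ) * e0
  · simp only [Matrix.cons_val]
    push_cast
    linear_combination (e : ℂ) * e1
  · rw [hr]
    push_cast
    linear_combination (e : ℂ) * e2

theorem exists_complex_factor {a b c : ℂ} (hc : c ≠ 0) :
    ∃ y₁ y₂ : ℂ, a = c * (y₁ * y₂) ∧ b = c * (-(y₂ + y₁)) := by
  obtain ⟨x, y, hxy, h⟩ := exists_complex_quadratic_zero a (b / 2) c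
  have hx : x ≠ 0 := by
    rintro rfl
    exact hxy ⟨rfl, by simpa [hc] using h⟩
  refine ⟨y / x, -b / c - y / x, ?_, by field_simp; ring⟩
  field_simp
  linear_combination h

theorem NormalForm.Chart.isBitangent (H : N.Chart l' α β) (hs : SmoothQuartic f) {ρ : Fin 2 → ℝ}
    (hE : OnCubic N.tri (liftLine α β ρ)) : ∃ z₁ z₂, IsBitangentAt f (cvec l') z₁ z₂ ∧
      lin (cvec l) z₁ = 1 ∧ lin (cvec l) z₂ = 1 := by
  have hQ := NormalForm.quad_ne_zero hs H.ne hE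
  obtain ⟨k0, k1, k2, k3⟩ := (NormalForm.onCubic_liftLine H.ne ρ).1 hE
  have hB := H.lineBasis
  have hcev := NormalForm.Chart.cev_eq N α β
  obtain ⟨Q0, hQ0⟩ : ∃ Q, Q = quad N.q (α 0) (α 1) := ⟨_, rfl⟩
  obtain ⟨Q1, hQ1⟩ : ∃ Q, Q = quadD N.q (α 0) (α 1) (β 0) (β 1) := ⟨_, rfl⟩
  obtain ⟨Q2, hQ2⟩ : ∃ Q, Q = quad N.q (β 0) (β 1) := ⟨_, rfl⟩
  obtain ⟨D0, hD0⟩ : ∃ Q, Q = cub N.c (α 0) (α 1) 1 := ⟨_, rfl⟩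
  obtain ⟨D1, hD1⟩ : ∃ Q, Q = cubD N.c (α 0) (α 1) 1 (β 0) (β 1) 0 := ⟨_, rfl⟩
  obtain ⟨D2, hD2⟩ : ∃ Q, Q = cubD N.c (β 0) (β 1) 0 (α 0) (α 1) 1 := ⟨_, rfl⟩
  obtain ⟨D3, hD3⟩ : ∃ Q, Q = cub N.c (β 0) (β 1) 0 := ⟨_, rfl⟩
  simp only [← hQ0, ← hQ1, ← hQ2, ← hD0, ← hD1, ← hD2, ← hD3] at k0 k1 k2 k3 hQ hcev
  have hQc : (Q2 : ℂ) ≠ 0 := by exact_mod_cast hQ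
  have k0 : (ρ 0 : ℂ) ^ 2 + 2 * Q0 * ρ 0 - D0 = 0 := by exact_mod_cast k0
  have k1 : (2 : ℂ) * ρ 0 * ρ 1 + 2 * Q0 * ρ 1 + 2 * Q1 * ρ 0 - D1 = 0 := by exact_mod_cast k1
  have k2 : (ρ 1 : ℂ) ^ 2 + 2 * Q1 * ρ 1 + 2 * Q2 * ρ 0 - D2 = 0 := by exact_mod_cast k2
  have k3 : (2 : ℂ) * Q2 * ρ 1 - D3 = 0 := by exact_mod_cast k3
  obtain ⟨y₁, y₂, h0, h1⟩ := exists_complex_factor (a := Q0 + ρ 0) (b := Q1 + ρ 1) hQc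
  have hN0 : (N.σ : ℂ) ≠ 0 := by rcases N.sign with h | h <;> rw [h] <;> norm_num
  have hval : ∀ x y : ℂ,
      cev f (x • cvec (N.rpt (α 0) (α 1) 1) + y • cvec (N.rpt (β 0) (β 1) 0)) =
        N.σ * Q2 ^ 2 * ((y₁ * x - y) * (y₂ * x - y)) ^ 2 := by
    intro x y
    have hr : (Q2 : ℂ) * ((y₁ * x - y) * (y₂ * x - y)) =
        (Q0 + ρ 0) * x ^ 2 + (Q1 + ρ 1) * x * y + Q2 * y ^ 2 := by rw [h0, h1]; ring
    rw [mul_assoc, ← mul_pow, hr, hcev]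
    linear_combination (-(N.σ : ℂ)) *
      (x ^ 4 * k0 + x ^ 3 * y * k1 + x ^ 2 * y ^ 2 * k2 + x * y ^ 3 * k3)
  have hn : β 0 ^ 2 + β 1 ^ 2 ≠ 0 := by
    intro h0
    exact H.ne ⟨by nlinarith [sq_nonneg (β 0), sq_nonneg (β 1)],
      by nlinarith [sq_nonneg (β 0), sq_nonneg (β 1)]⟩
  have hn' : (β 0 : ℂ) ^ 2 + (β 1 : ℂ) ^ 2 ≠ 0 := by exact_mod_cast hn
  obtain ⟨Y, hY⟩ : ∃ Y : Fin 3 → ℂ, Y =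
    (β 0 / (β 0 ^ 2 + β 1 ^ 2) : ℂ) • (cvec N.d0 - (α 0 : ℂ) • cvec l) +
    (β 1 / (β 0 ^ 2 + β 1 ^ 2) : ℂ) • (cvec N.d1 - (α 1 : ℂ) • cvec l) := ⟨_, rfl⟩
  have hlin : ∀ (a b z : Fin 3 → ℂ) (c : ℂ), lin (c • a + b) z = c * lin a z + lin b z := by
    intro a b z c
    simp only [lin, Fin.sum_univ_three, Pi.add_apply, Pi.smul_apply, smul_eq_mul]
    ring
  have hm : ∀ w x y : ℂ, lin (w • cvec l + -Y)
      (x • cvec (N.rpt (α 0) (α 1) 1) + y • cvec (N.rpt (β 0) (β 1) 0)) = w * x - y := by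
    intro w x y
    have g0 : lin (cvec N.d0) (N.pt (x * α 0 + y * β 0) (x * α 1 + y * β 1) x) = _ := N.lin0 _ _ _
    have g1 : lin (cvec N.d1) (N.pt (x * α 0 + y * β 0) (x * α 1 + y * β 1) x) = _ := N.lin1 _ _ _
    have g2 : lin (cvec l) (N.pt (x * α 0 + y * β 0) (x * α 1 + y * β 1) x) = _ := N.lin2 _ _ _
    have hY' : w • cvec l + -Y = (-(β 0 / (β 0 ^ 2 + β 1 ^ 2)) : ℂ) • cvec N.d0 +
        ((-(β 1 / (β 0 ^ 2 + β 1 ^ 2)) : ℂ) • cvec N.d1 +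
        ((w + β 0 / (β 0 ^ 2 + β 1 ^ 2) * α 0 +
          β 1 / (β 0 ^ 2 + β 1 ^ 2) * α 1 : ℂ) • cvec l + 0)) := by
      rw [hY]
      module
    rw [hY', NormalForm.Chart.pt_eq, hlin, hlin, hlin, g0, g1, g2]
    simp only [lin, Pi.zero_apply, zero_mul, Finset.sum_const_zero]
    field_simp
    ring
  have hz : ∀ y : ℂ, (1 : ℂ) • cvec (N.rpt (α 0) (α 1) 1) + y • cvec (N.rpt (β 0) (β 1) 0) ≠ 0 :=
    fun y h => one_ne_zero (hB.indep 1 y h).1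
  have hone : ∀ y : ℂ, lin (cvec l)
      ((1 : ℂ) • cvec (N.rpt (α 0) (α 1) 1) + y • cvec (N.rpt (β 0) (β 1) 0)) = 1 := by
    intro y
    rw [NormalForm.Chart.pt_eq]
    exact N.lin2 _ _ _
  have hp : ∀ w : ℂ, ∃ p, lin (cvec l') p = 0 ∧ lin (w • cvec l + -Y) p ≠ 0 := fun w =>
    ⟨_, hB.mem 0 1, by rw [hm]; simp⟩
  refine ⟨_, _, ⟨fun h => ?_, hz y₁, hz y₂, hB.mem _ _, hB.mem _ _, y₁ • cvec l + -Y,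
    y₂ • cvec l + -Y, N.σ * Q2 ^ 2, mul_ne_zero hN0 (pow_ne_zero 2 hQc), by rw [hm]; ring,
    by rw [hm]; ring, hp _, hp _, fun p hpl => ?_⟩, hone y₁, hone y₂⟩
  · obtain ⟨k, hk, hl⟩ := H.eq
    rw [h] at hl
    have g1 := hl (β 1) (-β 0) 0
    simp only [lin, Pi.zero_apply, zero_mul, Finset.sum_const_zero] at g1
    have g2 : (k : ℂ) * ((β 0 : ℂ) ^ 2 + (β 1 : ℂ) ^ 2) = 0 := by linear_combination -g1
    exact mul_ne_zero (by exact_mod_cast hk) hn' g2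
  · obtain ⟨x, y, rfl⟩ := hB.span p hpl
    rw [hval, hm, hm]

end TangencyLifts

section TangencyDirections

theorem triVal_direction {R : Type*} [Field R] [CharZero R] (q : Fin 3 → R) (c : Fin 10 → R)
    (z v : Fin 4 → R) (hv : v 3 = 0) : 3 * triVal q c z z v = v 2 * z 3 ^ 2 +
      2 * z 3 * quadD q (z 0) (z 1) (v 0) (v 1) - cubD c (z 0) (z 1) (z 2) (v 0) (v 1) (v 2) := by
  simp only [triVal, quadD, cubD, hv]
  ring

theorem resultant_eq {a0 a1 a2 n0 n1 n2 : ℝ} {y₁ y₂ : ℂ} (h0 : (a0 : ℂ) = a2 * (y₁ * y₂))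
    (h1 : (a1 : ℂ) = a2 * (-(y₂ + y₁) / 2)) :
    (((a0 * n2 + a2 * n0 - 2 * a1 * n1) ^ 2 -
        4 * (a0 * a2 - a1 ^ 2) * (n0 * n2 - n1 ^ 2) : ℝ) : ℂ) =
      a2 ^ 2 * ((n0 + 2 * y₁ * n1 + y₁ ^ 2 * n2) * (n0 + 2 * y₂ * n1 + y₂ ^ 2 * n2)) := by
  push_cast
  rw [h0, h1]
  ring

variable {f : MvPolynomial (Fin 3) ℝ} {l : Fin 3 → ℝ} {N : NormalForm f l} {l' : Fin 3 → ℝ}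
  {α β : Fin 2 → ℝ}

theorem NormalForm.dv_eq (N : NormalForm f l) (h : ¬ (β 0 = 0 ∧ β 1 = 0))
    {ρ : Fin 2 → ℝ} (hE : OnCubic N.tri (liftLine α β ρ)) {y : ℂ}
    (hy : quad N.cq (α 0 + y * β 0) (α 1 + y * β 1) = -(ρ 0 + y * ρ 1)) (v : Fin 4 → ℝ)
    (hv : v 3 = 0) : Dv f (N.rpt (v 0) (v 1) (v 2)) (N.pt (α 0 + y * β 0) (α 1 + y * β 1) 1) =
      -(3 * N.σ) * ((N.tri (liftA α (ρ 0)) (liftA α (ρ 0)) v : ℝ) +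
        2 * y * (N.tri (liftA α (ρ 0)) (liftB β (ρ 1)) v : ℝ) +
        y ^ 2 * (N.tri (liftB β (ρ 1)) (liftB β (ρ 1)) v : ℝ)) := by
  obtain ⟨k0, k1, k2, k3⟩ := (NormalForm.onCubic_liftLine h ρ).1 hE
  have hD : Dv f (N.rpt (v 0) (v 1) (v 2)) (N.pt (α 0 + y * β 0) (α 1 + y * β 1) 1) =
      ∑ i, N.pt (v 0) (v 1) (v 2) i *
        eval (N.pt (α 0 + y * β 0) (α 1 + y * β 1) 1) (pderiv i (cmap f)) := by
    rw [← N.cvec_rpt]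
    rfl
  rw [hD, N.deriv_pt]
  have hT : ∀ a b : Fin 4 → ℝ, ((N.tri a b v : ℝ) : ℂ) = triVal N.cq N.cc (fun i => (a i : ℂ))
      (fun i => (b i : ℂ)) (fun i => (v i : ℂ)) := fun a b => (triVal_ofReal _ _ a b v).symm
  rw [hT, hT, hT, ← triVal_add_smul]
  have hd := triVal_direction N.cq N.cc ((fun i => (liftA α (ρ 0) i : ℂ)) +
    y • (fun i => (liftB β (ρ 1) i : ℂ))) (fun i => (v i : ℂ)) (by simp [hv])
  have hC : cub N.cc (α 0 + y * β 0) (α 1 + y * β 1) 1 =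
      (cub N.c (α 0) (α 1) 1 : ℝ) + (cubD N.c (α 0) (α 1) 1 (β 0) (β 1) 0 : ℝ) * y +
        (cubD N.c (β 0) (β 1) 0 (α 0) (α 1) 1 : ℝ) * y ^ 2 +
        (cub N.c (β 0) (β 1) 0 : ℝ) * y ^ 3 := by
    simp only [cub, cubD, NormalForm.cc]
    push_cast
    ring
  have hq : quad N.cq (α 0 + y * β 0) (α 1 + y * β 1) =
      (quad N.q (α 0) (α 1) : ℝ) + (quadD N.q (α 0) (α 1) (β 0) (β 1) : ℝ) * y +
        (quad N.q (β 0) (β 1) : ℝ) * y ^ 2 := by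
    simp only [quad, quadD, NormalForm.cq]
    push_cast
    ring
  have k0 := congrArg (Complex.ofReal) k0
  have k1 := congrArg (Complex.ofReal) k1
  have k2 := congrArg (Complex.ofReal) k2
  have k3 := congrArg (Complex.ofReal) k3
  push_cast at k0 k1 k2 k3
  have hC' : cub N.cc (α 0 + y * β 0) (α 1 + y * β 1) 1 = -(ρ 0 + y * ρ 1) ^ 2 := by
    have e : cub N.cc (α 0 + y * β 0) (α 1 + y * β 1) 1 = (ρ 0 + y * ρ 1) ^ 2 +
        2 * quad N.cq (α 0 + y * β 0) (α 1 + y * β 1) * (ρ 0 + y * ρ 1) := by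
      rw [hC, hq]
      linear_combination -k0 - y * k1 - y ^ 2 * k2 - y ^ 3 * k3
    rw [e, hy]
    ring
  rw [hC', hy]
  simp only [Pi.add_apply, Pi.smul_apply, smul_eq_mul, liftA, liftB, Matrix.cons_val,
    Complex.ofReal_one, Complex.ofReal_zero, mul_zero, add_zero] at hd ⊢
  linear_combination N.σ * hd

theorem NormalForm.Chart.dv_mul (H : N.Chart l' α β) (hf : f.IsHomogeneous 4)
    (hs : SmoothQuartic f) {ρ : Fin 2 → ℝ} (hE : OnCubic N.tri (liftLine α β ρ)) {z₁ z₂ : Fin 3 → ℂ}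
    (h : IsBitangentAt f (cvec l') z₁ z₂) (h₁ : lin (cvec l) z₁ = 1) (h₂ : lin (cvec l) z₂ = 1)
    (v : Fin 4 → ℝ) (hv : v 3 = 0) : ∃ k : ℝ, 0 < k ∧
      Dv f (N.rpt (v 0) (v 1) (v 2)) z₁ * Dv f (N.rpt (v 0) (v 1) (v 2)) z₂ =
      ((k * resTri N.tri (liftA α (ρ 0)) (liftB β (ρ 1)) (Pi.single 3 1) v : ℝ) : ℂ) := by
  obtain ⟨ρ', κ, x₁, y₁, x₂, y₂, hE', rfl, rfl, e0, e1, e2⟩ := H.exists_liftLine hf hs h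
  obtain rfl := NormalForm.liftLine_unique hs H.ne hE hE'
  obtain rfl : x₁ = 1 := by rw [← h₁]; exact (N.lin2 _ _ _).symm
  obtain rfl : x₂ = 1 := by rw [← h₂]; exact (N.lin2 _ _ _).symm
  have hQ := NormalForm.quad_ne_zero hs H.ne hE
  simp only [one_mul] at *
  have hy : ∀ y : ℂ, (y - y₁) * (y - y₂) = 0 →
      quad N.cq (α 0 + y * β 0) (α 1 + y * β 1) = -(ρ 0 + y * ρ 1) := by
    intro y hy
    have hq : quad N.cq (α 0 + y * β 0) (α 1 + y * β 1) =
        (quad N.q (α 0) (α 1) : ℝ) + (quadD N.q (α 0) (α 1) (β 0) (β 1) : ℝ) * y +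
          (quad N.q (β 0) (β 1) : ℝ) * y ^ 2 := by
      simp only [quad, quadD, NormalForm.cq]
      push_cast
      ring
    push_cast at e0 e1
    rw [hq]
    linear_combination e0 + y * e1 + y ^ 2 * e2 + κ * hy
  rw [N.dv_eq H.ne hE (hy y₁ (by ring)) v hv, N.dv_eq H.ne hE (hy y₂ (by ring)) v hv]
  obtain ⟨Q, hQd⟩ : ∃ Q, Q = quad N.q (β 0) (β 1) := ⟨_, rfl⟩
  have m0 : N.tri (liftA α (ρ 0)) (liftA α (ρ 0)) (Pi.single 3 1) =
      2 / 3 * (quad N.q (α 0) (α 1) + ρ 0) := by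
    simp [NormalForm.tri, triForm_apply, triVal, liftA, quad]
    ring
  have m1 : N.tri (liftA α (ρ 0)) (liftB β (ρ 1)) (Pi.single 3 1) =
      1 / 3 * (quadD N.q (α 0) (α 1) (β 0) (β 1) + ρ 1) := by
    simp [NormalForm.tri, triForm_apply, triVal, liftA, liftB, quadD]
    ring
  have m2 : N.tri (liftB β (ρ 1)) (liftB β (ρ 1)) (Pi.single 3 1) = 2 / 3 * Q := by
    simp [NormalForm.tri, triForm_apply, triVal, liftB, quad, hQd]
    ring
  rw [← hQd] at hQ e2
  refine ⟨81 / 4 / Q ^ 2, by positivity, ?_⟩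
  have hres := resultant_eq (n0 := N.tri (liftA α (ρ 0)) (liftA α (ρ 0)) v)
    (n1 := N.tri (liftA α (ρ 0)) (liftB β (ρ 1)) v) (n2 := N.tri (liftB β (ρ 1)) (liftB β (ρ 1)) v)
    (y₁ := y₁) (y₂ := y₂) (a0 := N.tri (liftA α (ρ 0)) (liftA α (ρ 0)) (Pi.single 3 1))
    (a1 := N.tri (liftA α (ρ 0)) (liftB β (ρ 1)) (Pi.single 3 1))
    (a2 := N.tri (liftB β (ρ 1)) (liftB β (ρ 1)) (Pi.single 3 1))
    (by
      rw [m0, m2]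
      push_cast at e0 e2 ⊢
      rw [e0, e2]
      ring)
    (by
      rw [m1, m2]
      push_cast at e1 e2 ⊢
      rw [e1, e2]
      ring)
  rw [Complex.ofReal_mul, resTri, hres, m2]
  have hQc : (Q : ℂ) ≠ 0 := by exact_mod_cast hQ
  have hσ2 : (N.σ : ℂ) ^ 2 = 1 := by rcases N.sign with h | h <;> rw [h] <;> norm_num
  have aux : ∀ X Y : ℂ, -(3 * N.σ) * X * (-(3 * N.σ) * Y) =
      81 / 4 / (Q : ℂ) ^ 2 * ((2 / 3 * Q) ^ 2 * (X * Y)) := by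
    intro X Y
    field_simp
    linear_combination 324 * X * Y * hσ2
  push_cast
  exact aux _ _

end TangencyDirections

section Qtype

variable {f : MvPolynomial (Fin 3) ℝ} {l : Fin 3 → ℝ} {N : NormalForm f l} {l' : Fin 3 → ℝ}
  {α β : Fin 2 → ℝ}

theorem NormalForm.rpt_coords (N : NormalForm f l) (v : Fin 3 → ℝ) :
    N.rpt (lin N.d0 v) (lin N.d1 v) (lin l v) = v := by
  have h : cvec (N.rpt (lin N.d0 v) (lin N.d1 v) (lin l v)) = cvec v := by
    rw [N.cvec_rpt, ← lin_cvec, ← lin_cvec, ← lin_cvec]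
    exact N.coords _
  ext i
  have := congrFun h i
  simpa [cvec] using this

theorem NormalForm.Chart.frame (H : N.Chart l' α β) (r s : ℝ) {v : Fin 4 → ℝ}
    (hl : lin (cvec l') (cvec (N.rpt (v 0) (v 1) (v 2))) ≠ 0) :
    Frame ℝ (liftA α r) (liftB β s) (Pi.single 3 1) v := by
  intro x y a t h
  have h0 := congrFun h 0
  have h1 := congrFun h 1
  have h2 := congrFun h 2
  have h3 := congrFun h 3
  simp only [Pi.add_apply, Pi.smul_apply, smul_eq_mul, Pi.zero_apply] at h0 h1 h2 h3
  simp [liftA, liftB] at h0 h1 h2 h3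
  have ht : t = 0 := by
    by_contra ht
    apply hl
    obtain ⟨k, -, hk⟩ := H.eq
    rw [N.cvec_rpt, hk]
    have : β 1 * (v 0 - v 2 * α 0) - β 0 * (v 1 - v 2 * α 1) = 0 := by
      refine mul_left_cancel₀ ht ?_
      linear_combination β 1 * h0 - β 0 * h1 + (β 0 * α 1 - β 1 * α 0) * h2
    rw [show (β 1 : ℂ) * (v 0 - v 2 * α 0) - β 0 * (v 1 - v 2 * α 1) = 0 by exact_mod_cast this,
      mul_zero]
  subst ht
  obtain rfl : x = 0 := by simpa using h2
  have hy : y = 0 := by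
    by_contra hy
    exact H.ne ⟨by simpa [hy] using h0, by simpa [hy] using h1⟩
  subst hy
  exact ⟨rfl, rfl, by simpa using h3, rfl⟩

theorem NormalForm.Chart.dv_sign (H : N.Chart l' α β) (hf : f.IsHomogeneous 4)
    (hs : SmoothQuartic f) {ρ : Fin 2 → ℝ} (hE : OnCubic N.tri (liftLine α β ρ)) {z₁ z₂ : Fin 3 → ℂ}
    (h : IsBitangentAt f (cvec l') z₁ z₂) (h₁ : lin (cvec l) z₁ = 1) (h₂ : lin (cvec l) z₂ = 1)
    {v : Fin 3 → ℝ} (hv : lin (cvec l') (cvec v) ≠ 0) : ∃ r : ℝ, Dv f v z₁ * Dv f v z₂ = r ∧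
      ((0 < r ∧ segre N.tri (liftLine α β ρ) = 1) ∨
        (r < 0 ∧ segre N.tri (liftLine α β ρ) = -1)) := by
  obtain ⟨w, hw⟩ : ∃ w : Fin 4 → ℝ, w = ![lin N.d0 v, lin N.d1 v, lin l v, 0] := ⟨_, rfl⟩
  have hw' : N.rpt (w 0) (w 1) (w 2) = v := by
    rw [hw]
    exact N.rpt_coords v
  have hF := H.frame (ρ 0) (ρ 1) (v := w) (by rwa [hw'])
  obtain ⟨k, hk, he⟩ := H.dv_mul hf hs hE h h₁ h₂ w (by simp [hw])
  rw [hw'] at he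
  have hV : Module.finrank ℝ (Fin 4 → ℝ) = 4 := by simp
  have hne := resTri_ne_zero hV N.tri_symm (N.tri_smooth hs) hE.2 hF
  have hsg := segre_eq_sign hV N.tri_symm (N.tri_smooth hs) hE.2 hF
  refine ⟨_, he, ?_⟩
  rw [show segre N.tri (liftLine α β ρ) = _ from hsg]
  rcases lt_or_gt_of_ne hne with h | h
  · exact .inr ⟨mul_neg_of_pos_of_neg hk h, by rw [sign_neg h]; rfl⟩
  · exact .inl ⟨mul_pos hk h, by rw [sign_pos h]; rfl⟩

theorem NormalForm.Chart.hasQtype_iff (H : N.Chart l' α β) (hf : f.IsHomogeneous 4)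
    (hs : SmoothQuartic f) {ρ : Fin 2 → ℝ} (hE : OnCubic N.tri (liftLine α β ρ)) (ε : ℤ) :
    HasQtype f l (cvec l') ε ↔ ε = segre N.tri (liftLine α β ρ) := by
  constructor
  · rintro ⟨z₁, z₂, v, r, h, h₁, h₂, hv, hr, hε⟩
    obtain ⟨r', hr', hε'⟩ := H.dv_sign hf hs hE h h₁ h₂ hv
    obtain rfl : r = r' := by
      rw [hr] at hr'
      exact_mod_cast hr'
    rcases hε with ⟨a, rfl⟩ | ⟨a, rfl⟩ <;> rcases hε' with ⟨b, hb⟩ | ⟨b, hb⟩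
    · exact hb.symm
    · linarith
    · linarith
    · exact hb.symm
  · rintro rfl
    obtain ⟨z₁, z₂, h, h₁, h₂⟩ := H.isBitangent hs hE
    obtain ⟨i, hi⟩ : ∃ i, cvec l' i ≠ 0 := Function.ne_iff.1 h.1
    have hv : lin (cvec l') (cvec (Pi.single i 1)) ≠ 0 := by
      rw [lin_cvec]
      simpa [lin, Pi.single_apply, cvec] using hi
    obtain ⟨r, hr, hε⟩ := H.dv_sign hf hs hE h h₁ h₂ hv
    exact ⟨z₁, z₂, _, r, h, h₁, h₂, hv, hr, hε⟩

theorem NormalForm.Chart.tangency_off (H : N.Chart l' α β) (hf : f.IsHomogeneous 4)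
    (hs : SmoothQuartic f) {z₁ z₂ : Fin 3 → ℂ} (h : IsBitangentAt f (cvec l') z₁ z₂) :
    lin (cvec l) z₁ ≠ 0 ∧ lin (cvec l) z₂ ≠ 0 := by
  obtain ⟨ρ, κ, x₁, y₁, x₂, y₂, hE, rfl, rfl, -, -, e2⟩ := H.exists_liftLine hf hs h
  have hQ : ((quad N.q (β 0) (β 1) : ℝ) : ℂ) ≠ 0 := by
    exact_mod_cast NormalForm.quad_ne_zero hs H.ne hE
  have h1 : ∀ s t u, lin (cvec l) (N.pt s t u) = u := N.lin2
  rw [h1, h1]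
  constructor <;> rintro rfl <;> exact hQ (by rw [e2]; ring)

end Qtype

section Lines

variable {f : MvPolynomial (Fin 3) ℝ} {l : Fin 3 → ℝ} {N : NormalForm f l} {l' : Fin 3 → ℝ}
  {α β : Fin 2 → ℝ}

theorem NormalForm.eq_zero_of_mem {E : Submodule ℝ (Fin 4 → ℝ)} (hs : SmoothQuartic f)
    (hE : OnCubic N.tri E) {x : Fin 4 → ℝ} (hx : x ∈ E) (h0 : x 0 = 0) (h1 : x 1 = 0)
    (h2 : x 2 = 0) : x = 0 := by
  by_contra hx0
  obtain ⟨b, hb, hi, rfl⟩ := exists_pair_of_finrank_two hE.1 hx hx0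
  have h3 : x 3 ≠ 0 := by
    intro h3
    refine hx0 (funext fun i => ?_)
    fin_cases i <;> assumption
  have e1 := N.tri_symm.polar hE.2 hx hx hb
  have e2 := N.tri_symm.polar hE.2 hx hb hb
  have e3 := hE.2 _ hb
  simp only [NormalForm.tri, triForm_apply] at e1 e2
  rw [NormalForm.tri, triForm_diag] at e3
  simp only [triVal, h0, h1, h2, zero_mul, mul_zero, add_zero, zero_add, sub_zero] at e1 e2
  have b2 : b 2 = 0 := by
    refine mul_left_cancel₀ (pow_ne_zero 2 h3) ?_
    linear_combination 3 * e1
  have hq : quad N.q (b 0) (b 1) = 0 := by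
    refine mul_left_cancel₀ h3 ?_
    unfold quad
    linear_combination 3 / 2 * e2 - x 3 * b 3 * b2
  rw [b2, hq] at e3
  refine NormalForm.no_common_zero (N := N) (β := ![b 0, b 1]) hs ?_ hq (by simpa using e3)
  rintro ⟨b0, b1⟩
  simp at b0 b1
  have := hi (b 3) (-x 3) (by
    ext i
    fin_cases i
    · simp [h0, b0]
    · simp [h1, b1]
    · simp [h2, b2]
    · simp; ring)
  exact h3 (by simpa using this.2)

theorem NormalForm.exists_mem_ne {E : Submodule ℝ (Fin 4 → ℝ)} (hs : SmoothQuartic f)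
    (hE : OnCubic N.tri E) : ∃ x ∈ E, x 2 ≠ 0 := by
  by_contra! hu
  obtain ⟨a, ha, ha0⟩ : ∃ a ∈ E, a ≠ 0 := by
    refine E.exists_mem_ne_zero_of_ne_bot ?_
    rintro rfl
    have := hE.1
    simp at this
  obtain ⟨b, hb, hi, rfl⟩ := exists_pair_of_finrank_two hE.1 ha ha0
  obtain ⟨x, y, hxy, h⟩ := exists_complex_quadratic_zero (quad N.cq (a 0) (a 1))
    (quadD N.cq (a 0) (a 1) (b 0) (b 1) / 2) (quad N.cq (b 0) (b 1))
  have hq : quad N.cq (x * a 0 + y * b 0) (x * a 1 + y * b 1) = 0 := by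
    rw [← h]
    unfold quad quadD
    ring
  have e0 := congrArg (Complex.ofReal) (hE.2 _ ha)
  have e1 := congrArg (Complex.ofReal) (N.tri_symm.polar hE.2 ha ha hb)
  have e2 := congrArg (Complex.ofReal) (N.tri_symm.polar hE.2 ha hb hb)
  have e3 := congrArg (Complex.ofReal) (hE.2 _ hb)
  have a2 := hu _ ha
  have b2 := hu _ hb
  have hc : cub N.cc (x * a 0 + y * b 0) (x * a 1 + y * b 1) 0 =
      2 * quad N.cq (x * a 0 + y * b 0) (x * a 1 + y * b 1) * (x * a 3 + y * b 3) := by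
    simp only [NormalForm.tri, triForm_apply, triVal, a2, b2] at e0 e1 e2 e3
    push_cast at e0 e1 e2 e3
    simp only [cub, quad, NormalForm.cc, NormalForm.cq]
    linear_combination -x ^ 3 * e0 - 3 * x ^ 2 * y * e1 - 3 * x * y ^ 2 * e2 - y ^ 3 * e3
  rw [hq] at hc
  obtain ⟨s0, t0, -⟩ := N.smooth hs (s := x * a 0 + y * b 0) (t := x * a 1 + y * b 1) (u := 0)
    (by rw [hq, hc]; ring) (fun _ _ _ => by rw [hq, hc]; ring)
  have hdet : a 0 * b 1 - a 1 * b 0 = 0 := by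
    have : (a 0 : ℂ) * b 1 - a 1 * b 0 = 0 := by
      by_cases hx : x = 0
      · have hy : y ≠ 0 := fun hy => hxy ⟨hx, hy⟩
        refine mul_left_cancel₀ hy ?_
        linear_combination (a 0 : ℂ) * t0 - a 1 * s0
      · refine mul_left_cancel₀ hx ?_
        linear_combination (b 1 : ℂ) * s0 - b 0 * t0
    exact_mod_cast this
  have hz : ∀ r s : ℝ, r * a 0 + s * b 0 = 0 → r * a 1 + s * b 1 = 0 → r = 0 ∧ s = 0 := by
    intro r s h0 h1
    refine hi r s (NormalForm.eq_zero_of_mem hs hE (add_mem (Submodule.smul_mem _ _ ha)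
      (Submodule.smul_mem _ _ hb)) ?_ ?_ ?_)
    · simpa using h0
    · simpa using h1
    · simp [a2, b2]
  obtain ⟨b1, a1⟩ := hz (b 1) (-a 1) (by linear_combination hdet) (by ring)
  obtain ⟨b0, a0⟩ := hz (b 0) (-a 0) (by ring) (by linear_combination -hdet)
  exact one_ne_zero (hz 1 0 (by simpa using a0) (by simpa using a1)).1

theorem NormalForm.exists_liftLine {E : Submodule ℝ (Fin 4 → ℝ)} (hs : SmoothQuartic f)
    (hE : OnCubic N.tri E) : ∃ α β ρ : Fin 2 → ℝ, ¬ (β 0 = 0 ∧ β 1 = 0) ∧ E = liftLine α β ρ := by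
  obtain ⟨x, hx, hx2⟩ := NormalForm.exists_mem_ne hs hE
  obtain ⟨y, hy, hi, hxy⟩ := exists_pair_of_finrank_two hE.1 hx (fun h => hx2 (by rw [h]; rfl))
  obtain ⟨A, hA⟩ : ∃ A, A = (x 2)⁻¹ • x := ⟨_, rfl⟩
  obtain ⟨B, hB⟩ : ∃ B, B = y - y 2 • A := ⟨_, rfl⟩
  have hAE : A ∈ E := hA ▸ E.smul_mem _ hx
  have hBE : B ∈ E := hB ▸ E.sub_mem hy (E.smul_mem _ hAE)
  have hA2 : A 2 = 1 := by simp [hA, hx2]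
  have hB2 : B 2 = 0 := by simp [hB, hA2]
  have hB0 : B ≠ 0 := by
    intro h0
    have := hi (-(y 2 * (x 2)⁻¹)) 1 (by
      rw [hB, hA, smul_smul] at h0
      rw [← h0]
      module)
    exact one_ne_zero this.2
  have hne : ¬ (B 0 = 0 ∧ B 1 = 0) := fun h =>
    hB0 (NormalForm.eq_zero_of_mem hs hE hBE h.1 h.2 hB2)
  refine ⟨![A 0, A 1], ![B 0, B 1], ![A 3, B 3], hne, ?_⟩
  have h1 : liftA ![A 0, A 1] (A 3) = A := by
    ext i
    fin_cases i <;> simp [liftA, hA2]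
  have h2 : liftB ![B 0, B 1] (B 3) = B := by
    ext i
    fin_cases i <;> simp [liftB, hB2]
  have hi' : Indep2 ℝ (liftA ![A 0, A 1] (A 3)) (liftB ![B 0, B 1] (B 3)) := indep2_lift hne _ _
  rw [h1, h2] at hi'
  change E = Submodule.span ℝ {liftA ![A 0, A 1] (A 3), liftB ![B 0, B 1] (B 3)}
  rw [h1, h2]
  exact span_pair_eq_of_mem hE.1 hAE hBE hi'

end Lines

section Correspondence

variable {f : MvPolynomial (Fin 3) ℝ} {l : Fin 3 → ℝ} (N : NormalForm f l) {l' l'' : Fin 3 → ℝ}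

/-- The line `E` of the cubic surface lies over the line `V(l')`. -/
def NormalForm.Over (E : Submodule ℝ (Fin 4 → ℝ)) (l' : Fin 3 → ℝ) : Prop :=
  ∃ α β ρ : Fin 2 → ℝ, N.Chart l' α β ∧ E = liftLine α β ρ

variable {N} {E E' : Submodule ℝ (Fin 4 → ℝ)}

theorem NormalForm.lin_ext {m m' : Fin 3 → ℂ}
    (N : NormalForm f l) (h : ∀ s t u, lin m (N.pt s t u) = lin m' (N.pt s t u)) : m = m' := by
  ext i
  have h1 := h (lin (cvec N.d0) (Pi.single i 1)) (lin (cvec N.d1) (Pi.single i 1))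
      (lin (cvec l) (Pi.single i 1))
  rw [show N.pt _ _ _ = Pi.single i 1 from N.coords _] at h1
  simpa [lin, Pi.single_apply] using h1

theorem lin_smul_left (k : ℝ) (m : Fin 3 → ℝ) (z : Fin 3 → ℂ) :
    lin (cvec (k • m)) z = k * lin (cvec m) z := by
  simp [lin, cvec, Finset.mul_sum, mul_assoc]

theorem NormalForm.Chart.ne_smul {α β : Fin 2 → ℝ} (H : N.Chart l' α β) (k : ℝ) : l' ≠ k • l := by
  rintro rfl
  obtain ⟨c, hc, hl⟩ := H.eq
  have h : ∀ s t : ℂ, (c : ℂ) * (β 1 * s - β 0 * t) = 0 := by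
    intro s t
    have h1 := hl s t 0
    rw [lin_smul_left, show lin (cvec l) (N.pt s t 0) = 0 from N.lin2 s t 0] at h1
    linear_combination -h1
  have h1 := h 1 0
  have h2 := h 0 1
  simp [hc] at h1 h2
  exact H.ne ⟨h2, h1⟩

theorem NormalForm.exists_over (hs : SmoothQuartic f) (hE : OnCubic N.tri E) :
    ∃ L : Projectivization ℝ (Fin 3 → ℝ), N.Over E L.rep := by
  obtain ⟨α, β, ρ, hne, rfl⟩ := NormalForm.exists_liftLine hs hE
  obtain ⟨m, hm⟩ : ∃ m : Fin 3 → ℝ, m = β 1 • N.d0 + (-β 0) • N.d1 +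
    (β 0 * α 1 - β 1 * α 0) • l := ⟨_, rfl⟩
  have hl : ∀ s t u : ℂ,
      lin (cvec m) (N.pt s t u) = (β 1 * (s - u * α 0) - β 0 * (t - u * α 1)) := by
    intro s t u
    have g0 : lin (cvec N.d0) (N.pt s t u) = s := N.lin0 _ _ _
    have g1 : lin (cvec N.d1) (N.pt s t u) = t := N.lin1 _ _ _
    have g2 : lin (cvec l) (N.pt s t u) = u := N.lin2 _ _ _
    have hadd : lin (cvec m) (N.pt s t u) = β 1 * lin (cvec N.d0) (N.pt s t u) +
        (-β 0) * lin (cvec N.d1) (N.pt s t u) +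
        (β 0 * α 1 - β 1 * α 0) * lin (cvec l) (N.pt s t u) := by
      simp only [lin, cvec, hm, Fin.sum_univ_three, Pi.add_apply, Pi.smul_apply, smul_eq_mul]
      push_cast
      ring
    rw [hadd, g0, g1, g2]
    ring
  have H : N.Chart m α β := ⟨hne, 1, one_ne_zero, fun s t u => by rw [hl]; simp⟩
  have hm0 : m ≠ 0 := by simpa using H.ne_smul 0
  obtain ⟨a, ha⟩ := Projectivization.exists_smul_eq_mk_rep ℝ m hm0
  refine ⟨Projectivization.mk ℝ m hm0, α, β, ρ, ⟨hne, a, a.ne_zero, fun s t u => ?_⟩, rfl⟩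
  rw [← ha, show a • m = (a : ℝ) • m from rfl, lin_smul_left, hl]

theorem NormalForm.Over.left_unique (hs : SmoothQuartic f) (hE : OnCubic N.tri E)
    (hE' : OnCubic N.tri E') (h : N.Over E l') (h' : N.Over E' l') : E = E' := by
  obtain ⟨α, β, ρ, H, rfl⟩ := h
  obtain ⟨α', β', ρ', H', rfl⟩ := h'
  obtain ⟨k, hk, hl⟩ := H.eq
  obtain ⟨k', hk', hl'⟩ := H'.eq
  have hz : ∀ s t u : ℝ, β' 1 * (s - u * α' 0) - β' 0 * (t - u * α' 1) = 0 →
      β 1 * (s - u * α 0) - β 0 * (t - u * α 1) = 0 := by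
    intro s t u h
    have h1 : (k : ℂ) * (β 1 * (s - u * α 0) - β 0 * (t - u * α 1)) = 0 := by
      rw [← hl, hl', mul_eq_zero]
      exact .inr (by exact_mod_cast h)
    have h2 : k * (β 1 * (s - u * α 0) - β 0 * (t - u * α 1)) = 0 := by exact_mod_cast h1
    exact (mul_eq_zero.1 h2).resolve_left hk
  have aux : ∀ x y : ℝ, β 1 * x - β 0 * y = 0 → ∃ c, x = c * β 0 ∧ y = c * β 1 := by
    intro x y h
    by_cases h0 : β 0 = 0
    · have h1 : β 1 ≠ 0 := fun h1 => H.ne ⟨h0, h1⟩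
      refine ⟨y / β 1, ?_, by field_simp⟩
      rw [h0] at h ⊢
      simpa [h1] using h
    · refine ⟨x / β 0, by field_simp, ?_⟩
      field_simp
      linear_combination -h
  obtain ⟨c, hc0, hc1⟩ := aux (α' 0 - α 0) (α' 1 - α 1)
    (by linear_combination hz (α' 0) (α' 1) 1 (by ring))
  obtain ⟨d, hd0, hd1⟩ := aux (β' 0) (β' 1) (by linear_combination hz (β' 0) (β' 1) 0 (by ring))
  have hd : d ≠ 0 := by
    rintro rfl
    exact H'.ne ⟨by simpa using hd0, by simpa using hd1⟩
  have hA : liftA α' (ρ' 0) ∈ liftLine α' β' ρ' := Submodule.subset_span (by simp)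
  have hB : liftB β' (ρ' 1) ∈ liftLine α' β' ρ' := Submodule.subset_span (by simp)
  obtain ⟨ρ'', hρ⟩ : ∃ ρ'' : Fin 2 → ℝ, ρ'' = ![ρ' 0 - c / d * ρ' 1, ρ' 1 / d] := ⟨_, rfl⟩
  have e1 : liftA α (ρ'' 0) = liftA α' (ρ' 0) - (c / d) • liftB β' (ρ' 1) := by
    ext i
    fin_cases i
    · simp [liftA, liftB, hd0]
      field_simp
      linear_combination -hc0
    · simp [liftA, liftB, hd1]
      field_simp
      linear_combination -hc1
    · simp [liftA, liftB]
    · simp [liftA, liftB, hρ]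
  have e2 : liftB β (ρ'' 1) = d⁻¹ • liftB β' (ρ' 1) := by
    ext i
    fin_cases i
    · simp [liftB, hd0, hd]
    · simp [liftB, hd1, hd]
    · simp [liftB]
    · simp [liftB, hρ]
      ring
  have hEE : liftLine α' β' ρ' = liftLine α β ρ'' := by
    refine span_pair_eq_of_mem hE'.1 ?_ ?_ (indep2_lift H.ne _ _)
    · rw [e1]
      exact sub_mem hA (Submodule.smul_mem _ _ hB)
    · rw [e2]
      exact Submodule.smul_mem _ _ hB
  rw [hEE] at hE' ⊢
  rw [NormalForm.liftLine_unique hs H.ne hE hE']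

theorem NormalForm.Over.right_unique {L L' : Projectivization ℝ (Fin 3 → ℝ)}
    (h : N.Over E L.rep) (h' : N.Over E L'.rep) : L = L' := by
  obtain ⟨α, β, ρ, H, rfl⟩ := h
  obtain ⟨α', β', ρ', H', hE⟩ := h'
  obtain ⟨k, hk, hl⟩ := H.eq
  obtain ⟨k', hk', hl'⟩ := H'.eq
  have hA : liftA α' (ρ' 0) ∈ liftLine α β ρ := hE ▸ Submodule.subset_span (by simp)
  have hB : liftB β' (ρ' 1) ∈ liftLine α β ρ := hE ▸ Submodule.subset_span (by simp)
  obtain ⟨x, y, hA⟩ := Submodule.mem_span_pair.1 hA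
  obtain ⟨z, w, hB⟩ := Submodule.mem_span_pair.1 hB
  have a0 := congrFun hA 0
  have a1 := congrFun hA 1
  have a2 := congrFun hA 2
  have b0 := congrFun hB 0
  have b1 := congrFun hB 1
  have b2 := congrFun hB 2
  simp [liftA, liftB] at a0 a1 a2 b0 b1 b2
  subst a2 b2
  simp only [zero_mul, zero_add, one_mul] at a0 a1 b0 b1
  have hk0 : (k : ℂ) ≠ 0 := by exact_mod_cast hk
  have h : cvec L'.rep = cvec ((k' * w / k) • L.rep) := by
    refine N.lin_ext fun s t u => ?_
    rw [lin_smul_left, hl, hl', ← a0, ← a1, ← b0, ← b1]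
    push_cast
    field_simp
    ring
  have h' : L'.rep = (k' * w / k) • L.rep := by
    ext i
    have := congrFun h i
    simp only [cvec] at this
    exact_mod_cast this
  rw [← L.mk_rep, ← L'.mk_rep, eq_comm, Projectivization.mk_eq_mk_iff']
  exact ⟨_, h'.symm⟩

theorem ne_mk_iff {V : Type*} [AddCommGroup V] [Module ℝ V] {v : V} (hv : v ≠ 0)
    (L : Projectivization ℝ V) :
    L ≠ Projectivization.mk ℝ v hv ↔ ∀ k : ℝ, L.rep ≠ k • v := by
  conv_lhs => rw [← L.mk_rep]
  rw [Ne, Projectivization.mk_eq_mk_iff', not_exists]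
  exact forall_congr' fun k => not_congr eq_comm

end Correspondence

theorem sum_eq_card_sub_card {ι : Type*} (S : Finset ι) {w : ι → ℤ}
    (hw : ∀ i, w i = 1 ∨ w i = -1) :
    ∑ i ∈ S, w i = ((S.filter (w · = 1)).card : ℤ) - ((S.filter (w · = -1)).card : ℤ) := by
  rw [Finset.card_filter, Finset.card_filter]
  push_cast
  rw [← Finset.sum_sub_distrib]
  refine Finset.sum_congr rfl fun i _ => ?_
  rcases hw i with h | h <;> simp [h]

theorem NormalForm.exists_over_of_isBitangent {f : MvPolynomial (Fin 3) ℝ} {l l' : Fin 3 → ℝ}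
    (N : NormalForm f l) (hf : f.IsHomogeneous 4) (hs : SmoothQuartic f)
    (hne : ∀ k : ℝ, l' ≠ k • l) (h : IsBitangent f (cvec l')) :
    ∃ E, OnCubic N.tri E ∧ N.Over E l' := by
  obtain ⟨α, β, H⟩ := N.exists_chart hne
  obtain ⟨_, _, h⟩ := h
  obtain ⟨ρ, _, _, _, _, _, hE, -⟩ := H.exists_liftLine hf hs h
  exact ⟨_, hE, α, β, ρ, H, rfl⟩

theorem NormalForm.Over.hasQtype_iff {f : MvPolynomial (Fin 3) ℝ} {l l' : Fin 3 → ℝ}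
    {N : NormalForm f l} {E : Submodule ℝ (Fin 4 → ℝ)} (h : N.Over E l') (hf : f.IsHomogeneous 4)
    (hs : SmoothQuartic f) (hE : OnCubic N.tri E) (ε : ℤ) :
    HasQtype f l (cvec l') ε ↔ ε = segre N.tri E := by
  obtain ⟨α, β, ρ, H, rfl⟩ := h
  exact H.hasQtype_iff hf hs hE ε

theorem NormalForm.setOf_hasQtype_eq_image {f : MvPolynomial (Fin 3) ℝ} {l : Fin 3 → ℝ}
    (N : NormalForm f l) (hf : f.IsHomogeneous 4) (hs : SmoothQuartic f) (hl : l ≠ 0)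
    {S : Finset (Submodule ℝ (Fin 4 → ℝ))} (hS : ∀ E, E ∈ S ↔ OnCubic N.tri E)
    {Λ : Submodule ℝ (Fin 4 → ℝ) → Projectivization ℝ (Fin 3 → ℝ)}
    (hΛ : ∀ E ∈ S, N.Over E (Λ E).rep) (ε : ℤ) :
    {L ∈ realBitangents f | L ≠ Projectivization.mk ℝ l hl ∧ HasQtype f l (cvec L.rep) ε} =
      Λ '' ↑(S.filter (segre N.tri · = ε)) := by
  ext L
  simp only [Set.mem_ofPred_eq, Set.mem_image, Finset.mem_coe, Finset.mem_filter]
  constructor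
  · rintro ⟨hb, hne, hq⟩
    obtain ⟨E, hE, hO⟩ := N.exists_over_of_isBitangent hf hs ((ne_mk_iff hl L).1 hne) hb
    have hES := (hS E).2 hE
    exact ⟨E, ⟨hES, ((hO.hasQtype_iff hf hs hE ε).1 hq).symm⟩, (hΛ E hES).right_unique hO⟩
  · rintro ⟨E, ⟨hES, rfl⟩, rfl⟩
    have hE := (hS E).1 hES
    refine ⟨?_, (ne_mk_iff hl _).2 ?_, ((hΛ E hES).hasQtype_iff hf hs hE _).2 rfl⟩
    · obtain ⟨α, β, ρ, H, rfl⟩ := hΛ E hES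
      obtain ⟨z₁, z₂, h, -⟩ := H.isBitangent hs hE
      exact ⟨z₁, z₂, h⟩
    · obtain ⟨α, β, ρ, H, -⟩ := hΛ E hES
      exact H.ne_smul

/-- If `L∞ = V(ℓ∞)` is a real bitangent of the smooth quartic `V(f)`,
then every real bitangent `L ≠ L∞` has its tangency points off `L∞` (so its Qtype
relative to `L∞` is defined, and uniquely so), and
#{L ≠ L∞ : Qtype = +1} − #{L ≠ L∞ : Qtype = −1} = 3. -/
theorem statement2 (f : MvPolynomial (Fin 3) ℝ) (hf : f.IsHomogeneous 4)
    (hsm : SmoothQuartic f)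
    (ℓinf : Fin 3 → ℝ) (hinf : ℓinf ≠ 0)
    (hbinf : IsBitangent f (cvec ℓinf)) :
    (∀ L ∈ realBitangents f, L ≠ Projectivization.mk ℝ ℓinf hinf →
        (∀ z₁ z₂ : Fin 3 → ℂ, IsBitangentAt f (cvec L.rep) z₁ z₂ →
          lin (cvec ℓinf) z₁ ≠ 0 ∧ lin (cvec ℓinf) z₂ ≠ 0) ∧
        (∃! ε : ℤ, HasQtype f ℓinf (cvec L.rep) ε)) ∧
    {L ∈ realBitangents f | L ≠ Projectivization.mk ℝ ℓinf hinf ∧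
        HasQtype f ℓinf (cvec L.rep) 1}.Finite ∧
    {L ∈ realBitangents f | L ≠ Projectivization.mk ℝ ℓinf hinf ∧
        HasQtype f ℓinf (cvec L.rep) (-1)}.Finite ∧
    ({L ∈ realBitangents f | L ≠ Projectivization.mk ℝ ℓinf hinf ∧
        HasQtype f ℓinf (cvec L.rep) 1}.ncard : ℤ) -
      ({L ∈ realBitangents f | L ≠ Projectivization.mk ℝ ℓinf hinf ∧
        HasQtype f ℓinf (cvec L.rep) (-1)}.ncard : ℤ) = 3 := by
  obtain ⟨N⟩ := exists_normalForm hf hinf hbinf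
  obtain ⟨S, hS, hsum⟩ := N.exists_sum_segre hsm
  choose! Λ hΛ using fun E (hE : E ∈ S) => NormalForm.exists_over hsm ((hS E).1 hE)
  have hinj : Set.InjOn Λ S := fun E hE E' hE' h =>
    (hΛ E hE).left_unique hsm ((hS E).1 hE) ((hS E').1 hE') (h ▸ hΛ E' hE')
  have himage := N.setOf_hasQtype_eq_image hf hsm hinf hS hΛ
  have hcard (ε : ℤ) : (Λ '' ↑(S.filter (segre N.tri · = ε))).ncard =
      (S.filter (segre N.tri · = ε)).card := by
    rw [(hinj.mono (Finset.coe_subset.2 (Finset.filter_subset _ _))).ncard_image,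
      Set.ncard_coe_finset]
  refine ⟨fun L hL hne => ⟨fun z₁ z₂ h => ?_, ?_⟩, ?_, ?_, ?_⟩
  · obtain ⟨α, β, H⟩ := N.exists_chart ((ne_mk_iff hinf L).1 hne)
    exact H.tangency_off hf hsm h
  · obtain ⟨E, hE, hO⟩ := N.exists_over_of_isBitangent hf hsm ((ne_mk_iff hinf L).1 hne) hL
    simp only [hO.hasQtype_iff hf hsm hE]
    exact existsUnique_eq
  · rw [himage]
    exact (Finset.finite_toSet _).image Λ
  · rw [himage]
    exact (Finset.finite_toSet _).image Λ
  · rw [himage, himage, hcard, hcard, ← sum_eq_card_sub_card S segre_eq_or, hsum]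

end
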